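/- Let K be a universal class with amalgamation and arbitrarily large models. If K is categorical in some cardinal λ > LS(K), then K is categorical in every cardinal λ' ≥ min(λ, ℶ_{(2^{LS(K)})⁺}). -/

import Mathlib

/-!
# Categoricity transfer for universal classes with amalgamation

A universal class is a class of structures in a fixed vocabulary closed under isomorphisms,
substructures, and unions of `⊆`-increasing chains (equivalently, direct limits of systems of
embeddings indexed by a nonempty linear order), ordered by the substructure relation.  Every
universal class is an AEC with `LS(K) = |τ(K)| + ℵ₀`.
-/

universe u

open FirstOrder Cardinal

/-- A bundled `L`-structure with carrier in `Type u`. -/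
structure StrucOf (L : FirstOrder.Language.{u, u}) : Type (u + 1) where
  /-- the carrier -/
  α : Type u
  [str : L.Structure α]

attribute [instance] StrucOf.str

namespace StrucOf

variable (L : FirstOrder.Language.{u, u})

/-- `K` is a universal class: a class of `L`-structures closed under isomorphisms,
substructures, and unions of `⊆`-increasing chains (formalized as direct limits of chains of
embeddings indexed by a nonempty linear order). -/
def IsUniversalClass (K : Set (StrucOf L)) : Prop :=
  (∀ M ∈ K, ∀ N : StrucOf L, Nonempty (M.α ≃[L] N.α) → N ∈ K) ∧
  (∀ M ∈ K, ∀ S : L.Substructure M.α, (⟨↥S⟩ : StrucOf L) ∈ K) ∧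
  (∀ (ι : Type u) [LinearOrder ι] [Nonempty ι] [IsDirected ι (· ≤ ·)]
    (G : ι → Type u) [∀ i, L.Structure (G i)]
    (f : ∀ i j : ι, i ≤ j → G i ↪[L] G j) [DirectedSystem G fun i j h => ⇑(f i j h)],
    (∀ i, (⟨G i⟩ : StrucOf L) ∈ K) → (⟨L.DirectLimit G f⟩ : StrucOf L) ∈ K)

/-- `K` is categorical in `μ`: it has exactly one member of cardinality `μ` up to
isomorphism. -/
def Categorical (K : Set (StrucOf L)) (μ : Cardinal.{u}) : Prop :=
  (∃ M ∈ K, #M.α = μ) ∧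
  ∀ M ∈ K, ∀ N ∈ K, #M.α = μ → #N.α = μ → Nonempty (M.α ≃[L] N.α)

/-- `K` has the amalgamation property. -/
def Amalgamation (K : Set (StrucOf L)) : Prop :=
  ∀ M ∈ K, ∀ N₁ ∈ K, ∀ N₂ ∈ K, ∀ (f₁ : M.α ↪[L] N₁.α) (f₂ : M.α ↪[L] N₂.α),
    ∃ P ∈ K, ∃ (g₁ : N₁.α ↪[L] P.α) (g₂ : N₂.α ↪[L] P.α), g₁.comp f₁ = g₂.comp f₂

/-- `K` has arbitrarily large models. -/
def ArbitrarilyLargeModels (K : Set (StrucOf L)) : Prop :=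
  ∀ μ : Cardinal.{u}, ∃ M ∈ K, μ ≤ #M.α

section Atoms

open FirstOrder.Language

universe v w x

variable {L : FirstOrder.Language.{u, u}}

/-- Atomic formulas with variables in `ι`. -/
inductive Atm (L : FirstOrder.Language.{u, u}) (ι : Type v) : Type (max u v)
  | eq (t s : L.Term ι) : Atm L ι
  | rel {n : ℕ} (R : L.Relations n) (ts : Fin n → L.Term ι) : Atm L ι

/-- Truth of an atomic formula under an assignment. -/
def Atm.Holds {ι : Type v} {M : Type w} [L.Structure M] (f : ι → M) : Atm L ι → Prop
  | .eq t s => t.realize f = s.realize f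
  | .rel R ts => Structure.RelMap R fun k => (ts k).realize f

/-- Substitution of terms for variables in an atomic formula. -/
def Atm.subst {ι : Type v} {θ : Type x} (g : ι → L.Term θ) : Atm L ι → Atm L θ
  | .eq t s => .eq (t.subst g) (s.subst g)
  | .rel R ts => .rel R fun k => (ts k).subst g

theorem Atm.holds_subst {ι : Type v} {θ : Type x} {M : Type w} [L.Structure M] (f : θ → M)
    (g : ι → L.Term θ) (φ : Atm L ι) :
    (φ.subst g).Holds f ↔ φ.Holds fun k => (g k).realize f := by
  cases φ <;> simp [Atm.subst, Atm.Holds]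

/-- The quantifier-free type of an indexed family. -/
def tp {ι : Type v} {M : Type w} [L.Structure M] (f : ι → M) : Set (Atm L ι) :=
  {φ | φ.Holds f}

theorem mem_tp {ι : Type v} {M : Type w} [L.Structure M] {f : ι → M} {φ : Atm L ι} :
    φ ∈ tp f ↔ φ.Holds f := Iff.rfl

/-- Pull-back of a set of atoms along a substitution. -/
def pull {ι : Type v} {θ : Type x} (g : ι → L.Term θ) (T : Set (Atm L θ)) : Set (Atm L ι) :=
  {φ | φ.subst g ∈ T}

/-- Restriction of a set of atoms along a map of variables. -/
def res {ι : Type v} {θ : Type x} (g : ι → θ) (T : Set (Atm L θ)) : Set (Atm L ι) :=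
  pull (fun k => Term.var (g k)) T

theorem pull_tp {ι : Type v} {θ : Type x} {M : Type w} [L.Structure M] (f : θ → M)
    (g : ι → L.Term θ) : pull g (tp f) = tp fun k => (g k).realize f := by
  ext φ; exact Atm.holds_subst f g φ

theorem res_tp {ι : Type v} {θ : Type x} {M : Type w} [L.Structure M] (f : θ → M)
    (g : ι → θ) : res (L := L) g (tp f) = tp (f ∘ g) := pull_tp f _

theorem Term.subst_var_comp {ι : Type v} {θ : Type x} {ζ : Type w} (g : ι → θ)
    (h : θ → L.Term ζ) (t : L.Term ι) :
    (t.subst fun k => (Term.var (g k) : L.Term θ)).subst h = t.subst fun k => h (g k) := by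
  induction t with
  | var => rfl
  | func f ts ih => simp only [Term.subst]; congr 1; funext k; exact ih k

theorem res_res {ι : Type v} {θ : Type x} {ζ : Type w} (g : ι → θ) (h : θ → ζ)
    (T : Set (Atm L ζ)) : res g (res h T) = res (h ∘ g) T := by
  ext φ
  change (φ.subst _).subst _ ∈ T ↔ φ.subst _ ∈ T
  cases φ <;> simp [Atm.subst, Term.subst_var_comp]

theorem tp_comp {ι : Type v} {θ : Type x} {M : Type w} {N : Type*} [L.Structure M]
    [L.Structure N] {f : θ → M} {f' : θ → N} (h : tp (L := L) f = tp f') (g : ι → θ) :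
    tp (L := L) (f ∘ g) = tp (f' ∘ g) := by
  rw [← res_tp, ← res_tp, h]

theorem tp_term {ι : Type v} {θ : Type x} {M : Type w} {N : Type*} [L.Structure M]
    [L.Structure N] {f : θ → M} {f' : θ → N} (h : tp (L := L) f = tp f')
    (g : ι → L.Term θ) :
    tp (L := L) (fun k => (g k).realize f) = tp (fun k => (g k).realize f') := by
  rw [← pull_tp, ← pull_tp, h]

theorem tp_embedding {ι : Type v} {M : Type w} {N : Type*} [L.Structure M]
    [L.Structure N] (e : M ↪[L] N) (f : ι → M) : tp (L := L) (e ∘ f) = tp f := by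
  ext φ
  cases φ with
  | eq t s =>
    simp only [mem_tp, Atm.Holds, HomClass.realize_term]
    exact e.injective.eq_iff
  | rel R ts =>
    simp only [mem_tp, Atm.Holds, HomClass.realize_term]
    exact e.map_rel R _

theorem eq_of_tp_eq {ι : Type v} {M : Type w} {N : Type*} [L.Structure M]
    [L.Structure N] {f : ι → M} {g : ι → N} (h : tp (L := L) f = tp g) (t s : L.Term ι) :
    t.realize f = s.realize f ↔ t.realize g = s.realize g := by
  have : Atm.eq t s ∈ tp (L := L) f ↔ Atm.eq t s ∈ tp (L := L) g := by rw [h]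
  exact this

theorem apply_eq_of_tp_eq {ι : Type v} {M : Type w} {N : Type*} [L.Structure M]
    [L.Structure N] {f : ι → M} {g : ι → N} (h : tp (L := L) f = tp g) (a b : ι) :
    f a = f b ↔ g a = g b := eq_of_tp_eq h (Term.var a) (Term.var b)

/-- The substructure generated by a family. -/
def gen (L : FirstOrder.Language.{u, u}) {ι : Type v} {M : Type w} [L.Structure M] (f : ι → M) :
    L.Substructure M :=
  Substructure.closure L (Set.range f)

theorem mem_gen {ι : Type v} {M : Type w} [L.Structure M] {f : ι → M} {x : M} :
    x ∈ gen L f ↔ ∃ t : L.Term ι, t.realize f = x := by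
  constructor
  · intro h
    refine Substructure.closure_induction (p := fun x => ∃ t : L.Term ι, t.realize f = x) h ?_ ?_
    · rintro _ ⟨k, rfl⟩; exact ⟨Term.var k, rfl⟩
    · intro n F xs hxs
      choose ts hts using hxs
      refine ⟨Term.func F ts, ?_⟩
      simp [hts]
  · rintro ⟨t, rfl⟩
    induction t with
    | var k => exact Substructure.subset_closure ⟨k, rfl⟩
    | func F ts ih => exact (gen L f).fun_mem F _ ih

theorem apply_mem_gen {ι : Type v} {M : Type w} [L.Structure M] (f : ι → M) (k : ι) :
    f k ∈ gen L f := Substructure.subset_closure ⟨k, rfl⟩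

theorem realize_mem_gen {ι : Type v} {M : Type w} [L.Structure M] (f : ι → M) (t : L.Term ι) :
    t.realize f ∈ gen L f := mem_gen.2 ⟨t, rfl⟩

theorem gen_le {ι : Type v} {M : Type w} [L.Structure M] {f : ι → M} {S : L.Substructure M} :
    gen L f ≤ S ↔ ∀ k, f k ∈ S := by
  simp [gen, Substructure.closure_le, Set.range_subset_iff]

theorem gen_comp_le {ι : Type v} {θ : Type x} {M : Type w} [L.Structure M] (f : ι → M)
    (g : θ → ι) : gen L (f ∘ g) ≤ gen L f := gen_le.2 fun k => apply_mem_gen f (g k)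

/-- The family, as a family in the generated substructure. -/
def toGen (L : FirstOrder.Language.{u, u}) {ι : Type v} {M : Type w} [L.Structure M]
    (f : ι → M) : ι → gen L f := fun k => ⟨f k, apply_mem_gen f k⟩

theorem gen_embedding {ι : Type v} {M : Type w} {N : Type*} [L.Structure M]
    [L.Structure N] (e : M ↪[L] N) (f : ι → M) (x : M) :
    e x ∈ gen L (e ∘ f) ↔ x ∈ gen L f := by
  simp only [mem_gen, HomClass.realize_term, e.injective.eq_iff]

theorem tp_toGen {ι : Type v} {M : Type w} [L.Structure M] (f : ι → M) :
    tp (L := L) (toGen L f) = tp f :=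
  (tp_embedding (gen L f).subtype (toGen L f)).symm

theorem gen_toGen {ι : Type v} {M : Type w} [L.Structure M] (f : ι → M) (x : gen L f) :
    x ∈ gen L (toGen L f) :=
  (gen_embedding (gen L f).subtype (toGen L f) x).1 x.2

theorem gen_toGen_eq_top {ι : Type v} {M : Type w} [L.Structure M] (f : ι → M) :
    gen L (toGen L f) = ⊤ := by
  ext x; simp [gen_toGen]

theorem exists_embedding_of_tp_eq {ι : Type v} {M : Type w} {N : Type*} [L.Structure M]
    [L.Structure N] {f : ι → M} {g : ι → N} (h : tp (L := L) f = tp g) (hf : gen L f = ⊤) :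
    ∃ e : M ↪[L] N, ∀ k, e (f k) = g k := by
  have hx : ∀ x : M, ∃ t : L.Term ι, t.realize f = x := fun x =>
    mem_gen.1 (hf ▸ Substructure.mem_top x)
  choose t ht using hx
  have key : ∀ s : L.Term ι, (t (s.realize f)).realize g = s.realize g := fun s =>
    (eq_of_tp_eq h _ _).1 (ht _)
  refine ⟨⟨⟨fun x => (t x).realize g, ?_⟩, ?_, ?_⟩, ?_⟩
  · intro x y hxy
    have := (eq_of_tp_eq h _ _).2 hxy
    rwa [ht, ht] at this
  · intro n F xs
    have := key (Term.func F fun k => t (xs k))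
    simpa [ht, Function.comp_def] using this
  · intro n R xs
    have : Atm.rel R (fun k => t (xs k)) ∈ tp (L := L) f ↔
      Atm.rel R (fun k => t (xs k)) ∈ tp (L := L) g := by rw [h]
    simpa [mem_tp, Atm.Holds, ht, Function.comp_def] using this.symm
  · intro k
    exact key (Term.var k)

theorem exists_equiv_of_tp_eq {ι : Type v} {M : Type w} {N : Type*} [L.Structure M]
    [L.Structure N] {f : ι → M} {g : ι → N} (h : tp (L := L) f = tp g) (hf : gen L f = ⊤)
    (hg : gen L g = ⊤) : ∃ e : M ≃[L] N, ∀ k, e (f k) = g k := by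
  obtain ⟨e, he⟩ := exists_embedding_of_tp_eq h hf
  have hs : Function.Surjective e := by
    intro y
    obtain ⟨t, ht⟩ := mem_gen.1 (hg ▸ Substructure.mem_top y)
    refine ⟨t.realize f, ?_⟩
    rw [← HomClass.realize_term, ← ht]
    congr 1
    funext k; exact he k
  refine ⟨⟨Equiv.ofBijective e ⟨e.injective, hs⟩, fun F x => e.map_fun F x,
    fun R x => e.map_rel R x⟩, he⟩

/-- An embedding of the generated substructure sending one family to the other. -/
theorem exists_gen_embedding {ι : Type v} {M : Type w} {N : Type*} [L.Structure M]
    [L.Structure N] {f : ι → M} {g : ι → N} (h : tp (L := L) f = tp g) :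
    ∃ e : gen L f ↪[L] N, ∀ k, e (toGen L f k) = g k :=
  exists_embedding_of_tp_eq ((tp_toGen f).trans h) (gen_toGen_eq_top f)

theorem Term.exists_finset {ι : Type v} (t : L.Term ι) : ∃ s : Finset ι, ∀ s', s ⊆ s' →
    ∃ r : L.Term s', r.subst (fun k => (Term.var k.1 : L.Term ι)) = t := by
  classical
  induction t with
  | var k => exact ⟨{k}, fun s' hs' => ⟨Term.var ⟨k, hs' (by simp)⟩, rfl⟩⟩
  | func F ts ih =>
    choose s hs using ih
    refine ⟨Finset.univ.biUnion s, fun s' hs' => ?_⟩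
    choose r hr using fun k => hs k s' ((Finset.subset_biUnion_of_mem s
      (Finset.mem_univ k)).trans hs')
    exact ⟨Term.func F r, by simp [Term.subst, hr]⟩

theorem Atm.exists_finset {ι : Type v} (φ : Atm L ι) : ∃ s : Finset ι, ∃ ψ : Atm L s,
    ψ.subst (fun k => Term.var k.1) = φ := by
  classical
  cases φ with
  | eq t s =>
    obtain ⟨s₁, h₁⟩ := Term.exists_finset t
    obtain ⟨s₂, h₂⟩ := Term.exists_finset s
    obtain ⟨r₁, hr₁⟩ := h₁ (s₁ ∪ s₂) Finset.subset_union_left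
    obtain ⟨r₂, hr₂⟩ := h₂ (s₁ ∪ s₂) Finset.subset_union_right
    exact ⟨_, .eq r₁ r₂, by simp [Atm.subst, hr₁, hr₂]⟩
  | rel R ts =>
    choose s hs using fun k => Term.exists_finset (ts k)
    choose r hr using fun k => hs k (Finset.univ.biUnion s) (Finset.subset_biUnion_of_mem s
        (Finset.mem_univ k))
    exact ⟨_, .rel R r, by simp [Atm.subst, hr]⟩

/-- Finite character of types. -/
theorem tp_eq_of_finite {ι : Type v} {M : Type w} {N : Type*} [L.Structure M]
    [L.Structure N] {f : ι → M} {g : ι → N}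
    (h : ∀ s : Finset ι, tp (L := L) (fun k : s => f k) = tp (fun k : s => g k)) :
    tp (L := L) f = tp g := by
  ext φ
  obtain ⟨s, ψ, rfl⟩ := φ.exists_finset
  simp only [mem_tp, Atm.holds_subst, Term.realize_var]
  have : ψ ∈ tp (L := L) (fun k : s => f k) ↔ ψ ∈ tp (L := L) (fun k : s => g k) := by rw [h s]
  exact this

theorem Term.card_le_max {ι : Type v} :
    #(L.Term ι) ≤ max ℵ₀ (Cardinal.lift.{u} #ι + Cardinal.lift.{v} L.card) := by
  refine Term.card_le.trans (max_le_max le_rfl ?_)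
  rw [mk_sum]
  refine add_le_add le_rfl ?_
  rw [Language.card, Language.Symbols, mk_sum]
  simp

theorem Atm.card_le {ι : Type v} :
    #(Atm L ι) ≤ max ℵ₀ (Cardinal.lift.{u} #ι + Cardinal.lift.{v} L.card) := by
  set μ := max ℵ₀ (Cardinal.lift.{u} #ι + Cardinal.lift.{v} L.card)
  have hμ : ℵ₀ ≤ μ := le_max_left _ _
  have ht : #(L.Term ι) ≤ μ := Term.card_le_max
  let e : Atm L ι → (L.Term ι × L.Term ι) ⊕ ((Σ n, L.Relations n) × List (L.Term ι)) := fun φ =>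
    match φ with
    | .eq t s => Sum.inl (t, s)
    | .rel R ts => Sum.inr (⟨_, R⟩, List.ofFn ts)
  have he : Function.Injective e := by
    intro φ ψ h
    cases φ <;> cases ψ <;> simp [e] at h
    · obtain ⟨rfl, rfl⟩ := h; rfl
    · obtain ⟨⟨rfl, h1⟩, h2⟩ := h
      obtain rfl := eq_of_heq h1
      obtain rfl := List.ofFn_injective h2
      rfl
  have hR : Cardinal.lift.{v} #(Σ n, L.Relations n) ≤ μ := by
    refine le_trans ?_ (le_max_right _ _)
    refine le_trans ?_ (self_le_add_left _ _)
    rw [Language.card, Language.Symbols, mk_sum]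
    simp
  refine (mk_le_of_injective he).trans ?_
  rw [mk_sum, mk_prod, mk_prod]
  simp only [Cardinal.lift_id]
  have hl : #(List (L.Term ι)) ≤ μ := (mk_list_le_max _).trans (max_le hμ ht)
  refine add_le_of_le hμ (?_) ?_
  · exact mul_le_of_le hμ ht ht
  · refine mul_le_of_le hμ ?_ ?_
    · refine le_trans (le_of_eq ?_) hR
      rw [← Cardinal.lift_umax.{u, v}]
    · exact (Cardinal.lift_id'.{u, v} _).trans_le hl

end Atoms

theorem exists_initial_wellOrder (α : Type u) : ∃ (_ : LinearOrder α) (_ : WellFoundedLT α),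
    ∀ a : α, #(Set.Iio a) < #α := by
  classical
  obtain ⟨r, wo, hr⟩ := Cardinal.exists_ord_eq α
  let := linearOrderOfSTO r
  refine ⟨this, ⟨wo.wf⟩, fun a => ?_⟩
  have h := Ordinal.typein_lt_type r a
  rw [← hr, Cardinal.lt_ord] at h
  exact h

section Classes

open FirstOrder.Language

universe v w x

variable {L : FirstOrder.Language.{u, u}} {K : Set (StrucOf L)}

instance : CoeSort (StrucOf L) (Type u) := ⟨StrucOf.α⟩

theorem mem_of_equiv (hK : IsUniversalClass L K) {M N : StrucOf L} (hM : M ∈ K)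
    (e : M ≃[L] N) : N ∈ K := hK.1 M hM N ⟨e⟩

theorem sub_mem (hK : IsUniversalClass L K) {M : StrucOf L} (hM : M ∈ K)
    (S : L.Substructure M) : (⟨S⟩ : StrucOf L) ∈ K := hK.2.1 M hM S

theorem mem_of_embedding (hK : IsUniversalClass L K) {M N : StrucOf L} (hN : N ∈ K)
    (e : M ↪[L] N) : M ∈ K :=
  mem_of_equiv hK (sub_mem hK hN e.toHom.range) e.equivRange.symm

theorem iSup_mem (hK : IsUniversalClass L K) {M : StrucOf L} {ι : Type u} [LinearOrder ι]
    [Nonempty ι] (S : ι → L.Substructure M) (hS : Monotone S)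
    (h : ∀ k, (⟨S k⟩ : StrucOf L) ∈ K) : (⟨(⨆ k, S k : L.Substructure M)⟩ : StrucOf L) ∈ K := by
  let S' : ι →o L.Substructure M := ⟨S, hS⟩
  have := hK.2.2 ι (fun k => S' k) (fun i j hij => Substructure.inclusion (S'.monotone hij)) h
  exact mem_of_equiv hK this (DirectLimit.Equiv_iSup S')

theorem mem_of_top (hK : IsUniversalClass L K) {M : StrucOf L} {S : L.Substructure M}
    (h : (⟨S⟩ : StrucOf L) ∈ K) (hS : S = ⊤) : M ∈ K := by
  subst hS
  exact mem_of_equiv hK h Substructure.topEquiv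

/-- Membership in a universal class is determined by finitely generated substructures. -/
theorem mem_of_finite (hK : IsUniversalClass L K) {M : StrucOf L}
    (h : ∀ s : Finset M, (⟨Substructure.closure L (s : Set M)⟩ : StrucOf L) ∈ K) : M ∈ K := by
  have key : ∀ (c : Cardinal.{u}) (A : Set M), #A = c →
      (⟨Substructure.closure L A⟩ : StrucOf L) ∈ K := by
    intro c
    induction c using WellFoundedLT.induction with
    | ind c ih =>
      intro A hA
      rcases lt_or_ge #A ℵ₀ with hfin | hinf
      · have : A.Finite := Cardinal.lt_aleph0_iff_set_finite.1 hfin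
        obtain ⟨s, rfl⟩ := this.exists_finset_coe
        exact h s
      · obtain ⟨_, _, hlt⟩ := exists_initial_wellOrder A
        have : Infinite A := Cardinal.infinite_iff.2 hinf
        let B : A → Set M := fun a => Subtype.val '' Set.Iic a
        have hB : ∀ a, #(B a) < c := by
          intro a
          refine lt_of_le_of_lt Cardinal.mk_image_le ?_
          rw [← Set.Iio_insert]
          refine lt_of_le_of_lt Cardinal.mk_insert_le ?_
          rw [← hA]
          exact Cardinal.add_lt_of_lt hinf (hlt a) (Cardinal.one_lt_aleph0.trans_le hinf)
        have hmono : Monotone fun a => Substructure.closure L (B a) := fun a b hab =>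
          Substructure.closure_mono (Set.image_mono (Set.Iic_subset_Iic.2 hab))
        have := iSup_mem hK _ hmono fun a => ih _ (hB a) _ rfl
        rw [← Substructure.closure_iUnion] at this
        have hAB : ⋃ a, B a = A := by
          ext x
          simp only [Set.mem_iUnion]
          constructor
          · rintro ⟨a, y, -, rfl⟩; exact y.2
          · exact fun hx => ⟨⟨x, hx⟩, ⟨x, hx⟩, Set.mem_Iic.2 le_rfl, rfl⟩
        rwa [hAB] at this
  exact mem_of_top hK (key _ Set.univ rfl) Substructure.closure_univ

theorem gen_mem (hK : IsUniversalClass L K) {M : StrucOf L} (hM : M ∈ K) {ι : Type v}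
    (f : ι → M) : (⟨gen L f⟩ : StrucOf L) ∈ K := sub_mem hK hM _

/-- A structure lies in the class as soon as every finite tuple has the type of a tuple of
a member of the class. -/
theorem mem_of_tuples (hK : IsUniversalClass L K) {M : StrucOf L}
    (h : ∀ s : Finset M, ∃ N ∈ K, ∃ g : s → N, tp (L := L) (fun k : s => k.1) = tp g) :
    M ∈ K := by
  refine mem_of_finite hK fun s => ?_
  obtain ⟨N, hN, g, hg⟩ := h s
  obtain ⟨e, -⟩ := exists_gen_embedding hg
  have := mem_of_embedding (M := ⟨gen L (fun k : s => k.1)⟩) hK hN e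
  rwa [gen, Subtype.range_coe_subtype] at this

/-- A set of atoms is the type of a family in a member of the class. -/
def IsReal (K : Set (StrucOf L)) {ι : Type v} (T : Set (Atm L ι)) : Prop :=
  ∃ M ∈ K, ∃ f : ι → M, tp (L := L) f = T

theorem isReal_tp {M : StrucOf L} (hM : M ∈ K) {ι : Type v} (f : ι → M) :
    IsReal K (tp (L := L) f) := ⟨M, hM, f, rfl⟩

theorem IsReal.pull {ι : Type v} {θ : Type w} {T : Set (Atm L ι)} (h : IsReal K T)
    (g : θ → L.Term ι) : IsReal K (pull g T) := by
  obtain ⟨M, hM, f, rfl⟩ := h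
  exact ⟨M, hM, _, (pull_tp f g).symm⟩

theorem IsReal.res {ι : Type v} {θ : Type w} {T : Set (Atm L ι)} (h : IsReal K T)
    (g : θ → ι) : IsReal K (res g T) := h.pull _

theorem IsReal.exists_gen (hK : IsUniversalClass L K) {ι : Type v} {T : Set (Atm L ι)}
    (h : IsReal K T) : ∃ M ∈ K, ∃ f : ι → M, tp (L := L) f = T ∧ gen L f = ⊤ := by
  obtain ⟨M, hM, f, rfl⟩ := h
  exact ⟨⟨gen L f⟩, gen_mem hK hM f, toGen L f, tp_toGen f, gen_toGen_eq_top f⟩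

theorem Term.subst_subst {ι : Type v} {θ : Type x} {ζ : Type w} (g : ι → L.Term θ)
    (h : θ → L.Term ζ) (t : L.Term ι) :
    (t.subst g).subst h = t.subst fun k => (g k).subst h := by
  induction t with
  | var => rfl
  | func f ts ih => simp only [Term.subst]; congr 1; funext k; exact ih k

theorem pull_pull {ι : Type v} {θ : Type x} {ζ : Type w} (g : ι → L.Term θ)
    (h : θ → L.Term ζ) (T : Set (Atm L ζ)) :
    pull g (pull h T) = pull (fun k => (g k).subst h) T := by
  ext φ
  change (φ.subst _).subst _ ∈ T ↔ φ.subst _ ∈ T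
  cases φ <;> simp [Atm.subst, Term.subst_subst]

theorem Term.exists_finset_family {ι : Type v} {θ : Type w} [Finite θ] (t : θ → L.Term ι) :
    ∃ s : Finset ι, ∃ r : θ → L.Term s,
      ∀ k, (r k).subst (fun k => (Term.var k.1 : L.Term ι)) = t k := by
  classical
  cases nonempty_fintype θ
  choose s hs using fun k => Term.exists_finset (t k)
  choose r hr using fun k => hs k (Finset.univ.biUnion s) (Finset.subset_biUnion_of_mem s
      (Finset.mem_univ k))
  exact ⟨_, r, hr⟩

theorem isReal_pull_of_finite {ι : Type v} {T : Set (Atm L ι)}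
    (h : ∀ s : Finset ι, IsReal K (res (Subtype.val : s → ι) T)) {θ : Type w} [Finite θ]
    (t : θ → L.Term ι) : IsReal K (pull t T) := by
  obtain ⟨s, r, hr⟩ := Term.exists_finset_family t
  have := (h s).pull r
  rw [StrucOf.res, pull_pull] at this
  convert this using 2
  funext k; exact (hr k).symm

/-- Gluing: a finitely realised set of atoms is realised by a generating family. -/
theorem exists_model (hK : IsUniversalClass L K) {ι : Type u} {T : Set (Atm L ι)}
    (h : ∀ s : Finset ι, IsReal K (res (Subtype.val : s → ι) T)) :
    ∃ M ∈ K, ∃ f : ι → M, tp (L := L) f = T ∧ gen L f = ⊤ := by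
  have loc := fun {θ : Type} [Finite θ] (t : θ → L.Term ι) => isReal_pull_of_finite h t
  have hcongr : ∀ {n : ℕ} (a b : Fin n → L.Term ι), (∀ k, Atm.eq (a k) (b k) ∈ T) →
      (∀ F : L.Functions n, Atm.eq (Term.func F a) (Term.func F b) ∈ T) ∧
      (∀ R : L.Relations n, Atm.rel R a ∈ T ↔ Atm.rel R b ∈ T) := by
    intro n a b hab
    obtain ⟨M, -, v, hv⟩ := loc (Sum.elim a b)
    have h1 : ∀ k, v (Sum.inl k) = v (Sum.inr k) := by
      intro k
      have : Atm.eq (Term.var (Sum.inl k)) (Term.var (Sum.inr k)) ∈ tp (L := L) v := by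
        rw [hv]; exact hab k
      exact this
    constructor
    · intro F
      have : Atm.eq (Term.func F fun k => Term.var (Sum.inl k))
          (Term.func F fun k => Term.var (Sum.inr k)) ∈ tp (L := L) v := by
        simp [mem_tp, Atm.Holds, h1]
      rw [hv] at this; exact this
    · intro R
      have : Atm.rel R (fun k => Term.var (Sum.inl k)) ∈ tp (L := L) v ↔
          Atm.rel R (fun k => Term.var (Sum.inr k)) ∈ tp (L := L) v := by
        simp [mem_tp, Atm.Holds, h1]
      rw [hv] at this; exact this
  let S : Setoid (L.Term ι) :=
    { r := fun t s => Atm.eq t s ∈ T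
      iseqv := by
        refine ⟨fun t => ?_, fun {t s} hts => ?_, fun {t s r} hts hsr => ?_⟩
        · obtain ⟨M, -, v, hv⟩ := loc ![t]
          have : Atm.eq (Term.var 0) (Term.var 0) ∈ tp (L := L) v := rfl
          rw [hv] at this; exact this
        · obtain ⟨M, -, v, hv⟩ := loc ![t, s]
          have h1 : Atm.eq (Term.var 0) (Term.var 1) ∈ tp (L := L) v := by rw [hv]; exact hts
          have : Atm.eq (Term.var 1) (Term.var 0) ∈ tp (L := L) v := Eq.symm h1
          rw [hv] at this; exact this
        · obtain ⟨M, -, v, hv⟩ := loc ![t, s, r]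
          have h1 : Atm.eq (Term.var 0) (Term.var 1) ∈ tp (L := L) v := by rw [hv]; exact hts
          have h2 : Atm.eq (Term.var 1) (Term.var 2) ∈ tp (L := L) v := by rw [hv]; exact hsr
          have : Atm.eq (Term.var 0) (Term.var 2) ∈ tp (L := L) v := Eq.trans h1 h2
          rw [hv] at this; exact this }
  let : L.Structure (Quotient S) :=
    { funMap := fun F xs => ⟦Term.func F fun k => (xs k).out⟧
      RelMap := fun R xs => Atm.rel R (fun k => (xs k).out) ∈ T }
  let f : ι → Quotient S := fun k => ⟦Term.var k⟧
  have hr : ∀ t : L.Term ι, t.realize f = ⟦t⟧ := by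
    intro t
    induction t with
    | var k => rfl
    | func F ts ih =>
      simp only [Term.realize_func, ih]
      exact Quotient.sound ((hcongr _ _ fun k => Quotient.mk_out (ts k)).1 F)
  have hf : tp (L := L) f = T := by
    ext φ
    cases φ with
    | eq t s =>
      rw [mem_tp, Atm.Holds, hr, hr]
      exact Quotient.eq (r := S)
    | rel R ts =>
      rw [mem_tp, Atm.Holds]
      simp only [hr]
      exact (hcongr _ _ fun k => Quotient.mk_out (ts k)).2 R
  refine ⟨⟨Quotient S⟩, ?_, f, hf, ?_⟩
  · refine mem_of_tuples hK fun s => ?_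
    choose t ht using fun k : s => Quotient.exists_rep k.1
    obtain ⟨N, hN, g, hg⟩ := isReal_pull_of_finite h t
    refine ⟨N, hN, g, ?_⟩
    rw [hg, ← hf, pull_tp]
    congr 1
    funext k
    exact ((hr _).trans (ht k)).symm
  · ext x
    obtain ⟨t, rfl⟩ := Quotient.exists_rep x
    simp only [Substructure.mem_top, iff_true]
    exact mem_gen.2 ⟨t, hr t⟩

end Classes

section Amalgam

open FirstOrder.Language

universe v w x

variable {L : FirstOrder.Language.{u, u}} {K : Set (StrucOf L)}

/-- The Löwenheim–Skolem number of the vocabulary. -/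
noncomputable def kap (L : FirstOrder.Language.{u, u}) : Cardinal.{u} := L.card + ℵ₀

theorem aleph0_le_kap : ℵ₀ ≤ kap L := self_le_add_left _ _

theorem card_atm_le (ι : Type u) : #(Atm L ι) ≤ max #ι (kap L) := by
  refine Atm.card_le.trans ?_
  have h := aleph0_le_kap (L := L)
  have h1 : L.card ≤ kap L := self_le_add_right _ _
  simp only [Cardinal.lift_id]
  refine max_le (h.trans (le_max_right _ _)) ?_
  exact add_le_of_le (h.trans (le_max_right _ _)) (le_max_left _ _) (h1.trans (le_max_right _ _))

theorem card_term_le (ι : Type u) : #(L.Term ι) ≤ max #ι (kap L) := by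
  refine Term.card_le_max.trans ?_
  have h := aleph0_le_kap (L := L)
  have h1 : L.card ≤ kap L := self_le_add_right _ _
  simp only [Cardinal.lift_id]
  refine max_le (h.trans (le_max_right _ _)) ?_
  exact add_le_of_le (h.trans (le_max_right _ _)) (le_max_left _ _) (h1.trans (le_max_right _ _))

theorem card_atm_finite (ι : Type) [Finite ι] : #(Atm L ι) ≤ kap L := by
  refine Atm.card_le.trans ?_
  have h := aleph0_le_kap (L := L)
  have h1 : L.card ≤ kap L := self_le_add_right _ _
  have h2 : Cardinal.lift.{u} #ι ≤ ℵ₀ := by simp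
  rw [Cardinal.lift_uzero]
  exact max_le h (add_le_of_le h (h2.trans h) h1)

theorem card_gen_le {M : Type u} [L.Structure M] {ι : Type u} (f : ι → M) :
    #(gen L f) ≤ max #ι (kap L) := by
  refine le_trans ?_ (card_term_le (L := L) ι)
  exact Cardinal.mk_le_of_surjective (f := fun t : L.Term ι => (⟨_, realize_mem_gen f t⟩ : gen L f))
    fun ⟨x, hx⟩ => by obtain ⟨t, rfl⟩ := mem_gen.1 hx; exact ⟨t, rfl⟩

theorem card_le_of_gen {M : Type u} [L.Structure M] {ι : Type u} {f : ι → M}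
    (h : gen L f = ⊤) : #M ≤ max #ι (kap L) := by
  refine le_trans ?_ (card_gen_le (L := L) f)
  exact Cardinal.mk_le_of_injective
    (f := fun x : M => (⟨x, h ▸ Substructure.mem_top x⟩ : gen L f)) fun x y h => by simpa using h

theorem Term.subst_var_injective {ι : Type v} {θ : Type w} {g : ι → θ}
    (hg : Function.Injective g) :
    Function.Injective fun t : L.Term ι => t.subst fun k => (Term.var (g k) : L.Term θ) := by
  intro t
  induction t with
  | var k =>
    intro s h
    cases s with
    | var l => simp only [Term.subst, Term.var.injEq] at h; rw [hg h]
    | func F ts => simp [Term.subst] at h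
  | func F ts ih =>
    intro s h
    cases s with
    | var l => simp [Term.subst] at h
    | func G ss =>
      simp only [Term.subst, Term.func.injEq] at h
      obtain ⟨rfl, h1, h2⟩ := h
      obtain rfl := eq_of_heq h1
      congr 1
      funext k
      exact ih k (congrFun (eq_of_heq h2) k)

theorem Atm.subst_var_injective {ι : Type v} {θ : Type w} {g : ι → θ}
    (hg : Function.Injective g) :
    Function.Injective fun t : Atm L ι => t.subst fun k => (Term.var (g k) : L.Term θ) := by
  intro φ ψ h
  have ht := Term.subst_var_injective (L := L) hg
  cases φ with
  | eq t s =>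
    cases ψ with
    | eq t' s' =>
      simp only [Atm.subst, Atm.eq.injEq] at h
      rw [ht h.1, ht h.2]
    | rel R ts => simp [Atm.subst] at h
  | rel R ts =>
    cases ψ with
    | eq t' s' => simp [Atm.subst] at h
    | rel R' ts' =>
      simp only [Atm.subst, Atm.rel.injEq] at h
      obtain ⟨rfl, h1, h2⟩ := h
      obtain rfl := eq_of_heq h1
      congr 1
      funext k
      exact ht (congrFun (eq_of_heq h2) k)

theorem exists_res_eq {ι : Type v} {θ : Type w} {g : ι → θ} (hg : Function.Injective g)
    (T : Set (Atm L ι)) : ∃ T' : Set (Atm L θ), res g T' = T := by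
  refine ⟨{φ | ∃ ψ ∈ T, ψ.subst (fun k => Term.var (g k)) = φ}, ?_⟩
  ext ψ
  constructor
  · rintro ⟨ψ', h, h'⟩
    rwa [← Atm.subst_var_injective hg h']
  · intro h; exact ⟨ψ, h, rfl⟩

theorem mem_res {ι : Type v} {θ : Type w} {g : ι → θ} {T : Set (Atm L θ)} {φ : Atm L ι} :
    φ ∈ res g T ↔ φ.subst (fun k => Term.var (g k)) ∈ T := Iff.rfl

theorem res_id {ι : Type v} (T : Set (Atm L ι)) : res (fun k => k) T = T := by
  ext φ
  rw [mem_res]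
  have ht : ∀ t : L.Term ι, t.subst (fun k => (Term.var k : L.Term ι)) = t := by
    intro t
    induction t with
    | var => rfl
    | func F ts ih => simp [Term.subst, ih]
  have : φ.subst (fun k => (Term.var k : L.Term ι)) = φ := by
    cases φ <;> simp [Atm.subst, ht]
  rw [this]

/-- Amalgamation, for types. -/
theorem exists_extension (hK : IsUniversalClass L K) (hap : Amalgamation L K) {M N : StrucOf L}
    (hM : M ∈ K) (hN : N ∈ K) {D : Type v} {Y : Type w} {f : D → M} {g : D ⊕ Y → N}
    (h : tp (L := L) f = tp (g ∘ Sum.inl)) :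
    ∃ P ∈ K, ∃ (j : M ↪[L] P) (y : Y → P), tp (L := L) (Sum.elim (j ∘ f) y) = tp g := by
  obtain ⟨e, he⟩ := exists_gen_embedding h
  obtain ⟨P, hP, g₁, g₂, hg⟩ := hap _ (gen_mem hK hM f) M hM N hN (gen L f).subtype e
  refine ⟨P, hP, g₁, g₂ ∘ g ∘ Sum.inr, ?_⟩
  rw [← tp_embedding g₂ g]
  congr 1
  funext s
  rcases s with d | y
  · have := DFunLike.congr_fun hg (toGen L f d)
    simp only [Embedding.comp_apply, he] at this
    exact this
  · rfl

theorem tp_id_embedding {M N : Type*} [L.Structure M] [L.Structure N] {f : M → N}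
    (h : tp (L := L) (id : M → M) = tp f) : ∃ e : M ↪[L] N, ⇑e = f := by
  obtain ⟨e, he⟩ := exists_embedding_of_tp_eq h (by
    ext x; simp only [Substructure.mem_top, iff_true]; exact apply_mem_gen id x)
  exact ⟨e, funext he⟩

/-- Simultaneous extension: a family of types over a model is realised in one extension. -/
theorem exists_extension_family (hK : IsUniversalClass L K) (hap : Amalgamation L K)
    {M : StrucOf L} (hM : M ∈ K) {P : Type u} (D : P → Type u) (Y : P → Type u)
    (f : ∀ p, D p → M) (T : ∀ p, Set (Atm L (D p ⊕ Y p))) (hT : ∀ p, IsReal K (T p))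
    (h : ∀ p, tp (L := L) (f p) = res Sum.inl (T p)) :
    ∃ M' ∈ K, ∃ (j : M ↪[L] M') (y : ∀ p, Y p → M'),
      (∀ p, tp (L := L) (Sum.elim (j ∘ f p) (y p)) = T p) ∧
      gen L (Sum.elim j fun s : Σ p, Y p => y s.1 s.2) = ⊤ := by
  classical
  let V := M ⊕ Σ p, Y p
  let W : Set P → Set V := fun Q => {v | ∀ s, v = Sum.inr s → s.1 ∈ Q}
  have hWmono : ∀ {Q Q'}, Q ⊆ Q' → W Q ⊆ W Q' := fun hQ v hv s hs => hQ (hv s hs)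
  let vp : ∀ p, D p ⊕ Y p → V := fun p => Sum.elim (Sum.inl ∘ f p) fun y => Sum.inr ⟨p, y⟩
  let G : Set P × Set (Atm L V) → Prop := fun X =>
    IsReal K (res (Subtype.val : W X.1 → V) X.2) ∧
    res Sum.inl X.2 = tp (L := L) (id : M → M) ∧ ∀ p ∈ X.1, res (vp p) X.2 = T p
  let r : {X // G X} → {X // G X} → Prop := fun X X' => X.1.1 ⊆ X'.1.1 ∧
    res (Subtype.val : W X.1.1 → V) X.1.2 = res (Subtype.val : W X.1.1 → V) X'.1.2
  -- atoms along a map factoring through a smaller variable set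
  have rfac : ∀ {Q : Set P} {T T' : Set (Atm L V)} {θ : Type u} (g : θ → V)
      (_ : ∀ t, g t ∈ W Q)
      (_ : res (Subtype.val : W Q → V) T = res (Subtype.val : W Q → V) T'),
      res g T = res g T' := by
    intro Q T T' θ g hg hTT
    have : g = Subtype.val ∘ fun t => (⟨g t, hg t⟩ : W Q) := rfl
    rw [this, ← res_res, ← res_res, hTT]
  have rtrans : ∀ {a b c}, r a b → r b c → r a c := by
    intro a b c hab hbc
    refine ⟨hab.1.trans hbc.1, hab.2.trans ?_⟩
    exact rfac _ (fun t => hWmono hab.1 t.2) hbc.2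
  have vpmem : ∀ {Q : Set P} {p}, p ∈ Q → ∀ t, vp p t ∈ W Q := by
    intro Q p hp t s hs
    rcases t with t | t
    · simp [vp] at hs
    · obtain rfl := Sum.inr.inj hs
      exact hp
  have hG0 : G (∅, tp (L := L) (M := M) (id : M → M) |> fun T =>
      (exists_res_eq (g := (Sum.inl : M → V)) Sum.inl_injective T).choose) := by
    have := (exists_res_eq (g := (Sum.inl : M → V)) Sum.inl_injective
      (tp (L := L) (id : M → M))).choose_spec
    refine ⟨?_, this, fun p hp => absurd hp (Set.notMem_empty p)⟩
    have hx : ∀ v : W ∅, ∃ m : M, Sum.inl m = v.1 := by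
      rintro ⟨v | v, hv⟩
      · exact ⟨v, rfl⟩
      · exact absurd (hv v rfl) (Set.notMem_empty _)
    choose m hm using hx
    have e : (Subtype.val : W ∅ → V) = Sum.inl ∘ m := funext fun v => (hm v).symm
    change IsReal K (res (Subtype.val : W ∅ → V) _)
    rw [e, ← res_res, this, res_tp]
    exact isReal_tp hM _
  obtain ⟨X, hX⟩ := exists_maximal_of_chains_bounded (r := r) (by
    intro c hc
    rcases c.eq_empty_or_nonempty with rfl | ⟨X₀, hX₀⟩
    · exact ⟨⟨_, hG0⟩, by simp⟩
    let Q : Set P := {p | ∃ X ∈ c, p ∈ X.1.1}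
    let U : Set (Atm L V) := {φ | ∃ X ∈ c, ∃ ψ : Atm L (W X.1.1),
      ψ ∈ res (Subtype.val : W X.1.1 → V) X.1.2 ∧ ψ.subst (fun k => Term.var k.1) = φ}
    have hres : ∀ X ∈ c, res (Subtype.val : W X.1.1 → V) X.1.2
        = res (Subtype.val : W X.1.1 → V) U := by
      intro X hXc
      ext ψ
      refine ⟨fun h => ⟨X, hXc, ψ, h, rfl⟩, ?_⟩
      rintro ⟨X', hX', ψ', h1, h2⟩
      rcases eq_or_ne X X' with rfl | hne
      · rw [mem_res, ← h2]; exact h1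
      rcases hc hXc hX' hne with h3 | h3
      · rw [h3.2]
        rw [mem_res, ← h2]; exact h1
      · rw [h3.2] at h1
        rw [mem_res, ← h2]; exact h1
    have hQ : ∀ X ∈ c, X.1.1 ⊆ Q := fun X hX p hp => ⟨X, hX, hp⟩
    have hfin : ∀ s : Finset (W Q), ∃ X ∈ c, ∀ v ∈ s, v.1 ∈ W X.1.1 := by
      intro s
      induction s using Finset.induction_on with
      | empty => exact ⟨X₀, hX₀, by simp⟩
      | insert v s hv ih =>
        obtain ⟨X, hXc, hX⟩ := ih
        have : ∃ X' ∈ c, v.1 ∈ W X'.1.1 := by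
          obtain ⟨v | v, hvQ⟩ := v
          · exact ⟨X₀, hX₀, fun s hs => by simp at hs⟩
          · obtain ⟨X', hX', hp⟩ := hvQ v rfl
            exact ⟨X', hX', fun s hs => by obtain rfl := Sum.inr.inj hs; exact hp⟩
        obtain ⟨X', hX'c, hX'⟩ := this
        have : ∃ Z ∈ c, X.1.1 ⊆ Z.1.1 ∧ X'.1.1 ⊆ Z.1.1 := by
          rcases eq_or_ne X X' with rfl | hne
          · exact ⟨X, hXc, subset_rfl, subset_rfl⟩
          rcases hc hXc hX'c hne with h3 | h3
          · exact ⟨X', hX'c, h3.1, subset_rfl⟩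
          · exact ⟨X, hXc, subset_rfl, h3.1⟩
        obtain ⟨Z, hZc, h1, h2⟩ := this
        refine ⟨Z, hZc, fun w hw => ?_⟩
        rcases Finset.mem_insert.1 hw with rfl | hw
        · exact hWmono h2 hX'
        · exact hWmono h1 (hX w hw)
    refine ⟨⟨(Q, U), ?_, ?_, ?_⟩, fun X hX => ⟨hQ X hX, hres X hX⟩⟩
    · have := exists_model hK (T := res (Subtype.val : W Q → V) U) (by
        intro s
        obtain ⟨X, hXc, hX⟩ := hfin s
        rw [res_res]
        have e : res (Subtype.val ∘ (Subtype.val : s → W Q)) X.1.2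
          = res (Subtype.val ∘ (Subtype.val : s → W Q)) U :=
          rfac (Q := X.1.1) _ (fun t => hX t.1 t.2) (hres X hXc)
        rw [← e]
        have e2 : (Subtype.val ∘ (Subtype.val : s → W Q)) =
          Subtype.val ∘ fun t : s => (⟨t.1.1, hX t.1 t.2⟩ : W X.1.1) := rfl
        rw [e2, ← res_res]
        exact X.2.1.res _)
      obtain ⟨N, hN, g, hg, -⟩ := this
      exact ⟨N, hN, g, hg⟩
    · rw [← X₀.2.2.1]
      exact (rfac (Q := X₀.1.1) _ (fun t s hs => by simp at hs) (hres X₀ hX₀)).symm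
    · rintro p ⟨X, hXc, hp⟩
      rw [← X.2.2.2 p hp]
      exact (rfac (Q := X.1.1) _ (vpmem hp) (hres X hXc)).symm) rtrans
  have hall : ∀ p, p ∈ X.1.1 := by
    intro p
    by_contra hp
    obtain ⟨N, hN, g, hg⟩ := X.2.1
    obtain ⟨N', hN', g', hg'⟩ := hT p
    let m0 : M → W X.1.1 := fun m => ⟨Sum.inl m, fun s hs => by simp at hs⟩
    have e1 : tp (L := L) (g ∘ m0) = tp (id : M → M) := by
      rw [← res_tp, hg, res_res]; exact X.2.2.1
    have e2 : tp (L := L) (g ∘ m0 ∘ f p) = tp (g' ∘ Sum.inl) := by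
      rw [← res_tp g' Sum.inl, hg', ← h p]
      exact tp_comp e1 (f p)
    obtain ⟨Z, hZ, j, y, hy⟩ := exists_extension hK hap hN hN' e2
    let g2 : W (insert p X.1.1) → Z := fun v => match v with
      | ⟨Sum.inl m, _⟩ => j (g (m0 m))
      | ⟨Sum.inr s, hs⟩ => if hsp : s.1 = p then y (hsp ▸ s.2) else
          j (g ⟨Sum.inr s, fun s' hs' => by
            have := hs s' hs'
            obtain rfl := Sum.inr.inj hs'
            exact this.resolve_left hsp⟩)
    obtain ⟨U, hU⟩ := exists_res_eq (L := L) (g := (Subtype.val : W (insert p X.1.1) → V))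
      Subtype.val_injective (tp g2)
    have hsub : X.1.1 ⊆ insert p X.1.1 := Set.subset_insert _ _
    have hUX : res (Subtype.val : W X.1.1 → V) X.1.2 = res (Subtype.val : W X.1.1 → V) U := by
      have : (Subtype.val : W X.1.1 → V) = Subtype.val ∘ Set.inclusion (hWmono hsub) := rfl
      conv_rhs => rw [this, ← res_res, hU, res_tp]
      rw [← hg, ← tp_embedding j]
      congr 1
      funext v
      obtain ⟨v | v, hv⟩ := v
      · rfl
      · have hne : v.1 ≠ p := fun h => hp (h ▸ hv v rfl)
        simp [g2, hne]
    have hGU : G (insert p X.1.1, U) := by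
      refine ⟨⟨Z, hZ, g2, hU.symm⟩, ?_, ?_⟩
      · rw [← X.2.2.1]
        exact (rfac (Q := X.1.1) _ (fun t s hs => by simp at hs) hUX).symm
      · intro q hq
        rcases eq_or_ne q p with rfl | hqp
        · have : vp q = Subtype.val ∘ fun t => (⟨vp q t, vpmem hq t⟩ : W (insert q X.1.1)) := rfl
          rw [this, ← res_res, hU, res_tp, ← hg', ← hy]
          congr 1
          funext t
          rcases t with t | t
          · rfl
          · simp [g2, vp]
        · have hq' : q ∈ X.1.1 := hq.resolve_left hqp
          rw [← X.2.2.2 q hq']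
          exact (rfac (Q := X.1.1) _ (vpmem hq') hUX).symm
    have := hX ⟨_, hGU⟩ ⟨hsub, hUX⟩
    exact hp (this.1 (Set.mem_insert _ _))
  obtain ⟨N, hN, g, hg, hgen⟩ := X.2.1.exists_gen hK
  have hW : ∀ v, v ∈ W X.1.1 := fun v s _ => hall s.1
  let g' : V → N := fun v => g ⟨v, hW v⟩
  have hg' : tp (L := L) g' = X.1.2 := by
    have : g' = g ∘ fun v => ⟨v, hW v⟩ := rfl
    rw [this, ← res_tp, hg, res_res]
    exact res_id _
  have e1 : tp (L := L) (id : M → M) = tp (g' ∘ Sum.inl) := by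
    rw [← res_tp, hg']; exact X.2.2.1.symm
  obtain ⟨j, hj⟩ := tp_id_embedding e1
  refine ⟨N, hN, j, fun p y => g' (Sum.inr ⟨p, y⟩), fun p => ?_, ?_⟩
  · rw [← X.2.2.2 p (hall p), ← hg', res_tp]
    congr 1
    funext t
    rcases t with t | t
    · simp [hj, vp]
    · rfl
  · have : (Sum.elim j fun s : Σ p, Y p => g' (Sum.inr ⟨s.1, s.2⟩)) = g' := by
      funext t
      rcases t with t | t
      · simp [hj]
      · rfl
    rw [this, ← top_le_iff, ← hgen]
    exact gen_le.2 fun v => apply_mem_gen g' v.1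

end Amalgam

section ErdosRado

theorem exists_gt_of_card_le {T : Type u} [LinearOrder T] {ν : Cardinal.{u}} (hν : ℵ₀ ≤ ν)
    (hI : ∀ t : T, #(Set.Iio t) ≤ ν) (hT : ν < #T) {A : Type u} (f : A → T) (hA : #A ≤ ν) :
    ∃ t, ∀ a, f a < t := by
  by_contra! h
  have : (Set.univ : Set T) = ⋃ a, Set.Iic (f a) := by
    ext t; simpa using h t
  have h2 : #T ≤ ν := by
    rw [← Cardinal.mk_univ, this]
    refine (Cardinal.mk_iUnion_le _).trans (mul_le_of_le hν hA ?_)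
    refine ciSup_le' fun a => ?_
    rw [← Set.Iio_insert]
    exact Cardinal.mk_insert_le.trans
      (add_le_of_le hν (hI _) (Cardinal.one_le_aleph0.trans hν))
  exact absurd hT h2.not_gt

theorem exists_succ_wellOrder (ν : Cardinal.{u}) : ∃ (T : Type u) (_ : LinearOrder T)
    (_ : WellFoundedLT T), (∀ t : T, #(Set.Iio t) ≤ ν) ∧ #T = Order.succ ν := by
  obtain ⟨_, _, h⟩ := exists_initial_wellOrder (Order.succ ν).out
  refine ⟨(Order.succ ν).out, _, ‹_›, fun t => ?_, Cardinal.mk_out _⟩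
  have := h t
  rwa [Cardinal.mk_out, Order.lt_succ_iff] at this

/-- An end-homogeneous subset of a large well-order. -/
theorem exists_endHomogeneous {W : Type u} [LinearOrder W] [WellFoundedLT W] {C : Type u}
    {ν : Cardinal.{u}} (hν : ℵ₀ ≤ ν) (hW : 2 ^ ν < #W) (hC : #C ≤ 2 ^ ν) {n : ℕ}
    (c : (Fin n → W) → W → C) :
    ∃ S : Set W, ν < #S ∧ ∀ z : Fin n → W, (∀ k, z k ∈ S) → ∀ y ∈ S, ∀ y' ∈ S,
      (∀ k, z k < y) → (∀ k, z k < y') → c z y = c z y' := by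
  classical
  let Pr : W → Set W := WellFounded.fix (C := fun _ => Set W) (wellFounded_lt : WellFounded
    ((· < ·) : W → W → Prop)) fun x P => {y | ∃ h : y < x, ∀ z : Fin n → W,
      (∀ k, z k ∈ P y h) → c z y = c z x}
  have hPr : ∀ x y, y ∈ Pr x ↔ y < x ∧ ∀ z : Fin n → W, (∀ k, z k ∈ Pr y) → c z y = c z x := by
    intro x y
    have : Pr x = {y | ∃ _ : y < x, ∀ z : Fin n → W, (∀ k, z k ∈ Pr y) → c z y = c z x} :=
      WellFounded.fix_eq _ _ _
    rw [this]
    simp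
  have htr : ∀ y x, y ∈ Pr x → Pr y ⊆ Pr x := by
    intro y
    induction y using WellFoundedLT.induction with
    | ind y ih =>
      intro x hyx w hw
      have h1 := (hPr _ _).1 hw
      have h2 := (hPr _ _).1 hyx
      refine (hPr _ _).2 ⟨h1.1.trans h2.1, fun z hz => ?_⟩
      rw [h1.2 z hz]
      exact h2.2 z fun k => ih w h1.1 y hw (hz k)
  have hlin : ∀ x y y', y ∈ Pr x → y' ∈ Pr x → y < y' → y ∈ Pr y' := by
    intro x y
    induction y using WellFoundedLT.induction with
    | ind y ih =>
      intro y' hy hy' hlt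
      have h1 := (hPr _ _).1 hy
      have h2 := (hPr _ _).1 hy'
      refine (hPr _ _).2 ⟨hlt, fun z hz => ?_⟩
      rw [h1.2 z hz]
      refine (h2.2 z fun k => ?_).symm
      have h3 := ((hPr _ _).1 (hz k)).1
      exact ih (z k) h3 y' (htr y x hy (hz k)) hy' (h3.trans hlt)
  by_cases hbig : ∃ x, ν < #(Pr x)
  · obtain ⟨x, hx⟩ := hbig
    refine ⟨Pr x, hx, fun z hz y hy y' hy' h1 h2 => ?_⟩
    rw [((hPr x y).1 hy).2 z fun k => hlin x _ _ (hz k) hy (h1 k),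
      ((hPr x y').1 hy').2 z fun k => hlin x _ _ (hz k) hy' (h2 k)]
  exfalso
  push Not at hbig
  obtain ⟨T, _, _, hI, hT⟩ := exists_succ_wellOrder ν
  have hνT : ν < #T := by rw [hT]; exact Order.lt_succ ν
  have hne : Nonempty T := by
    rw [← Cardinal.mk_ne_zero_iff]; exact (zero_le.trans_lt hνT).ne'
  have hmin : ∀ s : Set T, ∃ t, s.Nonempty → t ∈ s ∧ ∀ t' < t, t' ∉ s := by
    intro s
    by_cases hs : s.Nonempty
    · exact ⟨wellFounded_lt.min s hs, fun _ => ⟨WellFounded.min_mem _ _ _, fun t' ht' hs' =>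
        (WellFounded.not_lt_min wellFounded_lt _ hs') ht'⟩⟩
    · exact ⟨hne.some, fun h => absurd h hs⟩
  choose mn hmn using hmin
  let ρ : W → T := WellFounded.fix (C := fun _ => T) (wellFounded_lt : WellFounded
    ((· < ·) : W → W → Prop)) fun x r => mn {t | ∀ y (h : y < x), y ∈ Pr x → r y h < t}
  have hρ0 : ∀ x, ρ x = mn {t | ∀ y, y < x → y ∈ Pr x → ρ y < t} := fun x =>
    WellFounded.fix_eq _ _ _
  have hρ : ∀ x, (∀ y ∈ Pr x, ρ y < ρ x) ∧ ∀ t < ρ x, ∃ y ∈ Pr x, t ≤ ρ y := by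
    intro x
    obtain ⟨t, ht⟩ := exists_gt_of_card_le hν hI hνT (fun y : Pr x => ρ y) (hbig x)
    have := hmn {t | ∀ y, y < x → y ∈ Pr x → ρ y < t} ⟨t, fun y _ hy => ht ⟨y, hy⟩⟩
    rw [← hρ0] at this
    refine ⟨fun y hy => this.1 y ((hPr _ _).1 hy).1 hy, fun t ht => ?_⟩
    have := this.2 t ht
    simp only [Set.mem_ofPred_eq, not_forall, not_lt] at this
    obtain ⟨y, -, hy, h⟩ := this
    exact ⟨y, hy, h⟩
  have hsurj : ∀ x, ∀ t < ρ x, ∃ y ∈ Pr x, ρ y = t := by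
    intro x
    induction x using WellFoundedLT.induction with
    | ind x ih =>
      intro t ht
      obtain ⟨y, hy, hty⟩ := (hρ x).2 t ht
      rcases hty.eq_or_lt with h | h
      · exact ⟨y, hy, h.symm⟩
      · obtain ⟨w, hw, hwt⟩ := ih y ((hPr _ _).1 hy).1 t h
        exact ⟨w, htr y x hy hw, hwt⟩
  have hinj : ∀ x, ∀ y ∈ Pr x, ∀ y' ∈ Pr x, ρ y = ρ y' → y = y' := by
    intro x y hy y' hy' h
    rcases lt_trichotomy y y' with h1 | h1 | h1
    · exact absurd h ((hρ y').1 y (hlin x _ _ hy hy' h1)).ne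
    · exact h1
    · exact absurd h ((hρ y).1 y' (hlin x _ _ hy' hy h1)).ne'
  have huniq : ∀ x x', Pr x = Pr x' → (∀ z : Fin n → W, (∀ k, z k ∈ Pr x) → c z x = c z x') →
      x = x' := by
    intro x x' h1 h2
    rcases lt_trichotomy x x' with h | h | h
    · have : x ∈ Pr x := by rw [h1]; exact (hPr _ _).2 ⟨h, h2⟩
      exact absurd ((hPr _ _).1 this).1 (lt_irrefl _)
    · exact h
    · have : x' ∈ Pr x' := by
        rw [← h1]; exact (hPr _ _).2 ⟨h, fun z hz => (h2 z (by rw [h1]; exact hz)).symm⟩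
      exact absurd ((hPr _ _).1 this).1 (lt_irrefl _)
  choose en hen using hsurj
  let code : W → Σ t : T, ((Fin n → Set.Iio t) → C) := fun x =>
    ⟨ρ x, fun z => c (fun k => en x (z k).1 (z k).2) x⟩
  have hcode : Function.Injective code := by
    intro x x' hxx
    have h1 : ρ x = ρ x' := congrArg Sigma.fst hxx
    have h2 : ∀ z : Fin n → T, ∀ (hz : ∀ k, z k < ρ x) (hz' : ∀ k, z k < ρ x'),
        c (fun k => en x (z k) (hz k)) x = c (fun k => en x' (z k) (hz' k)) x' := by
      have aux : ∀ (a b : Σ t : T, ((Fin n → Set.Iio t) → C)), a = b → ∀ z : Fin n → T,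
          ∀ (hz : ∀ k, z k < a.1) (hz' : ∀ k, z k < b.1),
          a.2 (fun k => ⟨z k, hz k⟩) = b.2 (fun k => ⟨z k, hz' k⟩) := by
        rintro a _ rfl z _ _; rfl
      exact fun z hz hz' => aux _ _ hxx z hz hz'
    have h3 : ∀ t (ht : t < ρ x) (ht' : t < ρ x'), en x t ht = en x' t ht' := by
      intro t
      induction t using WellFoundedLT.induction with
      | ind t ih =>
        intro ht ht'
        have hy := hen x t ht
        have hy' := hen x' t ht'
        have hset : ∀ w, w ∈ Pr (en x t ht) → ∃ (h : ρ w < t), w = en x (ρ w) (h.trans ht) := by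
          intro w hw
          have h := (hρ _).1 w hw
          rw [hy.2] at h
          exact ⟨h, hinj x _ (htr _ _ hy.1 hw) _ (hen x _ _).1 (hen x _ _).2.symm⟩
        have hset' : ∀ w, w ∈ Pr (en x' t ht') →
            ∃ (h : ρ w < t), w = en x' (ρ w) (h.trans ht') := by
          intro w hw
          have h := (hρ _).1 w hw
          rw [hy'.2] at h
          exact ⟨h, hinj x' _ (htr _ _ hy'.1 hw) _ (hen x' _ _).1 (hen x' _ _).2.symm⟩
        have hlt : ∀ x t (ht : t < ρ x) s (hs : s < t), en x s (hs.trans ht) ∈ Pr (en x t ht) := by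
          intro x t ht s hs
          have a1 := hen x t ht
          have a2 := hen x s (hs.trans ht)
          refine hlin x _ _ a2.1 a1.1 ?_
          rcases lt_trichotomy (en x s (hs.trans ht)) (en x t ht) with h | h | h
          · exact h
          · rw [← a1.2, ← h, a2.2] at hs; exact absurd hs (lt_irrefl _)
          · have := (hρ _).1 _ (hlin x _ _ a1.1 a2.1 h)
            rw [a1.2, a2.2] at this
            exact absurd hs this.not_gt
        refine huniq _ _ ?_ ?_
        · ext w
          constructor
          · intro hw
            obtain ⟨h, e⟩ := hset w hw
            rw [e, ih _ h (h.trans ht) (h.trans ht')]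
            exact hlt _ _ _ _ h
          · intro hw
            obtain ⟨h, e⟩ := hset' w hw
            rw [e, ← ih _ h (h.trans ht) (h.trans ht')]
            exact hlt _ _ _ _ h
        · intro z hz
          choose g ge using fun k => hset (z k) (hz k)
          have e1 : z = fun k => en x (ρ (z k)) ((g k).trans ht) := funext ge
          have e2 : z = fun k => en x' (ρ (z k)) ((g k).trans ht') := by
            funext k
            exact (ge k).trans (ih _ (g k) _ _)
          have hz' : ∀ k, z k ∈ Pr (en x' t ht') := by
            intro k; rw [congrFun e2 k]; exact hlt _ _ _ _ (g k)
          rw [((hPr _ _).1 hy.1).2 z hz, ((hPr _ _).1 hy'.1).2 z hz']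
          have := h2 (fun k => ρ (z k)) (fun k => (g k).trans ht) (fun k => (g k).trans ht')
          rwa [← e1, ← e2] at this
    have hset : ∀ x w, w ∈ Pr x → ∃ (h : ρ w < ρ x), w = en x (ρ w) h := by
      intro x w hw
      exact ⟨(hρ _).1 w hw, hinj x _ hw _ (hen x _ _).1 (hen x _ _).2.symm⟩
    refine huniq _ _ ?_ ?_
    · ext w
      constructor
      · intro hw
        obtain ⟨h, e⟩ := hset x w hw
        rw [e, h3 _ h (h1 ▸ h)]
        exact (hen _ _ _).1
      · intro hw
        obtain ⟨h, e⟩ := hset x' w hw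
        rw [e, ← h3 _ (h1 ▸ h) h]
        exact (hen _ _ _).1
    · intro z hz
      choose g ge using fun k => hset x (z k) (hz k)
      have e1 : z = fun k => en x (ρ (z k)) (g k) := funext ge
      have e2 : z = fun k => en x' (ρ (z k)) (h1 ▸ g k) := by
        funext k; exact (ge k).trans (h3 _ (g k) _)
      have := h2 (fun k => ρ (z k)) g (fun k => h1 ▸ g k)
      rwa [← e1, ← e2] at this
  have h2ν : ν < 2 ^ ν := Cardinal.cantor ν
  have hinf : ℵ₀ ≤ 2 ^ ν := hν.trans h2ν.le
  refine absurd hW (not_lt_of_ge ((Cardinal.mk_le_of_injective hcode).trans ?_))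
  rw [Cardinal.mk_sigma]
  refine (Cardinal.sum_le_mk_mul_iSup _).trans (mul_le_of_le hinf ?_ (ciSup_le' fun t => ?_))
  · rw [hT]; exact Order.succ_le_of_lt h2ν
  · rw [Cardinal.mk_arrow]
    simp only [Cardinal.lift_id]
    have h4 : #(Fin n → Set.Iio t) ≤ ν := by
      rw [Cardinal.mk_arrow]
      simp only [Cardinal.mk_fin, Cardinal.lift_natCast, Cardinal.lift_uzero]
      exact (Cardinal.power_le_power_right (hI t)).trans (Cardinal.power_nat_le hν)
    calc #C ^ #(Fin n → Set.Iio t) ≤ (2 ^ ν) ^ #(Fin n → Set.Iio t) :=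
          Cardinal.power_le_power_right hC
      _ ≤ (2 ^ ν) ^ ν := Cardinal.power_le_power_left (by
          exact (zero_lt_one.trans_le (Cardinal.one_le_aleph0.trans hinf)).ne') h4
      _ = 2 ^ ν := by rw [← Cardinal.power_mul, Cardinal.mul_eq_self hν]

/-- Iterated exponentiation. -/
noncomputable def iexp (μ : Cardinal.{u}) : ℕ → Cardinal.{u}
  | 0 => μ
  | n + 1 => 2 ^ iexp μ n

theorem le_iexp (μ : Cardinal.{u}) (n : ℕ) : μ ≤ iexp μ n := by
  induction n with
  | zero => exact le_rfl
  | succ n ih => exact ih.trans (Cardinal.cantor _).le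

/-- A version of the Erdős–Rado theorem. -/
theorem exists_homogeneous {C : Type u} [Nonempty C] {μ : Cardinal.{u}} (hμ : ℵ₀ ≤ μ)
    (hC : #C ≤ μ) (n : ℕ) : ∀ {W : Type u} [LinearOrder W] [WellFoundedLT W]
    (_ : iexp μ n < #W) (c : (Fin n → W) → C),
    ∃ S : Set W, μ < #S ∧ ∀ z z' : Fin n → W, StrictMono z → StrictMono z' →
      (∀ k, z k ∈ S) → (∀ k, z' k ∈ S) → c z = c z' := by
  classical
  induction n with
  | zero =>
    intro W _ _ hW c
    refine ⟨Set.univ, by rw [Cardinal.mk_univ]; exact hW, fun z z' _ _ _ _ => ?_⟩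
    rw [Subsingleton.elim z z']
  | succ n ih =>
    intro W _ _ hW c
    have hle := le_iexp μ n
    obtain ⟨S, hS, hh⟩ := exists_endHomogeneous (hμ.trans hle) hW
      (hC.trans (hle.trans (Cardinal.cantor _).le)) (fun z y => c (Fin.snoc z y))
    let c' : (Fin n → S) → C := fun z =>
      if h : ∃ y ∈ S, ∀ k, (z k : W) < y then c (Fin.snoc (fun k => (z k : W)) h.choose)
      else Classical.arbitrary C
    obtain ⟨S', hS', hh'⟩ := ih hS c'
    refine ⟨Subtype.val '' S', ?_, ?_⟩
    · rwa [Cardinal.mk_image_eq Subtype.val_injective]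
    · have key : ∀ z : Fin (n + 1) → W, StrictMono z → (∀ k, z k ∈ Subtype.val '' S') →
          ∃ w : Fin n → S, StrictMono w ∧ (∀ k, w k ∈ S') ∧ c z = c' w := by
        intro z hz hzS
        choose w hw hwz using hzS
        refine ⟨fun k => w k.castSucc, ?_, fun k => hw _, ?_⟩
        · intro a b hab
          have : (w a.castSucc : W) < w b.castSucc := by
            rw [hwz, hwz]; exact hz (by simpa using hab)
          exact this
        · have hex : ∃ y ∈ S, ∀ k : Fin n, (w k.castSucc : W) < y :=
            ⟨z (Fin.last n), by rw [← hwz]; exact (w _).2, fun k => by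
              rw [hwz]; exact hz (Fin.castSucc_lt_last k)⟩
          simp only [c', dif_pos hex]
          have hz2 : z = Fin.snoc (fun k : Fin n => (w k.castSucc : W)) (z (Fin.last n)) := by
            rw [funext (fun k : Fin n => hwz k.castSucc)]
            exact (Fin.snoc_init_self z).symm
          conv_lhs => rw [hz2]
          refine hh _ (fun k => (w k.castSucc).2) _ ?_ _ hex.choose_spec.1 ?_ hex.choose_spec.2
          · rw [← hwz]; exact (w _).2
          · intro k; rw [hwz]; exact hz (Fin.castSucc_lt_last k)
      intro z z' hz hz' hzS hzS'
      obtain ⟨w, h1, h2, h3⟩ := key z hz hzS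
      obtain ⟨w', h1', h2', h3'⟩ := key z' hz' hzS'
      rw [h3, h3']
      exact hh' w w' h1 h1' h2 h2'

end ErdosRado

section Template

open FirstOrder.Language

universe v w x

variable {L : FirstOrder.Language.{u, u}} {K : Set (StrucOf L)}

/-- `N` has large well-ordered families all of whose increasing `n`-tuples have type `T`. -/
def LargeHom (N : Type u) [L.Structure N] (Ω : Ordinal.{u}) (n : ℕ) (T : Set (Atm L (Fin n))) :
    Prop :=
  ∀ α < Ω, ∃ (I : Type u) (_ : LinearOrder I) (_ : WellFoundedLT I), Cardinal.beth α ≤ #I ∧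
    ∃ a : I → N, Function.Injective a ∧ ∀ z : Fin n → I, StrictMono z → tp (L := L) (a ∘ z) = T

theorem exists_strictMono_of_infinite {I : Type u} [LinearOrder I] [WellFoundedLT I]
    (h : ℵ₀ ≤ #I) (n : ℕ) : ∃ z : Fin n → I, StrictMono z := by
  have : Infinite I := Cardinal.aleph0_le_mk_iff.1 h
  obtain ⟨s, hs⟩ := Infinite.exists_subset_card_eq I n
  exact ⟨_, (s.orderEmbOfFin hs).strictMono⟩

theorem largeHom_succ {N : Type u} [L.Structure N] {n : ℕ} {T : Set (Atm L (Fin n))}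
    (h : LargeHom N ((Order.succ ((2 : Cardinal.{u}) ^ kap L)).ord) n T) :
    ∃ T' : Set (Atm L (Fin (n + 1))),
      LargeHom N ((Order.succ ((2 : Cardinal.{u}) ^ kap L)).ord) (n + 1) T' ∧
      ∀ g : Fin n ↪o Fin (n + 1), res g T' = T := by
  classical
  set κ := kap L with hκ
  set Ω := (Order.succ ((2 : Cardinal.{u}) ^ κ)).ord with hΩ
  have hκ0 : ℵ₀ ≤ κ := aleph0_le_kap
  have h2 : ℵ₀ ≤ (2 : Cardinal.{u}) ^ κ := hκ0.trans (Cardinal.cantor κ).le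
  have h3 : ℵ₀ ≤ Order.succ ((2 : Cardinal.{u}) ^ κ) := h2.trans (Order.le_succ _)
  have hlim : Order.IsSuccLimit Ω := Cardinal.isSuccLimit_ord h3
  have hκΩ : κ.ord < Ω := Cardinal.ord_lt_ord.2 ((Cardinal.cantor κ).trans (Order.lt_succ _))
  have hstep : ∀ α : Set.Iio Ω, ∃ T' : Set (Atm L (Fin (n + 1))),
      (∃ (I : Type u) (_ : LinearOrder I) (_ : WellFoundedLT I),
        Cardinal.beth α ≤ #I ∧ ∃ a : I → N, Function.Injective a ∧
          ∀ z : Fin (n + 1) → I, StrictMono z → tp (L := L) (a ∘ z) = T') ∧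
      ∀ g : Fin n ↪o Fin (n + 1), res g T' = T := by
    rintro ⟨α, hα⟩
    set α' := max (Order.succ κ.ord) α with hα'
    have hα'Ω : α' < Ω := max_lt (hlim.succ_lt hκΩ) hα
    have hωΩ : α' + Ordinal.omega0 < Ω := Ordinal.isPrincipal_add_ord h3 hα'Ω (by
      rw [← Cardinal.ord_aleph0]
      exact Cardinal.ord_lt_ord.2 (h2.trans_lt (Order.lt_succ _)))
    obtain ⟨I, lo, wf, hI, a, ha, hz⟩ := h _ hωΩ
    set μ := Cardinal.beth α' with hμ
    have hμ2 : (2 : Cardinal.{u}) ^ κ ≤ μ := by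
      calc (2 : Cardinal.{u}) ^ κ ≤ 2 ^ Cardinal.beth κ.ord :=
            Cardinal.power_le_power_left two_ne_zero (Cardinal.le_beth_ord κ)
        _ = Cardinal.beth (Order.succ κ.ord) := (Cardinal.beth_succ _).symm
        _ ≤ μ := Cardinal.beth_strictMono.monotone (le_max_left _ _)
    have hie : ∀ m : ℕ, iexp μ m = Cardinal.beth (α' + m) := by
      intro m
      induction m with
      | zero => simp [iexp, hμ]
      | succ m ih =>
        rw [iexp, ih, ← Cardinal.beth_succ]
        congr 1
        rw [Nat.cast_succ, ← add_assoc]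
        exact Order.succ_eq_add_one _
    have hlt : iexp μ (n + 1) < #I := by
      rw [hie]
      refine lt_of_lt_of_le (Cardinal.beth_strictMono ?_) hI
      exact (add_lt_add_iff_left _).2 (Ordinal.natCast_lt_omega0 _)
    have hC : #(Set (Atm L (Fin (n + 1)))) ≤ μ := by
      rw [Cardinal.mk_set]
      exact (Cardinal.power_le_power_left two_ne_zero (card_atm_finite _)).trans hμ2
    obtain ⟨S, hS, hom⟩ := exists_homogeneous (h2.trans hμ2) hC (n + 1) hlt
      (fun z => tp (L := L) (a ∘ z))
    have hinf : ℵ₀ ≤ #S := (h2.trans hμ2).trans hS.le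
    obtain ⟨z0, hz0⟩ := exists_strictMono_of_infinite hinf (n + 1)
    refine ⟨tp (L := L) (a ∘ fun k => (z0 k : I)), ⟨S, inferInstance, inferInstance,
      (Cardinal.beth_strictMono.monotone (le_max_right _ _)).trans hS.le,
      fun s => a s, ha.comp Subtype.val_injective, fun z hzm => ?_⟩, fun g => ?_⟩
    · exact hom (fun k => z k) (fun k => z0 k) hzm hz0 (fun k => (z k).2) (fun k => (z0 k).2)
    · rw [res_tp]
      exact hz ((fun k => (z0 k : I)) ∘ g) (fun _ _ hab => hz0 (g.strictMono hab))
  choose τ hτ1 hτ2 using hstep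
  have key : ∃ T', ∀ β < Ω, ∃ α : Set.Iio Ω, β ≤ α.1 ∧ τ α = T' := by
    by_contra hcon
    push Not at hcon
    choose b hb hb' using hcon
    have hsup : ⨆ T', b T' < Ω := by
      refine Ordinal.iSup_lt_of_lt_cof ?_ hb
      rw [hΩ, (Cardinal.isRegular_succ h2).cof_ord]
      refine lt_of_le_of_lt ?_ (Order.lt_succ _)
      rw [Cardinal.mk_set]
      exact Cardinal.power_le_power_left two_ne_zero (card_atm_finite _)
    exact hb' (τ ⟨_, hsup⟩) ⟨_, hsup⟩ (Ordinal.le_iSup b _) rfl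
  obtain ⟨T', hT'⟩ := key
  refine ⟨T', fun β hβ => ?_, ?_⟩
  · obtain ⟨α, hα, rfl⟩ := hT' β hβ
    obtain ⟨I, lo, wf, hI, H⟩ := hτ1 α
    exact ⟨I, lo, wf, (Cardinal.beth_strictMono.monotone hα).trans hI, H⟩
  · obtain ⟨α, -, rfl⟩ := hT' 0 (by
      rw [hΩ]; exact (zero_le (a := κ.ord)).trans_lt hκΩ)
    exact hτ2 α

/-- Coherent sequences of types of increasing tuples. -/
def Coherent (p : ∀ n, Set (Atm L (Fin n))) : Prop :=
  ∀ m n (g : Fin m ↪o Fin n), res g (p n) = p m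

theorem exists_template (N : Type u) [L.Structure N]
    (hN : Cardinal.beth ((Order.succ ((2 : Cardinal.{u}) ^ kap L)).ord) ≤ #N) :
    ∃ p : ∀ n, Set (Atm L (Fin n)), Coherent p ∧
      ∀ n, ∃ f : Fin n → N, Function.Injective f ∧ tp (L := L) f = p n := by
  have h2 : ℵ₀ ≤ (2 : Cardinal.{u}) ^ kap L := aleph0_le_kap.trans (Cardinal.cantor _).le
  let Ω := (Order.succ ((2 : Cardinal.{u}) ^ kap L)).ord
  have h0 : ∃ T, LargeHom (L := L) N Ω 0 T := by
    refine ⟨tp (L := L) (Fin.elim0 : Fin 0 → N), fun α hα => ?_⟩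
    obtain ⟨lo, wf, -⟩ := exists_initial_wellOrder N
    refine ⟨N, lo, wf, (Cardinal.beth_strictMono.monotone hα.le).trans hN, id,
      Function.injective_id, fun z _ => ?_⟩
    congr 1
    exact Subsingleton.elim _ _
  choose! F hF1 hF2 using fun n (T : Set (Atm L (Fin n))) (h : LargeHom N Ω n T) =>
    largeHom_succ h
  obtain ⟨T0, hT0⟩ := h0
  let p : ∀ n, Set (Atm L (Fin n)) := fun n => Nat.rec T0 (fun n T => F n T) n
  have hp : ∀ n, LargeHom N Ω n (p n) := by
    intro n
    induction n with
    | zero => exact hT0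
    | succ n ih => exact hF1 n _ ih
  have hs : ∀ n (g : Fin n ↪o Fin (n + 1)), res g (p (n + 1)) = p n := fun n => hF2 n _ (hp n)
  refine ⟨p, ?_, fun n => ?_⟩
  · intro m n
    induction n with
    | zero =>
      intro g
      have : m = 0 := by
        by_contra hm
        exact (g ⟨0, Nat.pos_of_ne_zero hm⟩).elim0
      subst this
      have : (g : Fin 0 → Fin 0) = fun k => k := Subsingleton.elim _ _
      rw [this, res_id]
    | succ n ih =>
      intro g
      by_cases hsurj : Function.Surjective g
      · have hmn : m = n + 1 := by
          have := Fintype.card_of_bijective ⟨g.injective, hsurj⟩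
          simpa using this
        subst hmn
        have : (g : Fin (n + 1) → Fin (n + 1)) = fun k => k := by
          exact congrArg (fun e : Fin (n + 1) ≃o Fin (n + 1) => (e : Fin (n + 1) → Fin (n + 1)))
            (Subsingleton.elim (StrictMono.orderIsoOfSurjective g g.strictMono hsurj)
              (OrderIso.refl _))
        rw [this, res_id]
      · simp only [Function.Surjective, not_forall, not_exists] at hsurj
        obtain ⟨j, hj⟩ := hsurj
        choose g' hg' using fun k => Fin.exists_succAbove_eq (hj k)
        have hmono : StrictMono g' := fun a b hab => by
          rw [← Fin.succAbove_lt_succAbove_iff (p := j), hg', hg']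
          exact g.strictMono hab
        have : (g : Fin m → Fin (n + 1)) =
            (Fin.succAboveOrderEmb j) ∘ (OrderEmbedding.ofStrictMono g' hmono) :=
          funext fun k => (hg' k).symm
        rw [this, ← res_res, hs, ih]
  · have hpos : (0 : Ordinal.{u}) < Ω := by
      refine (zero_le (a := (kap L).ord)).trans_lt ?_
      exact Cardinal.ord_lt_ord.2 ((Cardinal.cantor _).trans (Order.lt_succ _))
    obtain ⟨I, lo, wf, hI, a, ha, hz⟩ := hp n 0 hpos
    obtain ⟨z, hzm⟩ := exists_strictMono_of_infinite (by simpa using hI) n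
    exact ⟨a ∘ z, ha.comp hzm.injective, hz z hzm⟩

/-- An increasing `n`-tuple has type `p n` for all `n`. -/
def Indisc (p : ∀ n, Set (Atm L (Fin n))) {Λ : Type v} [LinearOrder Λ] {M : Type w}
    [L.Structure M] (i : Λ → M) : Prop :=
  ∀ n (e : Fin n → Λ), StrictMono e → tp (L := L) (i ∘ e) = p n

theorem exists_factor {Λ : Type v} [LinearOrder Λ] (s : Finset Λ) {n : ℕ} (e : Fin n → Λ)
    (he : ∀ k, e k ∈ s) : ∃ g : Fin n → Fin s.card, s.orderEmbOfFin rfl ∘ g = e := by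
  have : ∀ k, ∃ j, s.orderEmbOfFin rfl j = e k := fun k => by
    have := s.range_orderEmbOfFin rfl
    have h2 : e k ∈ Set.range (s.orderEmbOfFin rfl) := by rw [this]; exact he k
    exact h2
  choose g hg using this
  exact ⟨g, funext hg⟩

theorem exists_indisc (hK : IsUniversalClass L K) {p : ∀ n, Set (Atm L (Fin n))}
    (hp : Coherent p) (hr : ∀ n, IsReal K (p n)) (Λ : Type u) [LinearOrder Λ] :
    ∃ V ∈ K, ∃ i : Λ → V, Indisc p i ∧ gen L i = ⊤ := by
  classical
  let T : Set (Atm L Λ) := {φ | ∃ s : Finset Λ, ∃ ψ ∈ p s.card,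
    ψ.subst (fun k => (Term.var (s.orderEmbOfFin rfl k) : L.Term Λ)) = φ}
  have hT : ∀ s : Finset Λ, res (s.orderEmbOfFin rfl) T = p s.card := by
    intro s
    ext φ
    constructor
    · rintro ⟨s', ψ, hψ, e⟩
      let t := s ∪ s'
      obtain ⟨g, hg⟩ := exists_factor t (s.orderEmbOfFin rfl)
        (fun k => Finset.mem_union_left _ (Finset.orderEmbOfFin_mem s rfl k))
      obtain ⟨g', hg'⟩ := exists_factor t (s'.orderEmbOfFin rfl)
        (fun k => Finset.mem_union_right _ (Finset.orderEmbOfFin_mem s' rfl k))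
      have hm : ∀ {r : Finset Λ} {g : Fin r.card → Fin t.card},
          (t.orderEmbOfFin rfl) ∘ g = r.orderEmbOfFin rfl → StrictMono g := by
        intro r g hg a b hab
        rw [← (t.orderEmbOfFin rfl).lt_iff_lt]
        rw [funext_iff] at hg
        have h1 := hg a
        have h2 := hg b
        simp only [Function.comp] at h1 h2
        rw [h1, h2]
        exact (r.orderEmbOfFin rfl).strictMono hab
      have r1 := hp _ _ (OrderEmbedding.ofStrictMono g (hm hg))
      have r2 := hp _ _ (OrderEmbedding.ofStrictMono g' (hm hg'))
      rw [← r2] at hψ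
      rw [← r1]
      have key : φ.subst (fun k => (Term.var (g k) : L.Term _)) =
          ψ.subst (fun k => (Term.var (g' k) : L.Term _)) := by
        apply Atm.subst_var_injective (t.orderEmbOfFin rfl).injective
        have a1 : (φ.subst (fun k => (Term.var (g k) : L.Term _))).subst
            (fun k => (Term.var (t.orderEmbOfFin rfl k) : L.Term Λ)) =
            φ.subst (fun k => (Term.var (s.orderEmbOfFin rfl k) : L.Term Λ)) := by
          rw [← hg]; cases φ <;> simp [Atm.subst, Term.subst_var_comp]
        have a2 : (ψ.subst (fun k => (Term.var (g' k) : L.Term _))).subst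
            (fun k => (Term.var (t.orderEmbOfFin rfl k) : L.Term Λ)) =
            ψ.subst (fun k => (Term.var (s'.orderEmbOfFin rfl k) : L.Term Λ)) := by
          rw [← hg']; cases ψ <;> simp [Atm.subst, Term.subst_var_comp]
        exact a1.trans (e.symm.trans a2.symm)
      change φ.subst (fun k => (Term.var (g k) : L.Term _)) ∈ p t.card
      rw [key]
      exact hψ
    · intro hφ
      exact ⟨s, φ, hφ, rfl⟩
  have hs : ∀ s : Finset Λ, res (Subtype.val : s → Λ) T =
      res (s.orderIsoOfFin rfl).symm (p s.card) := by
    intro s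
    rw [← hT, res_res]
    congr 1
    funext x
    exact (congrArg Subtype.val ((s.orderIsoOfFin rfl).apply_symm_apply x)).symm
  obtain ⟨V, hV, i, hi, hg⟩ := exists_model hK (T := T) (fun s => by
    rw [hs]; exact (hr _).res _)
  refine ⟨V, hV, i, fun n e he => ?_, hg⟩
  rw [← res_tp, hi]
  let s : Finset Λ := Finset.univ.image e
  have hc : s.card = n := by
    rw [Finset.card_image_of_injective _ he.injective]; simp
  have : e = s.orderEmbOfFin hc :=
    Finset.orderEmbOfFin_unique hc (fun k => Finset.mem_image_of_mem _ (Finset.mem_univ k)) he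
  rw [this]
  have : ∀ m (h : s.card = m), res (s.orderEmbOfFin h) T = p m := by
    rintro m rfl; exact hT s
  exact this n hc

theorem Indisc.injective {p : ∀ n, Set (Atm L (Fin n))}
    (hp : ∃ (N : Type u) (_ : L.Structure N) (f : Fin 2 → N), Function.Injective f ∧
      tp (L := L) f = p 2)
    {Λ : Type v} [LinearOrder Λ] {M : Type w} [L.Structure M] {i : Λ → M} (h : Indisc p i) :
    Function.Injective i := by
  obtain ⟨N, _, f, hf, hf'⟩ := hp
  intro a b hab
  by_contra hne
  wlog hlt : a < b generalizing a b
  · exact this hab.symm (Ne.symm hne) (lt_of_le_of_ne (not_lt.1 hlt) (Ne.symm hne))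
  have hm : StrictMono ![a, b] := by
    intro k l hkl
    fin_cases k <;> fin_cases l <;> simp_all
  have h2 := h 2 _ hm
  have := (apply_eq_of_tp_eq (h2.trans hf'.symm) 0 1).1 (by simpa using hab)
  exact absurd (hf this) (by simp)

end Template

section Stability

open FirstOrder.Language

universe v w x

variable {L : FirstOrder.Language.{u, u}} {K : Set (StrucOf L)}

theorem Indisc.tp_eq {p : ∀ n, Set (Atm L (Fin n))} {Λ : Type v} [LinearOrder Λ] {Λ' : Type*}
    [LinearOrder Λ'] {M : Type w} [L.Structure M] {M' : Type*} [L.Structure M'] {i : Λ → M}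
    (hi : Indisc p i) {i' : Λ' → M'} (hi' : Indisc p i') {Z : Type x} (u : Z → Λ) (u' : Z → Λ')
    (h : ∀ a b, u a ≤ u b ↔ u' a ≤ u' b) : tp (L := L) (i ∘ u) = tp (i' ∘ u') := by
  classical
  refine tp_eq_of_finite fun s => ?_
  let r : Finset Λ := Finset.univ.image fun k : s => u k
  let e := r.orderEmbOfFin rfl
  have hr : ∀ j, ∃ k : s, u k = e j := fun j => by
    have := r.orderEmbOfFin_mem rfl j
    obtain ⟨k, -, hk⟩ := Finset.mem_image.1 this
    exact ⟨k, hk⟩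
  choose c hc using hr
  have hr' : ∀ k : s, ∃ j, e j = u k := fun k => by
    have := r.range_orderEmbOfFin rfl
    have h2 : u k ∈ Set.range (r.orderEmbOfFin rfl) := by
      rw [this]; exact Finset.mem_coe.2 (Finset.mem_image_of_mem _ (Finset.mem_univ k))
    exact h2
  choose d hd using hr'
  have hm : StrictMono fun j => u' (c j) := by
    intro a b hab
    have := e.strictMono hab
    rw [← hc, ← hc] at this
    exact lt_of_not_ge fun hba => this.not_ge ((h _ _).2 hba)
  have e1 : (fun k : s => (i ∘ u) k) = (i ∘ e) ∘ d := by
    funext k; simp [hd]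
  have e2 : (fun k : s => (i' ∘ u') k) = (i' ∘ fun j => u' (c j)) ∘ d := by
    funext k
    have : u' k = u' (c (d k)) := by
      have h1 : u (c (d k)) = u k := (hc _).trans (hd k)
      exact le_antisymm ((h _ _).1 h1.ge) ((h _ _).1 h1.le)
    simp [this]
  rw [e1, e2]
  exact tp_comp ((hi _ _ e.strictMono).trans (hi' _ _ hm).symm) d

theorem card_fin_fun_le {κ : Cardinal.{u}} (hκ : ℵ₀ ≤ κ) {X : Type u} (hX : #X ≤ κ) (n : ℕ) :
    #(Fin n → X) ≤ κ := by
  have : #(Fin n → X) = #X ^ n := by simp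
  rw [this]
  exact (Cardinal.power_nat_le_max (c := #X) (n := n)).trans (max_le hX hκ)

theorem card_finite_fun_le {κ : Cardinal.{u}} (hκ : ℵ₀ ≤ κ) {X : Type u} (hX : #X ≤ κ)
    (W : Type u) [Finite W] : #(W → X) ≤ κ := by
  obtain ⟨n, ⟨e⟩⟩ := Finite.exists_equiv_fin W
  rw [Cardinal.mk_congr (Equiv.arrowCongr e (Equiv.refl X))]
  exact card_fin_fun_le hκ hX n

/-- The substructure generated by the part of a family indexed by a set. -/
def clo (L : FirstOrder.Language.{u, u}) {ι : Type v} {M : Type w} [L.Structure M] (f : ι → M)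
    (R : Set ι) : L.Substructure M := gen L fun k : R => f k

theorem clo_mono {ι : Type v} {M : Type w} [L.Structure M] (f : ι → M) {R S : Set ι}
    (h : R ⊆ S) : clo L f R ≤ clo L f S :=
  gen_le.2 fun k => apply_mem_gen (fun k : S => f k) ⟨k, h k.2⟩

theorem apply_mem_clo {ι : Type v} {M : Type w} [L.Structure M] (f : ι → M) {R : Set ι} {k : ι}
    (h : k ∈ R) : f k ∈ clo L f R := apply_mem_gen (fun k : R => f k) ⟨k, h⟩

theorem clo_le {ι : Type v} {M : Type w} [L.Structure M] {f : ι → M} {R : Set ι}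
    {S : L.Substructure M} : clo L f R ≤ S ↔ ∀ k ∈ R, f k ∈ S :=
  gen_le.trans ⟨fun h k hk => h ⟨k, hk⟩, fun h k => h k k.2⟩

theorem clo_univ {ι : Type v} {M : Type w} [L.Structure M] (f : ι → M) :
    clo L f Set.univ = gen L f :=
  le_antisymm (clo_le.2 fun k _ => apply_mem_gen f k)
    (gen_le.2 fun _ => apply_mem_clo f (Set.mem_univ _))

theorem clo_le_gen {ι : Type v} {M : Type w} [L.Structure M] (f : ι → M) (R : Set ι) :
    clo L f R ≤ gen L f := clo_le.2 fun k _ => apply_mem_gen f k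

/-- Elements have finite supports. -/
theorem exists_finset_mem_clo {ι : Type v} {M : Type w} [L.Structure M] {f : ι → M} {R : Set ι}
    {x : M} (h : x ∈ clo L f R) : ∃ s : Finset ι, ↑s ⊆ R ∧ x ∈ clo L f s := by
  classical
  obtain ⟨t, rfl⟩ := mem_gen.1 h
  obtain ⟨s, hs⟩ := Term.exists_finset t
  obtain ⟨r, rfl⟩ := hs s le_rfl
  refine ⟨s.image Subtype.val, by simp, ?_⟩
  rw [Term.realize_subst]
  refine gen_le.2 (fun k => ?_) (realize_mem_gen (fun k : s => f k) r)
  exact apply_mem_clo f (Finset.mem_coe.2 (Finset.mem_image_of_mem _ k.2))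

theorem exists_finset_of_gen_eq_top {ι : Type v} {M : Type w} [L.Structure M] {f : ι → M}
    (h : gen L f = ⊤) (x : M) : ∃ s : Finset ι, x ∈ clo L f s := by
  have : x ∈ clo L f Set.univ := by rw [clo_univ, h]; trivial
  obtain ⟨s, -, hs⟩ := exists_finset_mem_clo this
  exact ⟨s, hs⟩

/-- A small set of elements has a small support. -/
theorem exists_set_mem_clo {ι : Type u} {M : Type w} [L.Structure M] {f : ι → M}
    (h : gen L f = ⊤) {A : Type u} (g : A → M) {κ : Cardinal.{u}} (hκ : ℵ₀ ≤ κ) (hA : #A ≤ κ) :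
    ∃ R : Set ι, #R ≤ κ ∧ ∀ a, g a ∈ clo L f R := by
  choose s hs using fun a => exists_finset_of_gen_eq_top h (g a)
  refine ⟨⋃ a, (s a : Set ι), ?_, fun a => clo_mono f (Set.subset_iUnion (fun a => (s a : Set ι)) a)
    (hs a)⟩
  refine (Cardinal.mk_iUnion_le_sum_mk).trans ?_
  refine (Cardinal.sum_le_sum _ (fun _ => ℵ₀) fun a => ?_).trans ?_
  · exact (Cardinal.lt_aleph0_of_finite _).le
  · rw [Cardinal.sum_const']
    exact (mul_le_mul' hA hκ).trans (Cardinal.mul_eq_self hκ).le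

theorem exists_term_fin {M : Type w} [L.Structure M] {ι : Type v} {f : ι → M} (h : gen L f = ⊤)
    {W : Type x} [Finite W] (m : W → M) : ∃ (n : ℕ) (z : Fin n → ι) (t : W → L.Term (Fin n)),
      m = fun k => (t k).realize (f ∘ z) := by
  have : ∀ k, ∃ t : L.Term ι, t.realize f = m k := fun k => mem_gen.1 (h ▸ trivial)
  choose t ht using this
  obtain ⟨s, r, hr⟩ := Term.exists_finset_family t
  refine ⟨s.card, fun k => s.equivFin.symm k, fun k => (r k).subst fun j =>
    Term.var (s.equivFin j), funext fun k => ?_⟩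
  rw [← ht, ← hr, Term.realize_subst, Term.realize_subst]
  simp [Function.comp_def]

theorem Indisc.card_types_le {p : ∀ n, Set (Atm L (Fin n))} {Λ : Type u} [LinearOrder Λ]
    [WellFoundedLT Λ] {M : Type u} [L.Structure M] {i : Λ → M} (hi : Indisc p i)
    (hg : gen L i = ⊤) {A : Type u} (g : A → M) (hA : #A ≤ kap L) (W : Type u) [Finite W] :
    #(Set.range fun m : W → M => tp (L := L) (Sum.elim g m)) ≤ kap L := by
  classical
  have hκ : ℵ₀ ≤ kap L := aleph0_le_kap
  obtain ⟨R, hR, hgR⟩ := exists_set_mem_clo hg g hκ hA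
  choose tg htg using fun a => mem_gen.1 (hgR a)
  let cut : Λ → Option R × Prop := fun x =>
    if h : ∃ y : R, x ≤ y then
      (some (WellFounded.min wellFounded_lt {y : R | x ≤ y} h), x ∈ R) else (none, x ∈ R)
  have cut_le : ∀ x x', cut x = cut x' → ∀ y : R, (x ≤ y → x' ≤ y) ∧ (y ≤ x → y ≤ x') := by
    intro x x' h y
    by_cases h1 : ∃ y : R, x ≤ y
    · by_cases h2 : ∃ y : R, x' ≤ y
      · simp only [cut, h1, h2, dite_true, Prod.mk.injEq, Option.some.injEq] at h
        have m1 : x ≤ _ := WellFounded.min_mem wellFounded_lt {y : R | x ≤ y} h1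
        have m2 : x' ≤ _ := WellFounded.min_mem wellFounded_lt {y : R | x' ≤ y} h2
        have l1 : ∀ y : R, x ≤ y →
            WellFounded.min wellFounded_lt {y : R | x ≤ y} h1 ≤ y :=
          fun y hy => WellFounded.min_le wellFounded_lt
          (s := {y : R | x ≤ y}) hy
        have l2 : ∀ y : R, x' ≤ y →
            WellFounded.min wellFounded_lt {y : R | x' ≤ y} h2 ≤ y :=
          fun y hy => WellFounded.min_le wellFounded_lt
          (s := {y : R | x' ≤ y}) hy
        rw [h.1] at m1 l1
        refine ⟨fun hy => m2.trans (Subtype.coe_le_coe.2 (l1 y hy)), fun hy => ?_⟩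
        by_contra hc
        have hc' := l2 y (not_le.1 hc).le
        have hx : x = y := le_antisymm (m1.trans (Subtype.coe_le_coe.2 hc')) hy
        have hxR : x' ∈ R := h.2.mp (hx ▸ y.2)
        exact hc (hy.trans (m1.trans (Subtype.coe_le_coe.2 (l2 ⟨x', hxR⟩ le_rfl))))
      · simp only [cut, h1, h2, dite_true, dite_false, Prod.mk.injEq, reduceCtorEq, false_and] at h
    · by_cases h2 : ∃ y : R, x' ≤ y
      · simp only [cut, h1, h2, dite_true, dite_false, Prod.mk.injEq, reduceCtorEq, false_and] at h
      · push Not at h1 h2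
        exact ⟨fun hy => absurd hy (h1 y).not_ge, fun _ => (h2 y).le⟩
  have hsig := fun τ : Set.range fun m : W → M => tp (L := L) (Sum.elim g m) => τ.2
  choose m hm using hsig
  choose n z t hmz using fun τ => exists_term_fin hg (m τ)
  let Code := Σ n : ULift.{u} ℕ,
    (W → L.Term (Fin n.down)) × (Fin n.down → Fin n.down → ULift.{u} Prop) ×
    (Fin n.down → Option R × Prop)
  have hCode : #Code ≤ kap L := by
    rw [Cardinal.mk_sigma]
    refine (Cardinal.sum_le_sum _ (fun _ => kap L) fun a => ?_).trans ?_
    · rw [Cardinal.mk_prod, Cardinal.mk_prod]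
      simp only [Cardinal.lift_id]
      refine (mul_le_mul' ?_ (mul_le_mul' ?_ ?_)).trans (b := kap L * (kap L * kap L)) ?_
      · refine card_finite_fun_le hκ (Term.card_le_max.trans ?_) W
        have h1 : L.card ≤ kap L := self_le_add_right _ _
        refine max_le hκ (add_le_of_le hκ ?_ ((Cardinal.lift_le.2 h1).trans (by simp)))
        exact le_trans (by simp) hκ
      · exact card_fin_fun_le hκ
          (card_fin_fun_le hκ ((Cardinal.lt_aleph0_of_finite _).le.trans hκ) _) _
      · refine card_fin_fun_le hκ ?_ _
        rw [Cardinal.mk_prod, Cardinal.mk_option]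
        refine mul_le_of_le hκ ?_ ?_
        · rw [Cardinal.lift_uzero]
          exact add_le_of_le hκ hR (Cardinal.one_le_aleph0.trans hκ)
        · exact (Cardinal.lt_aleph0_of_finite _).le.trans hκ
      · rw [Cardinal.mul_eq_self hκ, Cardinal.mul_eq_self hκ]
    · rw [Cardinal.sum_const']
      refine (mul_le_mul' (by simpa using hκ) le_rfl).trans (Cardinal.mul_eq_self hκ).le
  let code : (Set.range fun m : W → M => tp (L := L) (Sum.elim g m)) → Code := fun τ =>
    ⟨⟨n τ⟩, t τ, fun a b => ⟨z τ a ≤ z τ b⟩, fun a => cut (z τ a)⟩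
  refine (Cardinal.mk_le_of_injective (f := code) fun τ τ' h => ?_).trans hCode
  have : ∀ (n' : ULift.{u} ℕ) (z' : Fin n'.down → Λ) (t' : W → L.Term (Fin n'.down)) (m' : W → M),
      (m' = fun k => (t' k).realize (i ∘ z')) →
      code τ = ⟨n', t', fun a b => ⟨z' a ≤ z' b⟩, fun a => cut (z' a)⟩ →
      tp (L := L) (Sum.elim g (m τ)) = tp (Sum.elim g m') := by
    intro n' z' t' m' hm' hc
    rw [Sigma.mk.injEq] at hc
    obtain ⟨rfl, hc⟩ := hc
    rw [heq_eq_eq] at hc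
    simp only [Prod.mk.injEq] at hc
    obtain ⟨rfl, hc2, hc3⟩ := hc
    have hc2' : ∀ a b, z τ a ≤ z τ b ↔ z' a ≤ z' b := fun a b => by
      have := congrArg ULift.down (congrFun (congrFun hc2 a) b)
      exact iff_of_eq this
    have hc3' : ∀ a, cut (z τ a) = cut (z' a) := fun a => congrFun hc3 a
    have h1 : tp (L := L) (i ∘ Sum.elim (Subtype.val : R → Λ) (z τ)) =
        tp (i ∘ Sum.elim (Subtype.val : R → Λ) z') := by
      refine hi.tp_eq hi _ _ ?_
      rintro (a | a) (b | b)
      · rfl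
      · exact ⟨(cut_le _ _ (hc3' b) a).2, (cut_le _ _ (hc3' b).symm a).2⟩
      · exact ⟨(cut_le _ _ (hc3' a) b).1, (cut_le _ _ (hc3' a).symm b).1⟩
      · exact hc2' a b
    have h2 := tp_term h1 (Sum.elim (fun a => (tg a).subst fun k => Term.var (Sum.inl k))
      (fun w => (t τ w).subst fun k => Term.var (Sum.inr k)))
    convert h2 using 2
    · funext k
      rcases k with k | k
      · simp only [Sum.elim_inl, Term.realize_subst, Term.realize_var]
        exact (htg k).symm
      · simp only [Sum.elim_inr, Term.realize_subst, Term.realize_var]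
        exact congrFun (hmz τ) k
    · funext k
      rcases k with k | k
      · simp only [Sum.elim_inl, Term.realize_subst, Term.realize_var]
        exact (htg k).symm
      · simp only [Sum.elim_inr, Term.realize_subst, Term.realize_var]
        exact congrFun hm' k
  have := this _ _ _ _ (hmz τ') h
  exact Subtype.ext ((hm τ).symm.trans (this.trans (hm τ')))

end Stability

section Symmetry

open FirstOrder.Language

universe v w x

variable {L : FirstOrder.Language.{u, u}} {K : Set (StrucOf L)}

theorem swap_invariant {p : ∀ n, Set (Atm L (Fin n))} {Λ : Type u} [LinearOrder Λ]
    {V : Type u} [L.Structure V] {i : Λ → V} (hi : Indisc p i)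
    (hst : ∀ {A : Type u} (g : A → V), #A ≤ kap L →
      #(Set.range fun m : PUnit.{u + 1} → V => tp (L := L) (Sum.elim g m)) ≤ kap L)
    {n : ℕ} {lo hi' : Fin n → Λ} (hlo : StrictMono lo) (hhi : StrictMono hi') {B D : Set Λ}
    (hB : kap L < #B) (hD : #D ≤ kap L)
    (hlt : ∀ j, ∀ b ∈ B ∪ D, lo j < b ∧ b < hi' j)
    (hdense : ∀ b ∈ B, ∀ b' ∈ B, b < b' → ∃ d ∈ D, b < d ∧ d < b')
    (k : ℕ) (hk : k + 1 < n) :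
    res (Equiv.swap (⟨k, (Nat.lt_succ_self k).trans hk⟩ : Fin n) ⟨k + 1, hk⟩) (p n) = p n := by
  classical
  by_contra hne
  let a : Fin n := ⟨k, (Nat.lt_succ_self k).trans hk⟩
  let b : Fin n := ⟨k + 1, hk⟩
  have hab : a < b := Nat.lt_succ_self k
  let E : Λ → Λ → Fin n → Λ := fun x y j =>
    if j < a then lo j else if j = a then x else if j = b then y else hi' j
  have hE : ∀ x ∈ B ∪ D, ∀ y ∈ B ∪ D, x < y → StrictMono (E x y) := by
    intro x hx y hy hxy j l hjl
    have h1 := (hlt j x hx).1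
    have h2 := (hlt j y hy).1
    have h3 := (hlt l x hx).2
    have h4 := (hlt l y hy).2
    simp only [E]
    have d1 : ¬ j < a → j ≠ a → j = b ∨ b < j := by
      intro h h'
      have : (a : ℕ) < j := lt_of_le_of_ne (not_lt.1 h) (fun h => h' (Fin.ext h.symm))
      rcases Nat.lt_or_ge k.succ j with h | h
      · exact Or.inr h
      · exact Or.inl (Fin.ext (le_antisymm h this))
    split_ifs with g1 g2 g3 g4 g5 g6 g7 g8 g9 g10 g11 <;>
      first
        | exact hlo hjl
        | exact hhi hjl
        | assumption
        | exact h1.trans h3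
        | (exfalso; subst_vars; exact absurd hjl (by assumption))
        | (exfalso; subst_vars; exact lt_irrefl _ hjl)
        | (exfalso; exact g1 (hjl.trans (by assumption)))
        | (exact (lt_irrefl b (((d1 g1 g5).resolve_left g9).trans
            (hjl.trans_eq (by assumption)))).elim)
  have e1 : ∀ x ∈ B ∪ D, ∀ y ∈ B ∪ D, x < y → tp (L := L) (i ∘ E x y) = p n :=
    fun x hx y hy h => hi n _ (hE x hx y hy h)
  have e2 : ∀ x ∈ B ∪ D, ∀ y ∈ B ∪ D, y < x →
      tp (L := L) (i ∘ E x y) = res (Equiv.swap a b) (p n) := by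
    intro x hx y hy h
    rw [← e1 y hy x hx h, res_tp]
    congr 1
    funext j
    simp only [E, Function.comp]
    congr 1
    rcases eq_or_ne j a with rfl | hja
    · simp [hab.ne', hab.not_gt]
    · rcases eq_or_ne j b with rfl | hjb
      · simp [hab.ne', hab.not_gt]
      · simp [Equiv.swap_apply_of_ne_of_ne hja hjb, hja, hjb]
  let A := D ⊕ (ULift.{u} (Fin n) ⊕ ULift.{u} (Fin n))
  let g : A → V := Sum.elim (fun d => i d)
    (Sum.elim (fun j => i (lo j.down)) fun j => i (hi' j.down))
  have hA : #A ≤ kap L := by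
    have hκ := aleph0_le_kap (L := L)
    simp only [A, Cardinal.mk_sum, Cardinal.lift_id]
    refine add_le_of_le hκ hD (add_le_of_le hκ ?_ ?_) <;>
      exact (Cardinal.lt_aleph0_of_finite _).le.trans hκ
  have hle := hst g hA
  refine absurd hB (not_lt.2 (le_trans ?_ hle))
  refine Cardinal.mk_le_of_injective
    (f := fun x : B => ⟨tp (L := L) (Sum.elim g fun _ : PUnit.{u + 1} => i x), _, rfl⟩) ?_
  have key : ∀ x ∈ B, ∀ y ∈ B, x < y →
      tp (L := L) (Sum.elim g fun _ : PUnit.{u + 1} => i x) ≠ tp (Sum.elim g fun _ => i y) := by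
    intro x hx y hy hxy heq
    obtain ⟨d, hd, hxd, hdy⟩ := hdense x hx y hy hxy
    have := tp_comp heq (fun j : Fin n => if j < a then Sum.inl (Sum.inr (Sum.inl ⟨j⟩)) else
      if j = a then Sum.inr PUnit.unit else if j = b then Sum.inl (Sum.inl ⟨d, hd⟩) else
        Sum.inl (Sum.inr (Sum.inr ⟨j⟩)))
    have f1 := e1 x (Or.inl hx) d (Or.inr hd) hxd
    have f2 := e2 y (Or.inl hy) d (Or.inr hd) hdy
    apply hne
    refine (Eq.trans ?_ f1 : res (Equiv.swap a b) (p n) = p n)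
    rw [← f2]
    convert this.symm using 2
    · funext j
      simp only [E, Function.comp]
      split_ifs <;> rfl
    · funext j
      simp only [E, Function.comp]
      split_ifs <;> rfl
  rintro ⟨x, hx⟩ ⟨y, hy⟩ h
  have h' : tp (L := L) (Sum.elim g fun _ : PUnit.{u + 1} => i x) = tp (Sum.elim g fun _ => i y) :=
    congrArg Subtype.val h
  rcases lt_trichotomy x y with hxy | hxy | hxy
  · exact absurd h' (key x hx y hy hxy)
  · exact Subtype.ext hxy
  · exact absurd h'.symm (key y hy x hx hxy)

theorem exists_dense_order {κ : Cardinal.{u}} (hκ : ℵ₀ ≤ κ) : ∃ (Λ : Type u) (_ : LinearOrder Λ)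
    (B D : Set Λ), #B = Order.succ κ ∧ #D ≤ κ ∧ (∀ x, x ∈ B ∪ D) ∧
    ∀ b ∈ B, ∀ b' ∈ B, b < b' → ∃ d ∈ D, b < d ∧ d < b' := by
  classical
  have hex : ∃ μ : Cardinal.{u}, κ < 2 ^ μ := ⟨κ, Cardinal.cantor κ⟩
  let μ := WellFounded.min (wellFounded_lt (α := Cardinal.{u})) {μ | κ < 2 ^ μ} hex
  have hμ : κ < 2 ^ μ :=
    WellFounded.min_mem (wellFounded_lt (α := Cardinal.{u})) {μ | κ < 2 ^ μ} hex
  have hmin : ∀ ν < μ, (2 : Cardinal.{u}) ^ ν ≤ κ := fun ν hν => by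
    by_contra h
    exact absurd hν (not_lt.2 (WellFounded.min_le (wellFounded_lt (α := Cardinal.{u}))
      (s := {μ | κ < 2 ^ μ}) (not_le.1 h)))
  have hμκ : μ ≤ κ := by
    by_contra h
    exact absurd (Cardinal.cantor κ) (not_lt.2 (hmin κ (not_le.1 h)))
  have hμ0 : ℵ₀ ≤ μ := by
    by_contra h
    exact absurd (hκ.trans_lt hμ) (not_lt.2 (Cardinal.power_lt_aleph0 (by simp) (not_le.1 h)).le)
  obtain ⟨lo, wf, hI⟩ := exists_initial_wellOrder μ.out
  rw [Cardinal.mk_out] at hI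
  let X := Lex (μ.out → Bool)
  let loX : LinearOrder X := inferInstanceAs (LinearOrder (Lex (μ.out → Bool)))
  let D₀ : Set X := {f | ∃ α : μ.out, ∀ β, α < β → ofLex f β = false}
  have hD₀ : #D₀ ≤ κ := by
    have hsub : D₀ ⊆ ⋃ α : μ.out, Set.range fun (h : Set.Iic α → Bool) =>
        toLex fun β => if hb : β ≤ α then h ⟨β, hb⟩ else false := by
      rintro f ⟨α, hα⟩
      refine Set.mem_iUnion.2 ⟨α, fun β => ofLex f β, ?_⟩
      refine congrArg toLex (funext fun β => ?_)
      by_cases hb : β ≤ α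
      · simp [hb]
      · simp only [hb, dite_false]
        exact (hα β (not_le.1 hb)).symm
    refine (Cardinal.mk_le_mk_of_subset hsub).trans (Cardinal.mk_iUnion_le_sum_mk.trans ?_)
    refine (Cardinal.sum_le_sum _ (fun _ => κ) fun α => ?_).trans ?_
    · refine Cardinal.mk_range_le.trans ?_
      have : #(Set.Iic α → Bool) = 2 ^ #(Set.Iic α) := by simp
      rw [this]
      apply hmin
      rw [← Set.Iio_insert]
      exact (Cardinal.mk_insert_le).trans_lt (Cardinal.add_lt_of_lt hμ0 (hI α)
        (Cardinal.one_lt_aleph0.trans_le hμ0))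
    · rw [Cardinal.sum_const', Cardinal.mk_out]
      exact (mul_le_mul' hμκ le_rfl).trans (Cardinal.mul_eq_self hκ).le
  have hX : #X = 2 ^ μ := by
    change #(μ.out → Bool) = _
    simp
  have hco : Order.succ κ ≤ #(D₀ᶜ : Set X) := by
    rw [Order.succ_le_iff]
    by_contra h
    refine absurd hμ (not_lt.2 ?_)
    rw [← hX, ← Cardinal.mk_sum_compl D₀]
    exact add_le_of_le hκ hD₀ (not_lt.1 h)
  obtain ⟨B, hBD, hB⟩ := Cardinal.le_mk_iff_exists_subset.1 hco
  refine ⟨(B ∪ D₀ : Set X), inferInstance, Subtype.val ⁻¹' B, Subtype.val ⁻¹' D₀, ?_, ?_,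
    fun x => x.2, ?_⟩
  · rw [Cardinal.mk_preimage_of_injective_of_subset_range _ _ Subtype.val_injective
      (by rw [Subtype.range_coe]; exact Set.subset_union_left)]
    exact hB
  · rw [Cardinal.mk_preimage_of_injective_of_subset_range _ _ Subtype.val_injective
      (by rw [Subtype.range_coe]; exact Set.subset_union_right)]
    exact hD₀
  · rintro ⟨b, hb⟩ _ ⟨b', hb'⟩ hbB hlt
    have hlt' : b < b' := hlt
    obtain ⟨α, heq, hα⟩ := hlt'
    let d : X := toLex fun β => if β < α then ofLex b β else decide (β = α)
    have hd : d ∈ D₀ := ⟨α, fun β hβ => by simp [d, hβ.not_gt, hβ.ne']⟩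
    have hb1 : ofLex b α = false ∧ ofLex b' α = true := Bool.lt_iff.1 hα
    have hbd : b < d := ⟨α, fun β hβ => by simp [d, hβ], by
      change ofLex b α < ofLex d α
      simp [d, hb1.1]⟩
    refine ⟨⟨d, Or.inr hd⟩, hd, hbd, lt_of_le_of_ne (not_lt.1 ?_) fun h => ?_⟩
    · rintro ⟨γ, hγ, hγ'⟩
      have h3 : ofLex b' γ = false ∧ ofLex d γ = true := Bool.lt_iff.1 hγ'
      rcases lt_or_ge γ α with h4 | h4
      · have h5 : ofLex b γ = ofLex b' γ := heq γ h4
        have h6 : ofLex d γ = ofLex b γ := by simp [d, h4]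
        rw [h3.2, h5, h3.1] at h6
        exact absurd h6 (by simp)
      · have h5 : ofLex d γ = decide (γ = α) := by simp [d, h4.not_gt]
        rw [h3.2] at h5
        have h6 : γ = α := by simpa using h5
        rw [h6, hb1.2] at h3
        exact absurd h3.1 (by simp)
    · have : d = b' := congrArg Subtype.val h
      exact hBD hbB (this ▸ hd)

theorem perm_invariant {p : ∀ n, Set (Atm L (Fin n))} {n : ℕ}
    (h : ∀ (k : ℕ) (hk : k + 1 < n),
      res (Equiv.swap (⟨k, (Nat.lt_succ_self k).trans hk⟩ : Fin n) ⟨k + 1, hk⟩) (p n) = p n)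
    (σ : Equiv.Perm (Fin n)) : res σ (p n) = p n := by
  cases n with
  | zero =>
    have : (σ : Fin 0 → Fin 0) = fun k => k := Subsingleton.elim _ _
    rw [this, res_id]
  | succ n =>
    have hσ : σ ∈ Submonoid.closure
        (Set.range fun i : Fin n => Equiv.swap i.castSucc i.succ) := by
      rw [Equiv.Perm.mclosure_swap_castSucc_succ]; trivial
    induction hσ using Submonoid.closure_induction with
    | mem x hx =>
      obtain ⟨k, rfl⟩ := hx
      exact h k (Nat.succ_lt_succ k.2)
    | one => exact res_id _
    | mul x y _ _ hx hy => rw [Equiv.Perm.coe_mul, ← res_res, hx, hy]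

end Symmetry

section Context

open FirstOrder.Language

universe v w x

variable {L : FirstOrder.Language.{u, u}} {K : Set (StrucOf L)}

/-- All injective `n`-tuples have type `p n`. -/
def Ind (p : ∀ n, Set (Atm L (Fin n))) {X : Type v} {M : Type w} [L.Structure M] (i : X → M) :
    Prop :=
  ∀ n (e : Fin n → X), Function.Injective e → tp (L := L) (i ∘ e) = p n

theorem Ind.comp {p : ∀ n, Set (Atm L (Fin n))} {X : Type v} {M : Type w} [L.Structure M]
    {i : X → M} (hi : Ind p i) {Y : Type x} {g : Y → X} (hg : Function.Injective g) :
    Ind p (i ∘ g) := fun n e he => hi n (g ∘ e) (hg.comp he)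

theorem Ind.tp_eq {p : ∀ n, Set (Atm L (Fin n))} {X : Type v} {M : Type w} {N : Type*}
    [L.Structure M] [L.Structure N] {i : X → M} (hi : Ind p i) {j : X → N} (hj : Ind p j) :
    tp (L := L) i = tp j := by
  refine tp_eq_of_finite fun s => ?_
  have h := (hi s.card (fun k => s.equivFin.symm k)
    (Subtype.val_injective.comp s.equivFin.symm.injective)).trans
    (hj s.card (fun k => s.equivFin.symm k)
    (Subtype.val_injective.comp s.equivFin.symm.injective)).symm
  have := tp_comp h s.equivFin
  convert this using 2 <;> · funext k; simp

theorem Ind.tp_comp_eq {p : ∀ n, Set (Atm L (Fin n))} {X : Type v} {M : Type w} {Y : Type*}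
    {N : Type*} [L.Structure M] [L.Structure N] {i : X → M} (hi : Ind p i) {j : Y → N}
    (hj : Ind p j) {Z : Type x} {g : Z → X} {g' : Z → Y} (hg : Function.Injective g)
    (hg' : Function.Injective g') : tp (L := L) (i ∘ g) = tp (j ∘ g') :=
  (hi.comp hg).tp_eq (hj.comp hg')

theorem Ind.of_tp_eq {p : ∀ n, Set (Atm L (Fin n))} {X : Type v} {M : Type w} {N : Type*}
    [L.Structure M] [L.Structure N] {i : X → M} (hi : Ind p i) {j : X → N}
    (h : tp (L := L) j = tp i) : Ind p j := fun n e he => (tp_comp h e).trans (hi n e he)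

theorem Ind.embedding {p : ∀ n, Set (Atm L (Fin n))} {X : Type v} {M : Type w} {N : Type*}
    [L.Structure M] [L.Structure N] {i : X → M} (hi : Ind p i) (e : M ↪[L] N) : Ind p (e ∘ i) :=
  hi.of_tp_eq (tp_embedding e i)

theorem Indisc.ind {p : ∀ n, Set (Atm L (Fin n))} (hp : ∀ n (σ : Equiv.Perm (Fin n)),
    res σ (p n) = p n) {Λ : Type v} [LinearOrder Λ] {M : Type w} [L.Structure M] {i : Λ → M}
    (hi : Indisc p i) : Ind p i := by
  intro n e he
  have hm : StrictMono (e ∘ Tuple.sort e) :=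
    (Tuple.monotone_sort e).strictMono_of_injective (he.comp (Tuple.sort e).injective)
  have h := hi n _ hm
  have h2 := congrArg (res (Tuple.sort e).symm) h
  rw [res_tp, hp] at h2
  rw [← h2]
  congr 1
  funext k
  simp

/-- The situation obtained from categoricity in `lam`. -/
structure Ctx (K : Set (StrucOf L)) (lam : Cardinal.{u}) (p : ∀ n, Set (Atm L (Fin n))) :
    Prop where
  univ : IsUniversalClass L K
  amal : Amalgamation L K
  kap_lt : kap L < lam
  two : ∃ (N : Type u) (_ : L.Structure N) (f : Fin 2 → N), Function.Injective f ∧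
      tp (L := L) f = p 2
  free : ∀ X : Type u, ∃ V ∈ K, ∃ i : X → V, Ind p i ∧ gen L i = ⊤
  cat : ∀ V ∈ K, #V = lam → ∀ X : Type u, #X = lam → ∃ i : X → V, Ind p i ∧ gen L i = ⊤
  stab : ∀ V ∈ K, #V = lam → ∀ {A : Type u} (g : A → V), #A ≤ kap L →
    ∀ (W : Type u) [Finite W], #(Set.range fun m : W → V => tp (L := L) (Sum.elim g m)) ≤ kap L

theorem Ind.injective' {p : ∀ n, Set (Atm L (Fin n))}
    (hp : ∃ (N : Type u) (_ : L.Structure N) (f : Fin 2 → N), Function.Injective f ∧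
      tp (L := L) f = p 2) {X : Type v} {M : Type w} [L.Structure M] {i : X → M} (h : Ind p i) :
    Function.Injective i := by
  obtain ⟨N, _, f, hf, hf'⟩ := hp
  intro a b hab
  by_contra hne
  have hm : Function.Injective ![a, b] := by
    intro k l hkl
    fin_cases k <;> fin_cases l <;> simp_all [eq_comm]
  have h2 := h 2 _ hm
  have := (apply_eq_of_tp_eq (h2.trans hf'.symm) 0 1).1 (by simpa using hab)
  exact absurd (hf this) (by simp)

theorem exists_ctx (hK : IsUniversalClass L K) (hap : Amalgamation L K)
    (harb : ArbitrarilyLargeModels L K) {lam : Cardinal.{u}} (hlam : kap L < lam)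
    (hcat : Categorical L K lam) : ∃ p, Ctx K lam p := by
  obtain ⟨N, hN, hcard⟩ := harb (Cardinal.beth ((Order.succ ((2 : Cardinal.{u}) ^ kap L)).ord))
  obtain ⟨p, hp, hreal⟩ := exists_template (L := L) N hcard
  have hκ := aleph0_le_kap (L := L)
  have hl0 : ℵ₀ ≤ lam := hκ.trans hlam.le
  have hr : ∀ n, IsReal K (p n) := fun n => by
    obtain ⟨f, -, hf⟩ := hreal n
    exact ⟨N, hN, f, hf⟩
  have h2 : ∃ (N : Type u) (_ : L.Structure N) (f : Fin 2 → N), Function.Injective f ∧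
      tp (L := L) f = p 2 := by
    obtain ⟨f, hf⟩ := hreal 2
    exact ⟨N, inferInstance, f, hf⟩
  have hsize : ∀ {Λ : Type u} [LinearOrder Λ] {V : StrucOf L} {i : Λ → V}, #Λ = lam →
      Indisc p i → gen L i = ⊤ → #V = lam := by
    intro Λ _ V i hΛ hi hg
    apply le_antisymm
    · exact (card_le_of_gen hg).trans (max_le hΛ.le hlam.le)
    · rw [← hΛ]
      exact Cardinal.mk_le_of_injective (hi.injective h2)
  have hstab : ∀ V ∈ K, #V = lam → ∀ {A : Type u} (g : A → V), #A ≤ kap L →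
      ∀ (W : Type u) [Finite W],
        #(Set.range fun m : W → V => tp (L := L) (Sum.elim g m)) ≤ kap L := by
    intro V hV hVl A g hA W _
    obtain ⟨lo, wf, -⟩ := exists_initial_wellOrder lam.out
    obtain ⟨V', hV', i, hi, hg⟩ := exists_indisc hK hp hr lam.out
    obtain ⟨e⟩ := hcat.2 V' hV' V hV (hsize (Cardinal.mk_out _) hi hg) hVl
    have hi' : Indisc p (e ∘ i) := fun n z hz => by
      rw [← hi n z hz]
      exact tp_embedding e.toEmbedding (i ∘ z)
    refine hi'.card_types_le ?_ g hA W
    rw [eq_top_iff]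
    intro y _
    have := (gen_embedding e.toEmbedding i (e.symm y)).2 (hg ▸ trivial)
    simpa using this
  have hperm : ∀ n (σ : Equiv.Perm (Fin n)), res σ (p n) = p n := by
    intro n
    apply perm_invariant
    intro k hk
    obtain ⟨Λ₀, lo₀, B, D, hB, hD, hBD, hdense⟩ := exists_dense_order hκ
    obtain ⟨lo, wf, -⟩ := exists_initial_wellOrder lam.out
    obtain ⟨z, hz⟩ := exists_strictMono_of_infinite (I := lam.out) (by simpa using hl0) n
    let Λ := lam.out ⊕ₗ (Λ₀ ⊕ₗ lam.out)
    have hΛ₀ : #Λ₀ ≤ lam := by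
      rw [← Cardinal.mk_univ]
      have : (Set.univ : Set Λ₀) ⊆ B ∪ D := fun x _ => hBD x
      refine (Cardinal.mk_le_mk_of_subset this).trans ((Cardinal.mk_union_le _ _).trans ?_)
      refine add_le_of_le hl0 ?_ (hD.trans hlam.le)
      rw [hB]
      exact Order.succ_le_of_lt hlam
    have hΛ : #Λ = lam := by
      change #(lam.out ⊕ (Λ₀ ⊕ lam.out)) = lam
      simp only [Cardinal.mk_sum, Cardinal.lift_id, Cardinal.mk_out]
      exact le_antisymm (add_le_of_le hl0 le_rfl (add_le_of_le hl0 hΛ₀ le_rfl))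
        (self_le_add_right _ _)
    obtain ⟨V, hV, i, hi, hg⟩ := exists_indisc hK hp hr Λ
    let ι : Λ₀ → Λ := fun x => toLex (Sum.inr (toLex (Sum.inl x)))
    have hι : StrictMono ι := fun a b h => Sum.Lex.inr_lt_inr_iff.2 (Sum.Lex.inl_lt_inl_iff.2 h)
    refine swap_invariant hi (fun g hA => hstab V hV (hsize hΛ hi hg) g hA _)
      (lo := fun j => toLex (Sum.inl (z j)))
      (hi' := fun j => toLex (Sum.inr (toLex (Sum.inr (z j))))) (B := ι '' B) (D := ι '' D)
      ?_ ?_ ?_ ?_ ?_ ?_ k hk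
    · exact fun a b h => Sum.Lex.inl_lt_inl_iff.2 (hz h)
    · exact fun a b h => Sum.Lex.inr_lt_inr_iff.2 (Sum.Lex.inr_lt_inr_iff.2 (hz h))
    · rw [Cardinal.mk_image_eq hι.injective, hB]
      exact Order.lt_succ _
    · rwa [Cardinal.mk_image_eq hι.injective]
    · intro j b hb
      rw [← Set.image_union] at hb
      obtain ⟨b, -, rfl⟩ := hb
      exact ⟨Sum.Lex.inl_lt_inr _ _, Sum.Lex.inr_lt_inr_iff.2 (Sum.Lex.inl_lt_inr _ _)⟩
    · rintro _ ⟨b, hb, rfl⟩ _ ⟨b', hb', rfl⟩ h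
      obtain ⟨d, hd, h1, h2⟩ := hdense b hb b' hb' (hι.lt_iff_lt.1 h)
      exact ⟨ι d, ⟨d, hd, rfl⟩, hι h1, hι h2⟩
  have hfree : ∀ X : Type u, ∃ V ∈ K, ∃ i : X → V, Ind p i ∧ gen L i = ⊤ := by
    intro X
    obtain ⟨lo, -, -⟩ := exists_initial_wellOrder X
    obtain ⟨V, hV, i, hi, hg⟩ := exists_indisc hK hp hr X
    exact ⟨V, hV, i, hi.ind hperm, hg⟩
  refine ⟨p, hK, hap, hlam, h2, hfree, ?_, hstab⟩
  intro V hV hVl X hX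
  obtain ⟨V', hV', i, hi, hg⟩ := hfree X
  have hV'l : #V' = lam := by
    apply le_antisymm
    · exact (card_le_of_gen hg).trans (max_le hX.le hlam.le)
    · rw [← hX]
      exact Cardinal.mk_le_of_injective (hi.injective' h2)
  obtain ⟨e⟩ := hcat.2 V' hV' V hV hV'l hVl
  refine ⟨e ∘ i, hi.embedding e.toEmbedding, ?_⟩
  rw [eq_top_iff]
  intro y _
  have := (gen_embedding e.toEmbedding i (e.symm y)).2 (hg ▸ trivial)
  simpa using this

end Context

section Tools

open FirstOrder.Language

universe v w x

variable {L : FirstOrder.Language.{u, u}} {K : Set (StrucOf L)}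

theorem exists_perm {X : Type v} {R T : Set X} (hT : (T \ R).Infinite) (S : Finset X) :
    ∃ σ : Equiv.Perm X, (∀ x ∈ R, σ x = x) ∧ ∀ x ∈ S, x ∉ R → σ x ∈ T \ R := by
  classical
  induction S using Finset.induction with
  | empty => exact ⟨1, fun _ _ => rfl, by simp⟩
  | insert x S hx ih =>
    obtain ⟨σ, h1, h2⟩ := ih
    by_cases hxR : x ∈ R
    · refine ⟨σ, h1, fun y hy hyR => ?_⟩
      rcases Finset.mem_insert.1 hy with rfl | hy
      · exact absurd hxR hyR
      · exact h2 y hy hyR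
    · obtain ⟨t, ht, htS⟩ := hT.exists_notMem_finset (S.image σ)
      refine ⟨Equiv.swap (σ x) t * σ, fun y hy => ?_, fun y hy hyR => ?_⟩
      · have hyt : y ≠ t := fun h => ht.2 (h ▸ hy)
        have hyx : y ≠ σ x := fun h => by
          have := σ.injective ((h1 y hy).trans h)
          exact hxR (this ▸ hy)
        simp [h1 y hy, Equiv.swap_apply_of_ne_of_ne hyx hyt]
      · by_cases hyx : y = x
        · subst hyx; simpa using ht
        · have hyS : y ∈ S := (Finset.mem_insert.1 hy).resolve_left hyx
          have a1 : σ y ≠ σ x := fun h => hyx (σ.injective h)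
          have a2 : σ y ≠ t := fun h => htS (h ▸ Finset.mem_image_of_mem _ hyS)
          simpa [Equiv.swap_apply_of_ne_of_ne a1 a2] using h2 y hyS hyR

theorem clo_comp {ι : Type v} {θ : Type x} {M : Type w} [L.Structure M] (f : ι → M) (g : θ → ι)
    (R : Set θ) : clo L (f ∘ g) R = clo L f (g '' R) := by
  apply le_antisymm
  · exact clo_le.2 fun k hk => apply_mem_clo f (Set.mem_image_of_mem _ hk)
  · refine clo_le.2 ?_
    rintro _ ⟨k, hk, rfl⟩
    exact apply_mem_clo (f ∘ g) hk

theorem clo_congr {ι : Type v} {M : Type w} [L.Structure M] {f g : ι → M} {R : Set ι}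
    (h : ∀ k ∈ R, f k = g k) : clo L f R = clo L g R := by
  have : (fun k : R => f k) = fun k : R => g k := funext fun k => h k k.2
  rw [clo, clo, this]

theorem clo_embedding {ι : Type v} {M : Type w} {N : Type*} [L.Structure M] [L.Structure N]
    (e : M ↪[L] N) (f : ι → M) (R : Set ι) {a : M} : e a ∈ clo L (e ∘ f) R ↔ a ∈ clo L f R :=
  gen_embedding e (fun k : R => f k) a

theorem embedding_eq_of_mem_clo {ι : Type v} {M : Type w} {N : Type*} [L.Structure M]
    [L.Structure N] {e e' : M ↪[L] N} {f : ι → M} {R : Set ι} (h : ∀ k ∈ R, e (f k) = e' (f k))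
    {a : M} (ha : a ∈ clo L f R) : e a = e' a := by
  obtain ⟨t, rfl⟩ := mem_gen.1 ha
  rw [← HomClass.realize_term, ← HomClass.realize_term]
  congr 1
  exact funext fun k => h k k.2

theorem embedding_fix_of_mem_clo {ι : Type v} {M : Type w} [L.Structure M]
    {e : M ↪[L] M} {f : ι → M} {R : Set ι} (h : ∀ k ∈ R, e (f k) = f k)
    {a : M} (ha : a ∈ clo L f R) : e a = a :=
  embedding_eq_of_mem_clo (e' := Embedding.refl L M) h ha

theorem mem_clo_of_tp_eq {X : Type v} {M : Type w} [L.Structure M] {i j : X → M}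
    (h : tp (L := L) i = tp j) {A B : Set X} {a : M} (hA : a ∈ clo L i A) (hB : a ∈ clo L i B)
    (hij : ∀ x ∈ B, j x = i x) : a ∈ clo L j A := by
  obtain ⟨e, he⟩ := exists_gen_embedding h
  have hc : ∀ R : Set X, ∀ y : gen L i, (y : M) ∈ clo L i R → y ∈ clo L (toGen L i) R := by
    intro R y hy
    exact (clo_embedding (gen L i).subtype (toGen L i) R).1 hy
  let y : gen L i := ⟨a, clo_le_gen i A hA⟩
  have h1 : e y ∈ clo L j A := by
    have := (clo_embedding e (toGen L i) A).2 (hc A y hA)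
    rwa [show (e ∘ toGen L i) = j from funext he] at this
  have h2 : e y = (gen L i).subtype y :=
    embedding_eq_of_mem_clo (f := toGen L i) (R := B)
      (fun k hk => (he k).trans (hij k hk)) (hc B y hB)
  rw [h2] at h1
  exact h1

variable {p : ∀ n, Set (Atm L (Fin n))}

/-- Closures of subsets of an indiscernible set intersect well. -/
theorem Ind.mem_clo_inter {X : Type v} {M : Type w} [L.Structure M] {i : X → M} (hi : Ind p i)
    {A B : Set X} (hAB : (A ∩ B).Infinite) {a : M} (hA : a ∈ clo L i A) (hB : a ∈ clo L i B) :
    a ∈ clo L i (A ∩ B) := by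
  obtain ⟨S, hS, haS⟩ := exists_finset_mem_clo hA
  obtain ⟨S', hS', haS'⟩ := exists_finset_mem_clo hB
  let R : Set X := ↑S' ∪ (↑S ∩ B)
  have hR : R.Finite := S'.finite_toSet.union (S.finite_toSet.inter_of_left _)
  obtain ⟨σ, h1, h2⟩ := exists_perm (hAB.sdiff hR) S
  have := mem_clo_of_tp_eq (hi.tp_eq (hi.comp σ.injective)) haS haS'
    (fun x hx => by simp [h1 x (Or.inl hx)])
  rw [clo_comp] at this
  refine clo_mono i ?_ this
  rintro _ ⟨x, hx, rfl⟩
  by_cases hxR : x ∈ R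
  · rw [h1 x hxR]
    rcases hxR with h | h
    · exact ⟨hS hx, hS' h⟩
    · exact ⟨hS hx, h.2⟩
  · exact (h2 x hx hxR).1

namespace Ctx

variable {lam : Cardinal.{u}}

theorem inj (C : Ctx K lam p) {X : Type v} {M : Type w} [L.Structure M] {i : X → M}
    (h : Ind p i) : Function.Injective i := h.injective' C.two

theorem aleph0_le (C : Ctx K lam p) : ℵ₀ ≤ lam := aleph0_le_kap.trans C.kap_lt.le

theorem card_eq (C : Ctx K lam p) {X : Type u} {M : Type u} [L.Structure M] {i : X → M}
    (h : Ind p i) (hg : gen L i = ⊤) (hX : kap L ≤ #X) : #M = #X :=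
  le_antisymm ((card_le_of_gen hg).trans (max_le le_rfl hX))
    (Cardinal.mk_le_of_injective (C.inj h))

/-- A model of size `lam` containing an indiscernible set of prescribed size. -/
theorem exists_big (C : Ctx K lam p) (A : Type u) (hA : #A ≤ lam) :
    ∃ N ∈ K, #N = lam ∧ ∃ i : lam.out ⊕ A → N, Ind p i ∧ gen L i = ⊤ := by
  obtain ⟨N, hN, i, hi, hg⟩ := C.free (lam.out ⊕ A)
  have : #(lam.out ⊕ A) = lam := by
    simp only [Cardinal.mk_sum, Cardinal.lift_id, Cardinal.mk_out]
    exact le_antisymm (add_le_of_le C.aleph0_le le_rfl hA) (self_le_add_right _ _)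
  exact ⟨N, hN, (C.card_eq hi hg (C.kap_lt.le.trans this.ge)).trans this, i, hi, hg⟩

/-- Stability: there are few types over small sets. -/
theorem card_types_le (C : Ctx K lam p) {N : StrucOf L} (hN : N ∈ K) (hNl : #N = lam)
    {A : Type u} (hA : #A ≤ kap L) (f : A → N) (W : Type u) [Finite W] :
    #{τ : Set (Atm L (A ⊕ W)) | IsReal K τ ∧ res Sum.inl τ = tp f} ≤ kap L := by
  by_contra hcon
  rw [not_le, ← Order.succ_le_iff] at hcon
  obtain ⟨P, hP, hPc⟩ := Cardinal.le_mk_iff_exists_subset.1 hcon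
  obtain ⟨Q, ⟨e⟩⟩ : ∃ Q : Type u, Nonempty (Q ≃ P) := by
    exact ⟨P, ⟨Equiv.refl _⟩⟩
  obtain ⟨M, hM, j, y, hy, hg⟩ := exists_extension_family C.univ C.amal hN (P := P)
    (fun _ => A) (fun _ => W) (fun _ => f) (fun τ => τ.1) (fun τ => (hP τ.2).1)
    (fun τ => (hP τ.2).2.symm)
  have hMl : #M = lam := by
    apply le_antisymm
    · refine (card_le_of_gen hg).trans (max_le ?_ C.kap_lt.le)
      simp only [Cardinal.mk_sum, Cardinal.lift_id, Cardinal.mk_sigma, Cardinal.sum_const']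
      refine add_le_of_le C.aleph0_le hNl.le ?_
      rw [hPc]
      refine (mul_le_mul' (Order.succ_le_of_lt C.kap_lt)
        ((Cardinal.lt_aleph0_of_finite W).le.trans C.aleph0_le)).trans
          (Cardinal.mul_eq_self C.aleph0_le).le
    · rw [← hNl]; exact Cardinal.mk_le_of_injective j.injective
  have h := C.stab M hM hMl (j ∘ f) hA W
  refine absurd (Order.lt_succ (kap L)) (not_lt.2 (le_trans ?_ h))
  rw [← hPc]
  exact Cardinal.mk_le_mk_of_subset fun τ hτ => ⟨y ⟨τ, hτ⟩, hy ⟨τ, hτ⟩⟩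

end Ctx

/-- Sparse sets in well-orders of successor type. -/
theorem exists_sparse {ν : Cardinal.{u}} (hν : ℵ₀ ≤ ν) {T : Type u} [LinearOrder T]
    (hI : ∀ t : T, #(Set.Iio t) ≤ ν) (hT : ν < #T) (lev : T → T) :
    ∃ B : Set T, ν < #B ∧ ∀ b ∈ B, ∀ b' ∈ B, b < b' → lev b < b' := by
  obtain ⟨B, hB⟩ := zorn_subset {B : Set T | ∀ b ∈ B, ∀ b' ∈ B, b < b' → lev b < b'} (by
    intro c hc hchain
    refine ⟨⋃₀ c, ?_, fun s hs => Set.subset_sUnion_of_mem hs⟩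
    rintro b ⟨s, hs, hb⟩ b' ⟨s', hs', hb'⟩ hlt
    rcases hchain.total hs hs' with h | h
    · exact hc hs' b (h hb) b' hb' hlt
    · exact hc hs b hb b' (h hb') hlt)
  refine ⟨B, ?_, hB.prop⟩
  by_contra hcon
  rw [not_lt] at hcon
  obtain ⟨t, ht⟩ := exists_gt_of_card_le hν hI hT
    (fun b : B ⊕ B => Sum.elim (fun b : B => (b : T)) (fun b : B => lev b) b)
    (by simpa using add_le_of_le hν hcon hcon)
  have h1 : ∀ b ∈ B, b < t := fun b hb => ht (Sum.inl ⟨b, hb⟩)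
  have h2 : ∀ b ∈ B, lev b < t := fun b hb => ht (Sum.inr ⟨b, hb⟩)
  have : t ∈ B := by
    refine hB.mem_of_prop_insert ?_
    rintro b (rfl | hb) b' (rfl | hb') hlt
    · exact absurd hlt (lt_irrefl _)
    · exact absurd (h1 b' hb') hlt.not_gt
    · exact h2 b hb
    · exact hB.prop b hb b' hb' hlt
  exact lt_irrefl t (h1 t this)

namespace Ctx

variable {lam : Cardinal.{u}}

/-- Finite tuples do not split long sequences of indiscernibles at high levels. -/
theorem exists_bound (C : Ctx K lam p) {T : Type u} [LinearOrder T]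
    (hI : ∀ t : T, #(Set.Iio t) ≤ kap L) (hT : kap L < #T) {A : Type u} {V : StrucOf L} (hV : V ∈ K)
    {i : T × A → V} (hi : Ind p i) {W : Type u} [Finite W] (m : W → V) :
    ∃ b : T, ∀ n (e e' : ULift.{u} (Fin n) → T × A), Function.Injective e → Function.Injective e' →
      (∀ k, b ≤ (e k).1) → (∀ k, b ≤ (e' k).1) →
      tp (L := L) (Sum.elim (i ∘ e) m) = tp (Sum.elim (i ∘ e') m) := by
  classical
  have hκ := aleph0_le_kap (L := L)
  by_contra hcon
  push Not at hcon
  have hbad : ∀ b : T, ∃ nφ : Σ n : ULift.{u} ℕ, Atm L (ULift.{u} (Fin n.down) ⊕ W),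
      ∃ e e' : ULift.{u} (Fin nφ.1.down) → T × A, Function.Injective e ∧ Function.Injective e' ∧
      (∀ k, b ≤ (e k).1) ∧ (∀ k, b ≤ (e' k).1) ∧ nφ.2 ∈ tp (Sum.elim (i ∘ e) m) ∧
      nφ.2 ∉ tp (Sum.elim (i ∘ e') m) := by
    intro b
    obtain ⟨n, e, e', h1, h2, h3, h4, h5⟩ := hcon b
    rw [Ne, Set.ext_iff, not_forall] at h5
    obtain ⟨φ, hφ⟩ := h5
    by_cases hφ1 : φ ∈ tp (L := L) (Sum.elim (i ∘ e) m)
    · exact ⟨⟨⟨n⟩, φ⟩, e, e', h1, h2, h3, h4, hφ1, fun h => hφ ⟨fun _ => h, fun _ => hφ1⟩⟩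
    · refine ⟨⟨⟨n⟩, φ⟩, e', e, h2, h1, h4, h3, ?_, hφ1⟩
      by_contra h
      exact hφ ⟨fun h' => absurd h' hφ1, fun h' => absurd h' h⟩
  have hcard : #(Σ n : ULift.{u} ℕ, Atm L (ULift.{u} (Fin n.down) ⊕ W)) ≤ kap L := by
    rw [Cardinal.mk_sigma]
    refine (Cardinal.sum_le_sum _ (fun _ => kap L) fun a => ?_).trans ?_
    · exact (card_atm_le _).trans (max_le ((Cardinal.lt_aleph0_of_finite _).le.trans hκ) le_rfl)
    · rw [Cardinal.sum_const']
      exact (mul_le_mul' (by simpa using hκ) le_rfl).trans (Cardinal.mul_eq_self hκ).le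
  obtain ⟨⟨⟨n⟩, φ⟩, hφ⟩ : ∃ nφ : Σ n : ULift.{u} ℕ, Atm L (ULift.{u} (Fin n.down) ⊕ W), ∀ b : T,
      ∃ e e' : ULift.{u} (Fin nφ.1.down) → T × A, Function.Injective e ∧ Function.Injective e' ∧
      (∀ k, b ≤ (e k).1) ∧ (∀ k, b ≤ (e' k).1) ∧ nφ.2 ∈ tp (Sum.elim (i ∘ e) m) ∧
      nφ.2 ∉ tp (Sum.elim (i ∘ e') m) := by
    by_contra h
    push Not at h
    choose b hb using h
    obtain ⟨t, ht⟩ := exists_gt_of_card_le hκ hI hT b hcard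
    obtain ⟨nφ, e, e', h1, h2, h3, h4, h5, h6⟩ := hbad t
    exact h6 (hb nφ e e' h1 h2 (fun k => (ht nφ).le.trans (h3 k))
      (fun k => (ht nφ).le.trans (h4 k)) h5)
  clear hbad hcard
  choose e e' h1 h2 h3 h4 h5 h6 using hφ
  dsimp only at e e' h1 h2 h3 h4 h5 h6
  have hlev : ∀ b, ∃ t, (∀ k, (e b k).1 < t) ∧ ∀ k, (e' b k).1 < t := by
    intro b
    obtain ⟨t, ht⟩ := exists_gt_of_card_le hκ hI hT
      (fun k : ULift.{u} (Fin n) ⊕ ULift.{u} (Fin n) =>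
        Sum.elim (fun k => (e b k).1) (fun k => (e' b k).1) k)
      ((Cardinal.lt_aleph0_of_finite _).le.trans hκ)
    exact ⟨t, fun k => ht (Sum.inl k), fun k => ht (Sum.inr k)⟩
  choose lev hl1 hl2 using hlev
  obtain ⟨B₀, hB₀, hsp₀⟩ := exists_sparse hκ hI hT lev
  obtain ⟨B, hB, hBκ⟩ := Cardinal.le_mk_iff_exists_subset.1 hB₀.le
  have hsp : ∀ b ∈ B, ∀ b' ∈ B, b < b' → lev b < b' :=
    fun b hb b' hb' => hsp₀ b (hB hb) b' (hB hb')
  let A' := B × ULift.{u} (Fin n)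
  have hA' : #A' ≤ kap L := by
    simp only [A', Cardinal.mk_prod, Cardinal.lift_id, hBκ]
    exact (mul_le_mul' le_rfl ((Cardinal.lt_aleph0_of_finite _).le.trans hκ)).trans
      (Cardinal.mul_eq_self hκ).le
  obtain ⟨N, hN, hNl, j, hj, -⟩ := C.exists_big A' (hA'.trans C.kap_lt.le)
  let y : Set B → A' → T × A := fun Z q => if q.1 ∈ Z then e q.1 q.2 else e' q.1 q.2
  have hy1 : ∀ Z q, (q.1 : T) ≤ (y Z q).1 := fun Z q => by
    simp only [y]; split_ifs
    · exact h3 _ _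
    · exact h4 _ _
  have hy2 : ∀ Z q, (y Z q).1 < lev q.1 := fun Z q => by
    simp only [y]; split_ifs
    · exact hl1 _ _
    · exact hl2 _ _
  have hinj : ∀ Z, Function.Injective (y Z) := by
    rintro Z ⟨b, k⟩ ⟨b', k'⟩ h
    rcases lt_trichotomy b b' with hb | hb | hb
    · have := (hy2 Z (b, k)).trans ((hsp b b.2 b' b'.2 hb).trans_le (hy1 Z (b', k')))
      rw [h] at this; exact absurd this (lt_irrefl _)
    · subst hb
      simp only [y] at h
      split_ifs at h
      · rw [h1 _ h]
      · rw [h2 _ h]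
    · have := (hy2 Z (b', k')).trans ((hsp b' b'.2 b b.2 hb).trans_le (hy1 Z (b, k)))
      rw [h] at this; exact absurd this (lt_irrefl _)
  have hle := C.card_types_le hN hNl hA' (j ∘ Sum.inr) W
  refine absurd (Cardinal.cantor (kap L)) (not_lt.2 (le_trans ?_ hle))
  rw [← hBκ, ← Cardinal.mk_set]
  refine Cardinal.mk_le_of_injective (f := fun Z : Set B =>
    ⟨tp (L := L) (Sum.elim (i ∘ y Z) m), isReal_tp hV _, ?_⟩) ?_
  · rw [res_tp]
    exact hi.tp_comp_eq hj (hinj Z) Sum.inr_injective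
  · have key : ∀ Z Z' : Set B, tp (L := L) (Sum.elim (i ∘ y Z) m) = tp (Sum.elim (i ∘ y Z') m) →
        ∀ b ∈ Z, b ∈ Z' := by
      intro Z Z' h b hb
      by_contra hb'
      have := tp_comp h (Sum.map (fun k => (b, k)) id)
      have e1 : (Sum.elim (i ∘ y Z) m) ∘ (Sum.map (fun k => (b, k)) id) =
          Sum.elim (i ∘ e b) m := by
        funext k; rcases k with k | k <;> simp [y, hb]
      have e2 : (Sum.elim (i ∘ y Z') m) ∘ (Sum.map (fun k => (b, k)) id) =
          Sum.elim (i ∘ e' b) m := by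
        funext k; rcases k with k | k <;> simp [y, hb']
      rw [e1, e2] at this
      exact h6 b (this ▸ h5 b)
    intro Z Z' h
    have h' := congrArg Subtype.val h
    exact Set.Subset.antisymm (key Z Z' h') (key Z' Z h'.symm)

end Ctx

end Tools

section OneTypes

open FirstOrder.Language

universe v w x

variable {L : FirstOrder.Language.{u, u}} {K : Set (StrucOf L)}

/-- The type of `a` over the tuple `f`. -/
def tp1 {ι : Type v} {M : Type w} [L.Structure M] (f : ι → M) (a : M) :
    Set (Atm L (ι ⊕ PUnit.{u + 1})) := tp (Sum.elim f fun _ => a)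

section

variable {ι : Type v} {M : Type w} {N : Type x} [L.Structure M] [L.Structure N] {f : ι → M}
  {g : ι → N} {a : M} {b : N}

theorem tp_reindex (h : tp (L := L) f = tp g) {θ : Type*} (k : θ → ι) {c : θ → M} {d : θ → N}
    (hc : ∀ z, f (k z) = c z) (hd : ∀ z, g (k z) = d z) : tp (L := L) c = tp d := by
  have := tp_comp h k
  rwa [show f ∘ k = c from funext hc, show g ∘ k = d from funext hd] at this

theorem tp1_comp (h : tp1 (L := L) f a = tp1 g b) {θ : Type*} (k : θ → ι) :
    tp1 (L := L) (f ∘ k) a = tp1 (g ∘ k) b :=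
  tp_reindex h (Sum.map k id) (by rintro (z | z) <;> rfl) (by rintro (z | z) <;> rfl)

theorem tp1_embedding (e : M ↪[L] N) (f : ι → M) (a : M) :
    tp1 (L := L) (e ∘ f) (e a) = tp1 f a := by
  have := tp_embedding e (Sum.elim f fun _ : PUnit.{u + 1} => a)
  rw [Sum.comp_elim] at this
  exact this

theorem res_tp1 {θ : Type*} (k : θ → ι) (f : ι → M) (a : M) :
    res (Sum.map k id) (tp1 (L := L) f a) = tp1 (f ∘ k) a := by
  rw [tp1, res_tp, tp1]
  congr 1
  funext z; rcases z with z | z <;> rfl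

theorem tp_of_terms (h : tp (L := L) f = tp g) {θ : Type*} {c : θ → M} {d : θ → N}
    (hc : ∀ k, ∃ t : L.Term ι, t.realize f = c k ∧ t.realize g = d k) :
    tp (L := L) c = tp d := by
  choose t h1 h2 using hc
  have := tp_term h t
  rwa [show (fun k => (t k).realize f) = c from funext h1,
    show (fun k => (t k).realize g) = d from funext h2] at this

theorem tp1_of_finite (h : ∀ s : Finset ι,
    tp1 (L := L) (fun k : s => f k) a = tp1 (fun k : s => g k) b) :
    tp1 (L := L) f a = tp1 g b := by
  classical
  refine tp_eq_of_finite fun s => ?_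
  refine tp_reindex (h (s.preimage Sum.inl Sum.inl_injective.injOn)) (fun z : s => match z with
    | ⟨Sum.inl k, hk⟩ => Sum.inl ⟨k, Finset.mem_preimage.2 hk⟩
    | ⟨Sum.inr k, _⟩ => Sum.inr k) ?_ ?_
  · rintro ⟨z | z, hz⟩ <;> rfl
  · rintro ⟨z | z, hz⟩ <;> rfl

end

/-- The type of `a` over `i` does not split over `i '' G`. -/
def Supp {X : Type v} {M : Type w} [L.Structure M] (i : X → M) (a : M) (G : Set X) : Prop :=
  ∀ n (f f' : Fin n → X), Function.Injective f → Function.Injective f' →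
    (∀ k, f k ∈ G ∨ f' k ∈ G → f k = f' k) → tp1 (L := L) (i ∘ f) a = tp1 (i ∘ f') a

theorem Supp.tp1_eq {X : Type v} {M : Type w} [L.Structure M] {i : X → M} {a : M} {G : Set X}
    (h : Supp (L := L) i a G) {W : Type x} {f f' : W → X} (hf : Function.Injective f)
    (hf' : Function.Injective f') (hff : ∀ k, f k ∈ G ∨ f' k ∈ G → f k = f' k) :
    tp1 (L := L) (i ∘ f) a = tp1 (i ∘ f') a := by
  refine tp1_of_finite fun s => ?_
  have := tp1_comp (h s.card (fun k => f (s.equivFin.symm k)) (fun k => f' (s.equivFin.symm k))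
    (hf.comp (Subtype.val_injective.comp s.equivFin.symm.injective))
    (hf'.comp (Subtype.val_injective.comp s.equivFin.symm.injective)) fun k => hff _) s.equivFin
  convert this using 2 <;> · funext k; simp

theorem exists_limit {ν : Cardinal.{u}} (hν : ℵ₀ ≤ ν) {T : Type u} [LinearOrder T]
    [WellFoundedLT T] (hI : ∀ t : T, #(Set.Iio t) ≤ ν) (hT : ν < #T) (g : T → T) (α : T) :
    ∃ (δ : T) (β : ℕ → T), StrictMono β ∧ α < β 0 ∧ (∀ n, β n < δ) ∧
      (∀ n, g (β n) < β (n + 1)) ∧ ∀ γ < δ, ∃ n, γ ≤ β n := by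
  have h1 : ∀ a b : T, ∃ t, a < t ∧ b < t := by
    intro a b
    obtain ⟨t, ht⟩ := exists_gt_of_card_le hν hI hT
      (fun k : ULift.{u} Bool => if k.down then a else b)
      ((Cardinal.lt_aleph0_of_finite _).le.trans hν)
    exact ⟨t, by simpa using ht ⟨true⟩, by simpa using ht ⟨false⟩⟩
  choose q hq1 hq2 using h1
  let β : ℕ → T := fun n => Nat.rec (q α α) (fun _ b => q b (g b)) n
  obtain ⟨t, ht⟩ := exists_gt_of_card_le hν hI hT
      (fun n : ULift.{u} ℕ => β n.down) (by simpa using hν)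
  let S : Set T := {t | ∀ n, β n < t}
  have hS : S.Nonempty := ⟨t, fun n => ht ⟨n⟩⟩
  refine ⟨WellFounded.min (wellFounded_lt (α := T)) S hS, β,
    strictMono_nat_of_lt_succ fun n => hq1 _ _, hq1 _ _,
    fun n => WellFounded.min_mem (wellFounded_lt (α := T)) S hS n, fun n => hq2 _ _, ?_⟩
  intro γ hγ
  by_contra h
  push Not at h
  exact WellFounded.not_lt_min (wellFounded_lt (α := T)) S (x := γ) h hγ

end OneTypes

section Superstability

open FirstOrder.Language

universe v w x

variable {L : FirstOrder.Language.{u, u}} {K : Set (StrucOf L)} {p : ∀ n, Set (Atm L (Fin n))}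

/-- Permutations of an indiscernible set extend to embeddings. -/
theorem Ind.exists_embedding {X : Type v} {M : Type w} [L.Structure M] {i : X → M} (hi : Ind p i)
    (hg : gen L i = ⊤) {g : X → X} (hinj : Function.Injective g) :
    ∃ e : M ↪[L] M, ∀ k, e (i k) = i (g k) :=
  exists_embedding_of_tp_eq (hi.tp_eq (hi.comp hinj)) hg

theorem exists_term_of_mem_clo {ι : Type v} {M : Type w} [L.Structure M] {f : ι → M} {R : Set ι}
    {a : M} (h : a ∈ clo L f R) : ∃ t : L.Term R, t.realize (fun k : R => f k) = a :=
  mem_gen.1 h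

namespace Ctx

variable {lam : Cardinal.{u}}

theorem exists_bound_finite (C : Ctx K lam p) {T : Type u} [LinearOrder T]
    (hI : ∀ t : T, #(Set.Iio t) ≤ kap L) (hT : kap L < #T) {A : Type u} {V : StrucOf L} (hV : V ∈ K)
    {i : T × A → V} (hi : Ind p i) {W : Type u} [Finite W] (m : W → V) :
    ∃ b : T, ∀ (Z : Type) [Finite Z] (e e' : Z → T × A), Function.Injective e →
      Function.Injective e' → (∀ k, b ≤ (e k).1) → (∀ k, b ≤ (e' k).1) →
      tp (L := L) (Sum.elim (i ∘ e) m) = tp (Sum.elim (i ∘ e') m) := by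
  obtain ⟨b, hb⟩ := C.exists_bound hI hT hV hi m
  refine ⟨b, fun Z _ e e' h1 h2 h3 h4 => ?_⟩
  let q : Z ≃ ULift.{u} (Fin (Nat.card Z)) := (Finite.equivFin Z).trans Equiv.ulift.symm
  refine tp_reindex (hb (Nat.card Z) (e ∘ q.symm) (e' ∘ q.symm) (h1.comp q.symm.injective)
    (h2.comp q.symm.injective) (fun k => h3 _) (fun k => h4 _)) (Sum.map q id) ?_ ?_
  · rintro (z | z) <;> simp
  · rintro (z | z) <;> simp

theorem not_forall_level (C : Ctx K lam p) {X : Type u} [Countable X] {V : StrucOf L} (hV : V ∈ K)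
    {i : X → V} (hi : Ind p i) (a : V) (r : X → ℕ)
    (hbad : ∀ l, ∃ n, ∃ f f' : Fin n → X, Function.Injective f ∧ Function.Injective f' ∧
      (∀ w, r (f w) ≤ l) ∧ (∀ w, r (f' w) ≤ l) ∧
      (∀ w, r (f w) < l ∨ r (f' w) < l → f w = f' w) ∧
      tp1 (L := L) (i ∘ f) a ≠ tp1 (i ∘ f') a) : False := by
  classical
  have hκ := aleph0_le_kap (L := L)
  obtain ⟨T, _, _, hI, hT⟩ := exists_succ_wellOrder (kap L)
  have hTκ : kap L < #T := hT ▸ Order.lt_succ _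
  have hTl : #T ≤ lam := hT ▸ Order.succ_le_of_lt C.kap_lt
  have hXκ : #X ≤ kap L := (Cardinal.mk_le_aleph0 (α := X)).trans hκ
  obtain ⟨N₀, hN₀, hN₀l, j₀, hj₀, -⟩ := C.exists_big (T × X) (by
    rw [Cardinal.mk_prod, Cardinal.lift_id, Cardinal.lift_id]
    exact (mul_le_mul' hTl (hXκ.trans C.kap_lt.le)).trans (Cardinal.mul_eq_self C.aleph0_le).le)
  let i₀ : T × X → N₀ := j₀ ∘ Sum.inr
  have hi₀ : Ind p i₀ := hj₀.comp Sum.inr_injective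
  let P := {δ : T // ∃ η : ℕ → T, StrictMono η ∧ (∀ n, η n < δ) ∧ ∀ β < δ, ∃ n, β ≤ η n}
  choose η hη1 hη2 hη3 using fun δ : P => δ.2
  have hPinj : ∀ δ : P, Function.Injective fun x => ((η δ (r x), x) : T × X) :=
    fun δ x y h => congrArg Prod.snd h
  obtain ⟨N, hN, e₀, y, hy, hg⟩ := exists_extension_family C.univ C.amal hN₀ (P := P)
    (fun _ => X) (fun _ => PUnit) (fun δ x => i₀ (η δ (r x), x)) (fun _ => tp1 i a)
    (fun _ => isReal_tp hV _) (fun δ => by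
      rw [tp1, res_tp]
      exact (hi₀.comp (hPinj δ)).tp_eq hi)
  have hNl : #N = lam := by
    apply le_antisymm
    · refine (card_le_of_gen hg).trans (max_le ?_ C.kap_lt.le)
      simp only [Cardinal.mk_sum, Cardinal.lift_id, Cardinal.mk_sigma, Cardinal.sum_const',
        Cardinal.mk_punit, mul_one]
      exact add_le_of_le C.aleph0_le hN₀l.le ((Cardinal.mk_subtype_le _).trans hTl)
    · rw [← hN₀l]; exact Cardinal.mk_le_of_injective e₀.injective
  obtain ⟨j, hj, hjg⟩ := C.cat N hN hNl lam.out (Cardinal.mk_out _)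
  let i₁ : T × X → N := e₀ ∘ i₀
  have hi₁ : Ind p i₁ := hi₀.embedding e₀
  choose s hs using fun q : T × X => exists_finset_of_gen_eq_top hjg (i₁ q)
  let _ : Infinite lam.out := Cardinal.infinite_iff.2 (by simpa using C.aleph0_le)
  obtain ⟨ι⟩ : Nonempty (ℕ ↪ lam.out) := ⟨Infinite.natEmbedding _⟩
  let Js : Set lam.out := Set.range ι
  have hJs : Js.Infinite := Set.infinite_range_of_injective ι.injective
  let J : T → Set lam.out := fun α => Js ∪ ⋃ q : Set.Iio α × X, (s (q.1.1, q.2) : Set lam.out)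
  have hJ : ∀ α, #(J α) ≤ kap L := by
    intro α
    refine (Cardinal.mk_union_le _ _).trans (add_le_of_le hκ ?_ ?_)
    · exact (Cardinal.le_aleph0_iff_set_countable.2 (Set.countable_range _)).trans hκ
    · refine (Cardinal.mk_iUnion_le_sum_mk).trans ((Cardinal.sum_le_sum _ (fun _ => kap L)
        fun q => (Cardinal.lt_aleph0_of_finite _).le.trans hκ).trans ?_)
      rw [Cardinal.sum_const', Cardinal.mk_prod, Cardinal.lift_id, Cardinal.lift_id]
      exact (mul_le_mul' ((mul_le_mul' (hI α) hXκ).trans (Cardinal.mul_eq_self hκ).le)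
        le_rfl).trans (Cardinal.mul_eq_self hκ).le
  have hJmono : ∀ {α β : T}, α ≤ β → J α ⊆ J β := by
    intro α β h
    refine Set.union_subset_union_right _ ?_
    refine Set.iUnion_subset fun q => ?_
    exact Set.subset_iUnion_of_subset (⟨q.1.1, lt_of_lt_of_le q.1.2 h⟩, q.2) le_rfl
  have hsJ : ∀ (q : T × X) α, q.1 < α → (s q : Set lam.out) ⊆ J α := by
    intro q α h
    refine Set.subset_union_of_subset_right ?_ _
    exact Set.subset_iUnion_of_subset (⟨q.1, h⟩, q.2) le_rfl
  have hJlim : ∀ (δ : T) (β : ℕ → T), StrictMono β → (∀ γ < δ, ∃ n, γ ≤ β n) →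
      ∀ m : Finset lam.out, ↑m ⊆ J δ → ∃ n, ↑m ⊆ J (β n) := by
    intro δ β hβ hc m
    induction m using Finset.induction with
    | empty => intro _; exact ⟨0, by simp⟩
    | insert z m _ ih =>
      intro hm
      rw [Finset.coe_insert, Set.insert_subset_iff] at hm
      obtain ⟨n, hn⟩ := ih hm.2
      obtain ⟨n', hn'⟩ : ∃ n', z ∈ J (β n') := by
        rcases hm.1 with hz | hz
        · exact ⟨0, Or.inl hz⟩
        · obtain ⟨q, hq⟩ := Set.mem_iUnion.1 hz
          obtain ⟨n', hn'⟩ := hc _ q.1.2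
          refine ⟨n' + 1, hsJ (q.1.1, q.2) _ (hn'.trans_lt (hβ (Nat.lt_succ_self _))) hq⟩
      refine ⟨max n n', ?_⟩
      rw [Finset.coe_insert, Set.insert_subset_iff]
      exact ⟨hJmono (hβ.monotone (le_max_right _ _)) hn',
        hn.trans (hJmono (hβ.monotone (le_max_left _ _)))⟩
  choose b hb using fun m : Finset lam.out =>
    C.exists_bound_finite hI hTκ hN hi₁ (fun k : m => j k)
  have hg1 : ∀ α : T, ∃ β, ∀ m : Finset lam.out, ↑m ⊆ J α → b m < β := by
    intro α
    obtain ⟨t, ht⟩ := exists_gt_of_card_le hκ hI hTκ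
      (fun m : Finset (J α) => b (m.map (Function.Embedding.subtype _))) (by
        rcases finite_or_infinite (J α) with h | h
        · exact (Cardinal.lt_aleph0_of_finite _).le.trans hκ
        · rw [Cardinal.mk_finset_of_infinite]; exact hJ α)
    refine ⟨t, fun m hm => ?_⟩
    have := ht (m.subtype (· ∈ J α))
    rwa [Finset.subtype_map_of_mem hm] at this
  choose g₁ hg₁ using hg1
  have hg2 : ∀ α : T, ∃ γ, α < γ ∧ ∀ m : Finset lam.out, ↑m ⊆ J γ → b m ≤ γ := by
    intro α
    obtain ⟨δ, β, h1, h2, h3, h4, h5⟩ := exists_limit hκ hI hTκ g₁ α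
    refine ⟨δ, h2.trans (h3 0), fun m hm => ?_⟩
    obtain ⟨n, hn⟩ := hJlim δ β h1 h5 m hm
    exact ((hg₁ _ m hn).trans ((h4 n).trans (h3 _))).le
  choose g₂ hg₂ hgood using hg2
  obtain ⟨t₀⟩ : Nonempty T := by
    rw [← Cardinal.mk_ne_zero_iff]; exact (hκ.trans_lt hTκ).ne_bot
  obtain ⟨δ, β, h1, -, h3, h4, h5⟩ := exists_limit hκ hI hTκ g₂ t₀
  let δ' : P := ⟨δ, β, h1, h3, h5⟩
  obtain ⟨k, hk⟩ := exists_finset_of_gen_eq_top hjg (y δ' PUnit.unit)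
  let kd : Finset lam.out := k.filter (· ∈ J δ)
  obtain ⟨n, hn⟩ := hJlim δ β h1 h5 kd (fun z hz => (Finset.mem_filter.1 hz).2)
  obtain ⟨γ, hγδ, hγ, hkd⟩ : ∃ γ < δ, (∀ m : Finset lam.out, ↑m ⊆ J γ → b m ≤ γ) ∧
      (kd : Set lam.out) ⊆ J γ :=
    ⟨g₂ (β n), (h4 n).trans (h3 _), hgood _, hn.trans (hJmono (hg₂ _).le)⟩
  have hl := hη3 δ' γ hγδ
  let l := Nat.find hl
  have hl1 : γ ≤ η δ' l := Nat.find_spec hl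
  have hl2 : ∀ m < l, η δ' m < γ := fun m hm => not_le.1 (Nat.find_min hl hm)
  obtain ⟨n, f, f', hf, hf', hr, hr', hff, hne⟩ := hbad l
  let z : Fin n → T × X := fun w => (η δ' (r (f w)), f w)
  let z' : Fin n → T × X := fun w => (η δ' (r (f' w)), f' w)
  have hzz : ∀ w, (r (f w) < l ∨ r (f' w) < l) → z w = z' w := fun w h => by
    simp only [z, z', hff w h]
  let S : Finset lam.out := Finset.univ.biUnion fun w => s (z w) ∪ s (z' w)
  have hSz : ∀ w, (s (z w) : Set lam.out) ⊆ S := fun w v hv =>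
    Finset.mem_biUnion.2 ⟨w, Finset.mem_univ _, Finset.mem_union_left _ hv⟩
  have hSz' : ∀ w, (s (z' w) : Set lam.out) ⊆ S := fun w v hv =>
    Finset.mem_biUnion.2 ⟨w, Finset.mem_univ _, Finset.mem_union_right _ hv⟩
  have hSJ : (S : Set lam.out) ⊆ J δ := by
    intro v hv
    obtain ⟨w, -, hw⟩ := Finset.mem_biUnion.1 (Finset.mem_coe.1 hv)
    rcases Finset.mem_union.1 hw with h | h
    · exact hsJ (z w) δ (hη2 δ' _) h
    · exact hsJ (z' w) δ (hη2 δ' _) h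
  obtain ⟨σ, hσ1, hσ2⟩ := exists_perm (T := Js) (R := ↑(S ∪ kd)) (hJs.sdiff (S ∪ kd).finite_toSet) k
  obtain ⟨e, he⟩ := hj.exists_embedding hjg σ.injective
  have hσk : ∀ v ∈ k, σ v ∈ J γ := by
    intro v hv
    by_cases hvR : v ∈ (↑(S ∪ kd) : Set lam.out)
    · rw [hσ1 v hvR]
      apply hkd
      refine Finset.mem_coe.2 (Finset.mem_filter.2 ⟨hv, ?_⟩)
      rcases Finset.mem_union.1 (Finset.mem_coe.1 hvR) with h | h
      · exact hSJ h
      · exact (Finset.mem_filter.1 h).2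
    · exact Or.inl (hσ2 v hv hvR).1
  have hfix : ∀ q : T × X, (s q : Set lam.out) ⊆ S → e (i₁ q) = i₁ q := fun q hq =>
    embedding_fix_of_mem_clo (fun v hv => by
      rw [he, hσ1 v (Finset.mem_coe.2 (Finset.mem_union_left _ (hq hv)))]) (hs q)
  let lo : Fin n → Prop := fun w => r (f w) < l ∨ r (f' w) < l
  let m : Finset lam.out := k.image σ ∪ (Finset.univ.filter lo).biUnion fun w => s (z w)
  have hlow : ∀ w, lo w → (z w).1 < γ := by
    intro w hw
    have : r (f w) < l := by
      rcases hw with h | h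
      · exact h
      · rw [hff w (Or.inr h)]; exact h
    exact hl2 _ this
  have hm : (m : Set lam.out) ⊆ J γ := by
    intro v hv
    rcases Finset.mem_union.1 (Finset.mem_coe.1 hv) with h | h
    · obtain ⟨v', hv', rfl⟩ := Finset.mem_image.1 h
      exact hσk v' hv'
    · obtain ⟨w, hw, hv'⟩ := Finset.mem_biUnion.1 h
      exact hsJ (z w) γ (hlow w (Finset.mem_filter.1 hw).2) hv'
  have hhigh : ∀ w, ¬ lo w → r (f w) = l ∧ r (f' w) = l := fun w hw =>
    ⟨le_antisymm (hr w) (not_lt.1 fun h => hw (Or.inl h)),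
      le_antisymm (hr' w) (not_lt.1 fun h => hw (Or.inr h))⟩
  have key := hb m {w // ¬ lo w} (fun w => z w.1) (fun w => z' w.1)
    ((hPinj δ').comp (hf.comp Subtype.val_injective))
    ((hPinj δ').comp (hf'.comp Subtype.val_injective))
    (fun w => (hγ m hm).trans (by simpa only [z, (hhigh w.1 w.2).1] using hl1))
    (fun w => (hγ m hm).trans (by simpa only [z', (hhigh w.1 w.2).2] using hl1))
  let a' := y δ' PUnit.unit
  have hea : e a' ∈ clo L j m := by
    have h := (clo_embedding e j (k : Set lam.out)).2 hk
    rw [show (e ∘ j) = j ∘ σ from funext he, clo_comp] at h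
    refine clo_mono j ?_ h
    rintro _ ⟨v, hv, rfl⟩
    exact Finset.mem_coe.2 (Finset.mem_union_left _ (Finset.mem_image_of_mem _ hv))
  have hlowm : ∀ w, lo w → i₁ (z w) ∈ clo L j m := fun w hw => clo_mono j (fun v hv =>
    Finset.mem_coe.2 (Finset.mem_union_right _ (Finset.mem_biUnion.2
      ⟨w, Finset.mem_filter.2 ⟨Finset.mem_univ _, hw⟩, hv⟩))) (hs (z w))
  have hterm : ∀ c : N, c ∈ clo L j m → ∃ t : L.Term ({w // ¬ lo w} ⊕ m),
      t.realize (Sum.elim (i₁ ∘ fun w : {w // ¬ lo w} => z w.1) fun k : m => j k) = c ∧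
      t.realize (Sum.elim (i₁ ∘ fun w : {w // ¬ lo w} => z' w.1) fun k : m => j k) = c := by
    intro c hc
    obtain ⟨t, ht⟩ := exists_term_of_mem_clo hc
    refine ⟨t.relabel Sum.inr, ?_, ?_⟩
    · rw [Term.realize_relabel]; exact ht
    · rw [Term.realize_relabel]; exact ht
  have key2 : tp1 (L := L) (i₁ ∘ z) (e a') = tp1 (i₁ ∘ z') (e a') := by
    refine tp_of_terms key ?_
    rintro (w | w)
    · by_cases hw : lo w
      · obtain ⟨t, ht, ht'⟩ := hterm _ (hlowm w hw)
        refine ⟨t, ht, ht'.trans ?_⟩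
        simp only [Sum.elim_inl, Function.comp, hzz w hw]
      · exact ⟨Term.var (Sum.inl ⟨w, hw⟩), rfl, rfl⟩
    · exact hterm _ hea
  have e1 : (e ∘ (i₁ ∘ z)) = i₁ ∘ z := funext fun w => hfix _ (hSz w)
  have e2 : (e ∘ (i₁ ∘ z')) = i₁ ∘ z' := funext fun w => hfix _ (hSz' w)
  rw [← e1, tp1_embedding, ← e2, tp1_embedding] at key2
  apply hne
  have h := hy δ'
  have hyt : ∀ g : Fin n → X, tp1 (L := L) (i₁ ∘ fun w => (η δ' (r (g w)), g w)) a' =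
      tp1 (i ∘ g) a := fun g => tp1_comp (show tp1 (L := L)
        (e₀ ∘ fun x => i₀ (η δ' (r x), x)) a' = tp1 i a from h) g
  have h2 := hyt f'
  exact (hyt f).symm.trans (key2.trans h2)

/-- Superstability: every element has a finite support over an indiscernible set. -/
theorem exists_supp (C : Ctx K lam p) {X : Type v} {V : StrucOf L} (hV : V ∈ K)
    {i : X → V} (hi : Ind p i) (a : V) : ∃ G : Finset X, Supp (L := L) i a G := by
  classical
  by_contra hcon
  push Not at hcon
  simp only [Supp] at hcon
  push Not at hcon
  choose n f f' h1 h2 h3 h4 using hcon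
  let Gs : ℕ → Finset X := fun l => Nat.rec ∅
    (fun _ G => G ∪ (Finset.univ.image (f G) ∪ Finset.univ.image (f' G))) l
  have hmono : Monotone Gs := monotone_nat_of_le_succ fun l => Finset.subset_union_left
  let X₀ : Set X := {x | ∃ l, x ∈ Gs l}
  have hX₀ : X₀.Countable := by
    refine (Set.countable_iUnion fun l => (Gs l).countable_toSet).mono fun x hx => ?_
    exact Set.mem_iUnion.2 hx
  let _ : Countable X₀ := hX₀
  obtain ⟨Y, ⟨q⟩⟩ : ∃ Y : Type u, Nonempty (Y ≃ X₀) := (Countable.toSmall X₀).equiv_small.imp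
    fun _ h => h.map Equiv.symm
  let _ : Countable Y := q.injective.countable
  have hlev : ∀ x : X₀, ∃ l, x.1 ∈ Gs (l + 1) := fun x => by
    obtain ⟨l, hl⟩ := x.2
    exact ⟨l, hmono (Nat.le_succ l) hl⟩
  let r : X₀ → ℕ := fun x => Nat.find (hlev x)
  have hr1 : ∀ (x : X₀) l, x.1 ∈ Gs (l + 1) → r x ≤ l := fun x l h => Nat.find_min' (hlev x) h
  have hr2 : ∀ (x : X₀) l, r x < l → x.1 ∈ Gs l := fun x l h =>
    hmono (Nat.succ_le_of_lt h) (Nat.find_spec (hlev x))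
  have hf1 : ∀ l w, f (Gs l) w ∈ Gs (l + 1) := fun l w =>
    Finset.mem_union_right _
      (Finset.mem_union_left _ (Finset.mem_image_of_mem _ (Finset.mem_univ _)))
  have hf1' : ∀ l w, f' (Gs l) w ∈ Gs (l + 1) := fun l w =>
    Finset.mem_union_right _ (Finset.mem_union_right _
      (Finset.mem_image_of_mem _ (Finset.mem_univ _)))
  have hsub : ∀ l, ∀ x ∈ Gs l, x ∈ X₀ := fun l x hx => ⟨l, hx⟩
  refine C.not_forall_level (X := Y) hV
    (hi.comp (g := fun x => ((q x : X₀) : X)) (Subtype.val_injective.comp q.injective)) a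
    (fun x => r (q x)) fun l => ?_
  refine ⟨n (Gs l), fun w => q.symm ⟨f (Gs l) w, hsub (l + 1) _ (hf1 l w)⟩,
    fun w => q.symm ⟨f' (Gs l) w, hsub (l + 1) _ (hf1' l w)⟩, ?_, ?_, ?_, ?_, ?_, ?_⟩
  · exact fun w w' h => h1 _ (congrArg Subtype.val (q.symm.injective h))
  · exact fun w w' h => h2 _ (congrArg Subtype.val (q.symm.injective h))
  · intro w
    rw [Equiv.apply_symm_apply]
    exact hr1 _ _ (hf1 l w)
  · intro w
    rw [Equiv.apply_symm_apply]
    exact hr1 _ _ (hf1' l w)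
  · intro w h
    rw [Equiv.apply_symm_apply, Equiv.apply_symm_apply] at h
    exact congrArg q.symm (Subtype.ext (h3 (Gs l) w (h.imp (hr2 _ _) (hr2 _ _))))
  · convert h4 (Gs l) using 2 <;> · funext w; simp

end Ctx

end Superstability

section Chain

open FirstOrder.Language

universe v w x

variable {L : FirstOrder.Language.{u, u}} {K : Set (StrucOf L)} {p : ∀ n, Set (Atm L (Fin n))}

theorem exists_colimit (G : ℕ → StrucOf L) (e : ∀ n, G n ↪[L] G (n + 1)) :
    ∃ (D : StrucOf L) (of : ∀ n, G n ↪[L] D), (∀ n x, of (n + 1) (e n x) = of n x) ∧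
      ∀ x, ∃ n, x ∈ Set.range (of n) := by
  let G' : ℕ → Type u := fun n => G n
  let e' : ∀ n, G' n ↪[L] G' (n + 1) := e
  refine ⟨⟨L.DirectLimit G' (DirectedSystem.natLERec e')⟩,
    DirectLimit.of L ℕ G' (DirectedSystem.natLERec e'), fun n x => ?_, fun x =>
      DirectLimit.exists_of x⟩
  have h := DirectLimit.of_f (L := L) (f := DirectedSystem.natLERec e') (i := n) (j := n + 1)
    (hij := Nat.le_succ n) (x := x)
  rw [DirectedSystem.coe_natLERec] at h
  beta_reduce at h
  rw [Nat.leRecOn_succ le_rfl, Nat.leRecOn_self] at h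
  exact h

namespace Ctx

variable {lam : Cardinal.{u}}

/-- There are few `1`-types over an indiscernible set. -/
theorem card_types_ind_le (C : Ctx K lam p) {X : Type u} (hX : #X = lam) {V : StrucOf L}
    {i : X → V} (hi : Ind p i) :
    #{τ : Set (Atm L (X ⊕ PUnit.{u + 1})) | IsReal K τ ∧ res Sum.inl τ = tp i} ≤ lam := by
  classical
  have hκ := aleph0_le_kap (L := L)
  let _ : Infinite X := Cardinal.infinite_iff.2 (hX ▸ C.aleph0_le)
  obtain ⟨ν⟩ : Nonempty (ℕ ↪ X) := ⟨Infinite.natEmbedding _⟩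
  let Xs : Set X := Set.range ν
  have hXs : Xs.Infinite := Set.infinite_range_of_injective ν.injective
  have hex : ∀ τ : {τ : Set (Atm L (X ⊕ PUnit.{u + 1})) | IsReal K τ ∧ res Sum.inl τ = tp i},
      ∃ G : Finset X, ∃ E ∈ K, ∃ (j : X → E) (a : E), Ind p j ∧ tp1 j a = τ.1 ∧
        Supp (L := L) j a G := by
    rintro ⟨τ, ⟨E, hE, f, rfl⟩, h⟩
    rw [res_tp] at h
    have hj : Ind p (f ∘ Sum.inl) := hi.of_tp_eq h
    obtain ⟨G, hG⟩ := C.exists_supp hE hj (f (Sum.inr PUnit.unit))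
    refine ⟨G, E, hE, f ∘ Sum.inl, f (Sum.inr PUnit.unit), hj, ?_, hG⟩
    rw [tp1]; congr 1; funext z; rcases z with z | z <;> rfl
  choose G E hE j a hj hτ hG using hex
  have hres : ∀ τ, res Sum.inl (res (Sum.map (Subtype.val : (Xs ∪ ↑(G τ) : Set X) → X) id) τ.1) =
      tp (L := L) fun k : (Xs ∪ ↑(G τ) : Set X) => i k := by
    intro τ
    rw [res_res, show (Sum.map (Subtype.val : (Xs ∪ ↑(G τ) : Set X) → X)
      (id : PUnit.{u + 1} → PUnit)) ∘ Sum.inl = Sum.inl ∘ Subtype.val from rfl, ← res_res, τ.2.2,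
      res_tp]
    rfl
  let F : {τ : Set (Atm L (X ⊕ PUnit.{u + 1})) | IsReal K τ ∧ res Sum.inl τ = tp i} →
      Σ G : Finset X, {τ : Set (Atm L ((Xs ∪ ↑G : Set X) ⊕ PUnit.{u + 1})) |
        IsReal K τ ∧ res Sum.inl τ = tp (L := L) fun k : (Xs ∪ ↑G : Set X) => i k} :=
    fun τ => ⟨G τ, res (Sum.map Subtype.val id) τ.1, τ.2.1.res _, hres τ⟩
  have hF : Function.Injective F := by
    intro τ τ' h
    have h1 : G τ = G τ' := congrArg Sigma.fst h
    have h2 : res (Sum.map (Subtype.val : (Xs ∪ ↑(G τ) : Set X) → X) id) τ.1 =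
        res (Sum.map (Subtype.val : (Xs ∪ ↑(G τ) : Set X) → X) id) τ'.1 := by
      have : ∀ (G' : Finset X), G τ = G' → ∀ T, HEq (res (Sum.map (Subtype.val :
          (Xs ∪ ↑(G τ) : Set X) → X) (id : PUnit.{u + 1} → PUnit)) τ.1)
          (res (Sum.map (Subtype.val : (Xs ∪ ↑G' : Set X) → X) (id : PUnit.{u + 1} → PUnit)) T) →
          res (Sum.map (Subtype.val : (Xs ∪ ↑(G τ) : Set X) → X) (id : PUnit.{u + 1} → PUnit)) τ.1 =
          res (Sum.map (Subtype.val : (Xs ∪ ↑(G τ) : Set X) → X)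
            (id : PUnit.{u + 1} → PUnit)) T := by
        rintro G' rfl T h; exact eq_of_heq h
      refine this _ h1 _ ?_
      simp only [F, Sigma.mk.injEq] at h
      have h3 := h.2
      have key : ∀ (G₁ G₂ : Finset X) (_ : G₁ = G₂) (s₁ : {τ : Set (Atm L ((Xs ∪ ↑G₁ : Set X) ⊕
          PUnit.{u + 1})) | IsReal K τ ∧ res Sum.inl τ = tp (L := L) fun k :
          (Xs ∪ ↑G₁ : Set X) => i k}) (s₂ : {τ : Set (Atm L ((Xs ∪ ↑G₂ : Set X) ⊕
          PUnit.{u + 1})) | IsReal K τ ∧ res Sum.inl τ = tp (L := L) fun k :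
          (Xs ∪ ↑G₂ : Set X) => i k}), HEq s₁ s₂ → HEq s₁.1 s₂.1 := by
        rintro G₁ _ rfl s₁ s₂ h; rw [eq_of_heq h]
      exact key _ _ h1 _ _ h3
    apply Subtype.ext
    rw [← hτ τ, ← hτ τ'] at h2 ⊢
    rw [res_tp1, res_tp1] at h2
    refine tp1_of_finite fun s => ?_
    obtain ⟨σ, hσ1, hσ2⟩ := exists_perm (T := Xs) (R := ↑(G τ)) (hXs.sdiff (G τ).finite_toSet) s
    have hσ : ∀ k : s, σ k ∈ Xs ∪ ↑(G τ) := by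
      intro k
      by_cases hk : (k : X) ∈ G τ
      · right; rw [hσ1 k hk]; exact hk
      · left; exact (hσ2 k k.2 hk).1
    have hfix : ∀ k : s, (k : X) ∈ (G τ : Set X) ∨ σ k ∈ (G τ : Set X) → (k : X) = σ k := by
      rintro k (h | h)
      · exact (hσ1 k h).symm
      · exact (σ.injective (hσ1 _ h)).symm
    have a1 := (hG τ).tp1_eq (f := fun k : s => (k : X)) (f' := fun k : s => σ k)
      Subtype.val_injective (σ.injective.comp Subtype.val_injective) hfix
    have a2 := (hG τ').tp1_eq (f := fun k : s => (k : X)) (f' := fun k : s => σ k)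
      Subtype.val_injective (σ.injective.comp Subtype.val_injective) (fun k => h1 ▸ hfix k)
    exact a1.trans ((tp1_comp h2 fun k : s => ⟨σ k, hσ k⟩).trans a2.symm)
  refine (Cardinal.mk_le_of_injective hF).trans ?_
  rw [Cardinal.mk_sigma]
  obtain ⟨N, hN, i', hi', hg⟩ := C.free X
  have hNl : #N = lam := (C.card_eq hi' hg (hX ▸ C.kap_lt.le)).trans hX
  refine (Cardinal.sum_le_sum _ (fun _ => kap L) fun G => ?_).trans ?_
  · have := C.card_types_le hN hNl (A := (Xs ∪ ↑G : Set X)) ?_ (fun k => i' k) PUnit.{u + 1}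
    · have h := hi.tp_comp_eq hi' (Z := (Xs ∪ ↑G : Set X)) Subtype.val_injective
        Subtype.val_injective
      simp only [Function.comp_def] at h
      rw [h]
      exact this
    · refine (Cardinal.le_aleph0_iff_set_countable.2 ?_).trans hκ
      exact (Set.countable_range _).union G.countable_toSet
  · rw [Cardinal.sum_const', Cardinal.mk_finset_of_infinite, hX]
    exact (mul_le_mul' le_rfl C.kap_lt.le).trans (Cardinal.mul_eq_self C.aleph0_le).le

theorem exists_step (C : Ctx K lam p) {M : StrucOf L} (hM : M ∈ K) (hMl : #M = lam) :
    ∃ M' ∈ K, #M' = lam ∧ ∃ e : M ↪[L] M', ∀ τ : Set (Atm L (M ⊕ PUnit.{u + 1})), IsReal K τ →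
      res Sum.inl τ = tp (L := L) (fun k : M => k) → ∃ a, tp1 e a = τ := by
  obtain ⟨i, hi, hg⟩ := C.cat M hM hMl lam.out (Cardinal.mk_out _)
  let P := {τ : Set (Atm L (M ⊕ PUnit.{u + 1})) | IsReal K τ ∧
    res Sum.inl τ = tp (L := L) (fun k : M => k)}
  have hP : #P ≤ lam := by
    refine le_trans ?_ (C.card_types_ind_le (Cardinal.mk_out lam) hi)
    refine Cardinal.mk_le_of_injective (f := fun τ : P => ⟨res (Sum.map i id) τ.1, τ.2.1.res _, ?_⟩)
      ?_
    · rw [res_res, show (Sum.map i (id : PUnit.{u + 1} → PUnit)) ∘ Sum.inl = Sum.inl ∘ i from rfl,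
        ← res_res, τ.2.2, res_tp]
      rfl
    · rintro ⟨τ, ⟨E, hE, f, rfl⟩, h⟩ ⟨τ', ⟨E', hE', f', rfl⟩, h'⟩ hh
      have hh := congrArg Subtype.val hh
      simp only [res_tp] at hh h h'
      apply Subtype.ext
      refine tp_of_terms hh ?_
      rintro (m | z)
      · obtain ⟨t, ht⟩ := mem_gen.1 (hg ▸ trivial : m ∈ gen L i)
        have : ∀ (E : StrucOf L) (f : M ⊕ PUnit.{u + 1} → E), tp (L := L) (f ∘ Sum.inl) =
            tp (L := L) (fun k : M => k) →
            (t.relabel Sum.inl).realize (f ∘ Sum.map i id) = f (Sum.inl m) := by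
          intro E f h
          obtain ⟨e, he⟩ := tp_id_embedding (M := M) (f := f ∘ Sum.inl) h.symm
          rw [Term.realize_relabel]
          change t.realize ((f ∘ Sum.inl) ∘ i) = (f ∘ Sum.inl) m
          rw [← he, HomClass.realize_term, ht]
        exact ⟨t.relabel Sum.inl, this E f h, this E' f' h'⟩
      · exact ⟨Term.var (Sum.inr z), rfl, rfl⟩
  obtain ⟨M', hM', e, y, hy, hgen⟩ := exists_extension_family C.univ C.amal hM (P := P)
    (fun _ => M) (fun _ => PUnit) (fun _ m => m) (fun τ => τ.1)
    (fun τ => τ.2.1) (fun τ => τ.2.2.symm)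
  refine ⟨M', hM', ?_, e, fun τ h1 h2 => ⟨y ⟨τ, h1, h2⟩ PUnit.unit, hy ⟨τ, h1, h2⟩⟩⟩
  apply le_antisymm
  · refine (card_le_of_gen hgen).trans (max_le ?_ C.kap_lt.le)
    simp only [Cardinal.mk_sum, Cardinal.lift_id, Cardinal.mk_sigma, Cardinal.sum_const',
      Cardinal.mk_punit, mul_one]
    exact add_le_of_le C.aleph0_le hMl.le hP
  · rw [← hMl]; exact Cardinal.mk_le_of_injective e.injective

theorem exists_sequence (C : Ctx K lam p) : ∃ G : ℕ → StrucOf L, (∀ n, G n ∈ K) ∧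
    (∀ n, #(G n) = lam) ∧ ∃ e : ∀ n, G n ↪[L] G (n + 1), ∀ n,
      ∀ τ : Set (Atm L (G n ⊕ PUnit.{u + 1})), IsReal K τ →
        res Sum.inl τ = tp (L := L) (fun k : G n => k) → ∃ a, tp1 (e n) a = τ := by
  choose F hF hFl e he using fun M : {M : StrucOf L // M ∈ K ∧ #M = lam} =>
    C.exists_step M.2.1 M.2.2
  obtain ⟨V, hV, i, hi, hg⟩ := C.free lam.out
  have hVl : #V = lam :=
    (C.card_eq hi hg ((Cardinal.mk_out lam).symm ▸ C.kap_lt.le)).trans (Cardinal.mk_out _)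
  let G : ℕ → {M : StrucOf L // M ∈ K ∧ #M = lam} := fun n =>
    Nat.rec ⟨V, hV, hVl⟩ (fun _ M => ⟨F M, hF M, hFl M⟩) n
  exact ⟨fun n => (G n).1, fun n => (G n).2.1, fun n => (G n).2.2, fun n => e (G n),
    fun n => he (G n)⟩

theorem exists_chain (C : Ctx K lam p) : ∃ N ∈ K, #N = lam ∧ ∃ S : ℕ → Set N, Monotone S ∧
    (∀ x, ∃ n, x ∈ S n) ∧ ∀ n, ∀ E ∈ K, ∀ h : S n → E,
      tp (L := L) (fun x : S n => (x : N)) = tp h → ∀ c, ∃ b : N,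
        tp1 (L := L) (fun x : S n => (x : N)) b = tp1 h c := by
  obtain ⟨G, hGK, hGl, e, he⟩ := C.exists_sequence
  obtain ⟨D, of, hof, hSu⟩ := exists_colimit G e
  let S : ℕ → Set D := fun n => Set.range (of n)
  have hS : Monotone S := monotone_nat_of_le_succ fun n => by
    rintro _ ⟨x, rfl⟩
    exact ⟨e n x, hof n x⟩
  have hSfin : ∀ s : Finset D, ∃ n, ↑s ⊆ S n := by
    classical
    intro s
    induction s using Finset.induction with
    | empty => exact ⟨0, by simp⟩
    | insert z s _ ih =>
      obtain ⟨n, hn⟩ := ih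
      obtain ⟨m, hm⟩ := hSu z
      refine ⟨max n m, ?_⟩
      rw [Finset.coe_insert, Set.insert_subset_iff]
      exact ⟨hS (le_max_right _ _) hm, hn.trans (hS (le_max_left _ _))⟩
  refine ⟨D, ?_, ?_, S, hS, hSu, ?_⟩
  · refine mem_of_tuples C.univ fun s => ?_
    obtain ⟨n, hn⟩ := hSfin s
    choose g hg using fun k : s => hn k.2
    refine ⟨G n, hGK n, g, ?_⟩
    rw [← tp_embedding (of n) g]
    congr 1
    exact funext fun k => (hg k).symm
  · apply le_antisymm
    · have : (Set.univ : Set D) ⊆ ⋃ n : ULift.{u} ℕ, S n.down := fun x _ => by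
        obtain ⟨n, hn⟩ := hSu x
        exact Set.mem_iUnion.2 ⟨⟨n⟩, hn⟩
      change #D ≤ lam
      rw [← Cardinal.mk_univ]
      refine (Cardinal.mk_le_mk_of_subset this).trans (Cardinal.mk_iUnion_le_sum_mk.trans
        ((Cardinal.sum_le_sum _ (fun _ => lam) fun n : ULift.{u} ℕ => Cardinal.mk_range_le.trans
          (hGl n.down).le).trans ?_))
      rw [Cardinal.sum_const', Cardinal.mk_uLift, Cardinal.mk_nat, Cardinal.lift_aleph0]
      exact (mul_le_mul' C.aleph0_le le_rfl).trans (Cardinal.mul_eq_self C.aleph0_le).le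
    · rw [← hGl 0]
      exact Cardinal.mk_le_of_injective (of 0).injective
  · intro n E hE h hh c
    have h1 : tp (L := L) (fun k : G n => k) = tp fun k => h ⟨of n k, k, rfl⟩ := by
      rw [← tp_embedding (of n) (fun k : G n => k)]
      exact tp_reindex hh (fun k => ⟨of n k, k, rfl⟩) (fun _ => rfl) (fun _ => rfl)
    obtain ⟨a, ha⟩ := he n (tp1 (fun k => h ⟨of n k, k, rfl⟩) c) (isReal_tp hE _) (by
      rw [tp1, res_tp, h1]; rfl)
    refine ⟨of (n + 1) a, ?_⟩
    choose q hq using fun x : S n => x.2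
    have h2 : tp1 (L := L) (fun k => of (n + 1) (e n k)) (of (n + 1) a) =
        tp1 (fun k => h ⟨of n k, k, rfl⟩) c :=
      (tp1_embedding (of (n + 1)) (e n) a).trans ha
    refine tp_reindex h2 (Sum.map q id) ?_ ?_
    · rintro (z | z)
      · exact (hof n (q z)).trans (hq z)
      · rfl
    · rintro (z | z)
      · exact congrArg h (Subtype.ext (hq z))
      · rfl

end Ctx

end Chain

section Saturation

open FirstOrder.Language

universe v w x

variable {L : FirstOrder.Language.{u, u}} {K : Set (StrucOf L)} {p : ∀ n, Set (Atm L (Fin n))}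

/-- One-point realization of types implies realization of types of long tuples. -/
theorem exists_tuple_of_one_point {M N : StrucOf L} {μ : Cardinal.{u}}
    (hone : ∀ {A : Type u} (f : A → M) (g : A → N), #A < μ → tp (L := L) f = tp g →
      ∀ c, ∃ b, tp1 (L := L) f b = tp1 g c)
    {A D : Type u} (hA : #(A ⊕ D) < μ) (f : A → M) (g : A ⊕ D → N)
    (h : tp (L := L) f = tp (g ∘ Sum.inl)) :
    ∃ y : D → M, tp (L := L) (Sum.elim f y) = tp g := by
  classical
  obtain ⟨R, hR⟩ := zorn_subset {R : Set (D × M) |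
    tp (L := L) (Sum.elim f fun r : R => r.1.2) =
      tp (Sum.elim (g ∘ Sum.inl) fun r : R => g (Sum.inr r.1.1))} (by
    intro c hc hchain
    rcases c.eq_empty_or_nonempty with rfl | hne
    · refine ⟨∅, ?_, by simp⟩
      refine tp_reindex h (Sum.elim id fun r : (∅ : Set (D × M)) => r.2.elim) ?_ ?_
      · rintro (z | ⟨z, hz⟩)
        · rfl
        · exact hz.elim
      · rintro (z | ⟨z, hz⟩)
        · rfl
        · exact hz.elim
    refine ⟨⋃₀ c, ?_, fun s hs => Set.subset_sUnion_of_mem hs⟩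
    refine tp_eq_of_finite fun s => ?_
    have : ∀ s' : Finset (⋃₀ c), ∃ R ∈ c, ∀ r ∈ s', r.1 ∈ R := by
      intro s'
      induction s' using Finset.induction with
      | empty => exact ⟨hne.some, hne.some_mem, by simp⟩
      | insert z s' _ ih =>
        obtain ⟨R, hR, hs⟩ := ih
        obtain ⟨R', hR', hz⟩ := z.2
        rcases hchain.total hR hR' with hh | hh
        · refine ⟨R', hR', fun r hr => ?_⟩
          rcases Finset.mem_insert.1 hr with rfl | hr
          · exact hz
          · exact hh (hs r hr)
        · refine ⟨R, hR, fun r hr => ?_⟩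
          rcases Finset.mem_insert.1 hr with rfl | hr
          · exact hh hz
          · exact hs r hr
    obtain ⟨R, hR, hs⟩ := this (s.preimage Sum.inr Sum.inr_injective.injOn)
    refine tp_reindex (hc hR) (fun z : s => match z with
      | ⟨Sum.inl k, _⟩ => Sum.inl k
      | ⟨Sum.inr k, hk⟩ => Sum.inr ⟨k.1, hs k (Finset.mem_preimage.2 hk)⟩) ?_ ?_
    · rintro ⟨z | z, hz⟩ <;> rfl
    · rintro ⟨z | z, hz⟩ <;> rfl)
  have hp : tp (L := L) (Sum.elim f fun r : R => r.1.2) =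
      tp (Sum.elim (g ∘ Sum.inl) fun r : R => g (Sum.inr r.1.1)) := hR.prop
  have hfst : Function.Injective fun r : R => r.1.1 := by
    rintro ⟨⟨d, m⟩, h1⟩ ⟨⟨d', m'⟩, h2⟩ (rfl : d = d')
    have := (apply_eq_of_tp_eq hp (Sum.inr ⟨(d, m), h1⟩) (Sum.inr ⟨(d, m'), h2⟩)).2 rfl
    simp only [Sum.elim_inr] at this
    simp [this]
  have hall : ∀ d, ∃ m, (d, m) ∈ R := by
    intro d
    obtain ⟨m, hm⟩ := hone _ _ (lt_of_le_of_lt (by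
      simp only [Cardinal.mk_sum, Cardinal.lift_id]
      exact add_le_add le_rfl (Cardinal.mk_le_of_injective hfst)) hA) hp (g (Sum.inr d))
    refine ⟨m, hR.mem_of_prop_insert ?_⟩
    refine tp_reindex hm (fun z => match z with
      | Sum.inl k => Sum.inl (Sum.inl k)
      | Sum.inr r => if hr : r.1 ∈ R then Sum.inl (Sum.inr ⟨r.1, hr⟩) else Sum.inr PUnit.unit) ?_ ?_
    · rintro (z | ⟨r, hr⟩)
      · rfl
      · by_cases hrR : r ∈ R
        · simp [hrR]
        · have : r = (d, m) := hr.resolve_right hrR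
          subst this
          simp [hrR]
    · rintro (z | ⟨r, hr⟩)
      · rfl
      · by_cases hrR : r ∈ R
        · simp [hrR]
        · have : r = (d, m) := hr.resolve_right hrR
          subst this
          simp [hrR]
  choose y hy using hall
  refine ⟨y, tp_reindex hp (Sum.map id fun d => ⟨(d, y d), hy d⟩) ?_ ?_⟩
  · rintro (z | z) <;> rfl
  · rintro (z | z) <;> rfl

namespace Ctx

variable {lam : Cardinal.{u}}

/-- Every type over an indiscernible set is realized by a term in this set and new points. -/
theorem exists_term (C : Ctx K lam p) {X : Type u} (hX : #X = lam) {E : StrucOf L} (hE : E ∈ K)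
    {i : X → E} (hi : Ind p i) (c : E) : ∃ t : L.Term (X ⊕ ℕ), ∀ (V : StrucOf L)
      (i' : X ⊕ ℕ → V), Ind p i' → tp1 (L := L) (i' ∘ Sum.inl) (t.realize i') = tp1 i c := by
  classical
  obtain ⟨N, hN, hNl, S, hS, hSu, hreal⟩ := C.exists_chain
  obtain ⟨j, hj, hjg⟩ := C.cat N hN hNl X hX
  obtain ⟨P, hP, e, y, hy⟩ := exists_extension C.univ C.amal hN hE
    (f := j) (g := Sum.elim i fun _ : PUnit.{u + 1} => c) (hj.tp_eq hi)
  let c' := y PUnit.unit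
  have hc' : tp1 (L := L) (e ∘ j) c' = tp1 i c := hy
  obtain ⟨G, hG⟩ := C.exists_supp hE hi c
  obtain ⟨n₁, hn₁⟩ : ∃ n, ∀ x ∈ G, j x ∈ S n := by
    induction G using Finset.induction with
    | empty => exact ⟨0, by simp⟩
    | insert z s _ ih =>
      clear hG
      choose q hq using hSu
      refine ⟨(insert z s).sup fun x => q (j x), fun x hx => ?_⟩
      exact hS (Finset.le_sup (f := fun x => q (j x)) hx) (hq (j x))
  obtain ⟨n₂, hn₂⟩ : ∃ n, {x | j x ∈ S n}.Infinite := by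
    by_contra hcon
    push Not at hcon
    have : (Set.univ : Set X).Countable := by
      refine (Set.countable_iUnion fun n => (hcon n).countable).mono fun x _ => ?_
      obtain ⟨n, hn⟩ := hSu (j x)
      exact Set.mem_iUnion.2 ⟨n, hn⟩
    have h2 : #X ≤ ℵ₀ := by
      rw [← Cardinal.mk_univ]; exact Cardinal.le_aleph0_iff_set_countable.2 this
    rw [hX] at h2
    exact (h2.trans aleph0_le_kap).not_gt C.kap_lt
  obtain ⟨n, hn, hB⟩ : ∃ n, (∀ x ∈ G, j x ∈ S n) ∧ {x | j x ∈ S n}.Infinite :=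
    ⟨max n₁ n₂, fun x hx => hS (le_max_left _ _) (hn₁ x hx),
      hn₂.mono fun x hx => hS (le_max_right _ _) hx⟩
  obtain ⟨b, hb⟩ := hreal n P hP (fun x => e x) (tp_embedding e _).symm c'
  obtain ⟨g, hg⟩ := exists_finset_of_gen_eq_top hjg b
  obtain ⟨t, ht⟩ := exists_term_of_mem_clo hg
  let ρ : {x // x ∈ (g : Set X)} → X ⊕ ℕ := fun x =>
    if x.1 ∈ G then Sum.inl x.1 else Sum.inr (g.equivFin x)
  refine ⟨t.relabel ρ, fun V i' hi' => ?_⟩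
  refine tp1_of_finite fun s => ?_
  let B : Set X := {x | j x ∈ S n}
  obtain ⟨σ, hσ1, hσ2⟩ := exists_perm (T := B \ g) (R := ↑G)
    ((hB.sdiff g.finite_toSet).sdiff G.finite_toSet) s
  have hσB : ∀ x ∈ s ∪ G, j (σ x) ∈ S n := by
    intro x hx
    by_cases hxG : x ∈ G
    · rw [hσ1 x hxG]; exact hn x hxG
    · exact (hσ2 x ((Finset.mem_union.1 hx).resolve_right hxG) hxG).1.1
  have hfix : ∀ k : s, (k : X) ∈ (G : Set X) ∨ σ k ∈ (G : Set X) → (k : X) = σ k := by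
    rintro k (h | h)
    · exact (hσ1 k h).symm
    · exact (σ.injective (hσ1 _ h)).symm
  have a1 := hG.tp1_eq (f := fun k : s => (k : X)) (f' := fun k : s => σ k)
      Subtype.val_injective (σ.injective.comp Subtype.val_injective) hfix
  have a2 : tp1 (L := L) (i ∘ fun k : s => σ k) c = tp1 (j ∘ fun k : s => σ k) b :=
    (tp1_comp hc' fun k : s => σ k).symm.trans (tp1_comp hb fun k : s =>
      (⟨j (σ k), hσB _ (Finset.mem_union_left _ k.2)⟩ : S n)).symm
  refine Eq.trans ?_ (a1.trans a2).symm
  let W := {x // x ∈ s ∪ G} ⊕ {x : {x // x ∈ g} // x.1 ∉ G}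
  let w₁ : W → X ⊕ ℕ := Sum.elim (fun x => Sum.inl x.1) fun x => Sum.inr (g.equivFin x.1)
  let w₂ : W → X := Sum.elim (fun x => σ x.1) fun x => x.1.1
  have hw₁ : Function.Injective w₁ := by
    rintro (x | x) (z | z) h
    · exact congrArg Sum.inl (Subtype.ext (Sum.inl_injective h))
    · cases h
    · cases h
    · exact congrArg Sum.inr (Subtype.ext (g.equivFin.injective
        (Fin.val_injective (Sum.inr_injective h))))
  have hne : ∀ x ∈ s ∪ G, ∀ z : {x : {x // x ∈ g} // x.1 ∉ G}, σ x ≠ z.1.1 := by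
    intro x hx z h
    by_cases hxG : x ∈ G
    · rw [hσ1 x hxG] at h
      exact z.2 (h ▸ hxG)
    · exact (hσ2 x ((Finset.mem_union.1 hx).resolve_right hxG) hxG).1.2 (h ▸ z.1.2)
  have hw₂ : Function.Injective w₂ := by
    rintro (x | x) (z | z) h
    · exact congrArg Sum.inl (Subtype.ext (σ.injective h))
    · exact absurd h (hne x.1 x.2 z)
    · exact absurd h.symm (hne z.1 z.2 x)
    · exact congrArg Sum.inr (Subtype.ext (Subtype.ext h))
  have key := hi'.tp_comp_eq hj hw₁ hw₂
  let t' : L.Term W := t.relabel fun x => if hx : x.1 ∈ G then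
    Sum.inl ⟨x.1, Finset.mem_union_right _ hx⟩ else Sum.inr ⟨x, hx⟩
  refine tp_of_terms key ?_
  rintro (k | z)
  · exact ⟨Term.var (Sum.inl ⟨k.1, Finset.mem_union_left _ k.2⟩), rfl, rfl⟩
  · refine ⟨t', ?_, ?_⟩
    · simp only [t', Term.realize_relabel, Sum.elim_inr]
      congr 1
      funext x
      by_cases hx : x.1 ∈ G <;> simp [hx, ρ, w₁]
    · simp only [t', Term.realize_relabel, Sum.elim_inr]
      rw [← ht]
      congr 1
      funext x
      by_cases hx : x.1 ∈ G <;> simp [hx, w₂, hσ1]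

/-- Models of size `lam` are saturated. -/
theorem saturated (C : Ctx K lam p) {N : StrucOf L} (hN : N ∈ K) (hNl : #N = lam) {E : StrucOf L}
    (hE : E ∈ K) {A : Type u} (hA : #A < lam) (f : A → N) (g : A → E)
    (h : tp (L := L) f = tp g) (c : E) : ∃ b, tp1 (L := L) f b = tp1 g c := by
  classical
  obtain ⟨j, hj, hjg⟩ := C.cat N hN hNl lam.out (Cardinal.mk_out _)
  obtain ⟨P, hP, e, y, hy⟩ := exists_extension C.univ C.amal hN hE
    (f := f) (g := Sum.elim g fun _ : PUnit.{u + 1} => c) h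
  let c' := y PUnit.unit
  have hc' : tp1 (L := L) (e ∘ f) c' = tp1 g c := hy
  obtain ⟨t, ht⟩ := C.exists_term (Cardinal.mk_out lam) hP (hj.embedding e) c'
  have hl0 : ℵ₀ < lam := aleph0_le_kap.trans_lt C.kap_lt
  obtain ⟨R, hR, hRf⟩ := exists_set_mem_clo hjg f (le_max_right #A ℵ₀) (le_max_left _ _)
  obtain ⟨q, hq⟩ := StrucOf.Term.exists_finset t
  let R' : Set lam.out := R ∪ (q.preimage Sum.inl Sum.inl_injective.injOn : Finset _)
  have hR' : #R' < lam := by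
    refine (Cardinal.mk_union_le _ _).trans_lt (Cardinal.add_lt_of_lt C.aleph0_le
      (hR.trans_lt (max_lt hA hl0)) ((Cardinal.lt_aleph0_of_finite _).trans hl0))
  have hinf : (R'ᶜ).Infinite := by
    intro hfin
    have := Cardinal.mk_sum_compl R'
    rw [Cardinal.mk_out] at this
    exact this.not_lt (Cardinal.add_lt_of_lt C.aleph0_le hR' (hfin.lt_aleph0.trans hl0))
  let ν : ℕ ↪ (R'ᶜ : Set lam.out) := Set.Infinite.natEmbedding _ hinf
  let w₁ : R' ⊕ ℕ → lam.out ⊕ ULift.{u} ℕ := Sum.map Subtype.val ULift.up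
  let w₂ : R' ⊕ ℕ → lam.out := Sum.elim Subtype.val fun n => (ν n).1
  have hw₁ : Function.Injective w₁ := Subtype.val_injective.sumMap ULift.up_injective
  have hw₂ : Function.Injective w₂ := by
    rintro (x | x) (z | z) h
    · exact congrArg Sum.inl (Subtype.ext h)
    · exact absurd ((show x.1 = (ν z).1 from h) ▸ x.2) (ν z).2
    · exact absurd ((show (ν x).1 = z.1 from h) ▸ z.2) (ν x).2
    · exact congrArg Sum.inr (ν.injective (Subtype.ext h))
  obtain ⟨V, hV, i₀, hi₀, -⟩ := C.free (lam.out ⊕ ULift.{u} ℕ)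
  let i' : lam.out ⊕ ℕ → V := i₀ ∘ Sum.map id ULift.up
  have hi' : Ind p i' := hi₀.comp (Function.injective_id.sumMap ULift.up_injective)
  have key : tp (L := L) (i₀ ∘ w₁) = tp (j ∘ w₂) := hi₀.tp_comp_eq hj hw₁ hw₂
  obtain ⟨r, hr⟩ : ∃ r : L.Term (R' ⊕ ℕ), r.realize (i₀ ∘ w₁) = t.realize i' := by
    obtain ⟨r, hr⟩ := hq q (subset_refl _)
    refine ⟨r.relabel fun z => match z with
      | ⟨Sum.inl x, hx⟩ => Sum.inl ⟨x, Or.inr (Finset.mem_preimage.2 hx)⟩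
      | ⟨Sum.inr n, _⟩ => Sum.inr n, ?_⟩
    rw [← hr, Term.realize_relabel, Term.realize_subst]
    congr 1
    funext z
    rcases z with ⟨z | z, hz⟩ <;> rfl
  refine ⟨r.realize (j ∘ w₂), ?_⟩
  rw [← hc']
  choose s hs using fun a => exists_term_of_mem_clo (hRf a)
  have h1 := ht V i' hi'
  have h2 : tp1 (L := L) (fun a => (s a).realize fun k : R => i' (Sum.inl k)) (t.realize i') =
      tp1 (e ∘ f) c' := by
    refine tp_of_terms h1 ?_
    rintro (a | z)
    · refine ⟨((s a).relabel fun k : R => Sum.inl k.1), ?_, ?_⟩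
      · rw [Term.realize_relabel]; rfl
      · rw [Term.realize_relabel, Sum.elim_inl, Function.comp, ← hs a, ← HomClass.realize_term]
        rfl
    · exact ⟨Term.var (Sum.inr z), rfl, rfl⟩
  rw [← h2]
  refine (tp_of_terms key ?_).symm
  rintro (a | z)
  · refine ⟨((s a).relabel fun k : R => Sum.inl ⟨k.1, Or.inl k.2⟩), ?_, ?_⟩
    · rw [Term.realize_relabel]; rfl
    · rw [Term.realize_relabel, Sum.elim_inl, ← hs a]
      rfl
  · exact ⟨r, hr, rfl⟩

theorem saturated_tuple (C : Ctx K lam p) {N : StrucOf L} (hN : N ∈ K) (hNl : #N = lam)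
    {E : StrucOf L} (hE : E ∈ K) {A D : Type u} (hA : #(A ⊕ D) < lam) (f : A → N) (g : A ⊕ D → E)
    (h : tp (L := L) f = tp (g ∘ Sum.inl)) :
    ∃ y : D → N, tp (L := L) (Sum.elim f y) = tp g :=
  exists_tuple_of_one_point (fun f g hA h c => C.saturated hN hNl hE hA f g h c) hA f g h

end Ctx

end Saturation

section MinimalTypes

open FirstOrder.Language

universe v w x

variable {L : FirstOrder.Language.{u, u}} {K : Set (StrucOf L)} {p : ∀ n, Set (Atm L (Fin n))}

/-- Eventually constant types have a limit. -/
theorem exists_limit_model (hK : IsUniversalClass L K) {M : StrucOf L} (hM : M ∈ K) {ι : Type u}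
    (F : ℕ → ι → M) (h : ∀ s : Finset ι, ∃ n, ∀ m ≥ n,
      tp (L := L) (fun k : s => F m k) = tp fun k : s => F n k) :
    ∃ E ∈ K, ∃ f : ι → E, ∀ {θ : Type u} (k : θ → ι) (n : ℕ),
      (∀ m ≥ n, tp (L := L) (F m ∘ k) = tp (F n ∘ k)) → tp (L := L) (f ∘ k) = tp (F n ∘ k) := by
  let T : Set (Atm L ι) := {φ | ∃ n, ∀ m ≥ n, φ ∈ tp (L := L) (F m)}
  have hT : ∀ {θ : Type u} (k : θ → ι) (n : ℕ),
      (∀ m ≥ n, tp (L := L) (F m ∘ k) = tp (F n ∘ k)) → res k T = tp (L := L) (F n ∘ k) := by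
    intro θ k n hn
    ext φ
    constructor
    · rintro ⟨q, hq⟩
      have := hq (max n q) (le_max_right _ _)
      rw [← mem_res, res_tp, hn _ (le_max_left _ _)] at this
      exact this
    · intro hφ
      refine ⟨n, fun m hm => ?_⟩
      rw [← mem_res, res_tp, hn m hm]
      exact hφ
  obtain ⟨E, hE, f, hf, -⟩ := exists_model hK (T := T) (by
    intro s
    obtain ⟨n, hn⟩ := h s
    rw [hT _ n hn]
    exact isReal_tp hM _)
  refine ⟨E, hE, f, fun k n hn => ?_⟩
  rw [← res_tp, hf, hT k n hn]

theorem Supp.mono {X : Type v} {M : Type w} [L.Structure M] {i : X → M} {a : M} {G G' : Set X}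
    (h : Supp (L := L) i a G) (hG : G ⊆ G') : Supp (L := L) i a G' :=
  fun n f f' hf hf' hff => h n f f' hf hf' fun k hk => hff k (hk.imp (@hG _) (@hG _))

theorem Supp.comp {X : Type v} {M : Type w} [L.Structure M] {i : X → M} {a : M} {G : Set X}
    (h : Supp (L := L) i a G) {Y : Type x} {g : Y → X} (hg : Function.Injective g) :
    Supp (L := L) (i ∘ g) a (g ⁻¹' G) :=
  fun n f f' hf hf' hff => h n (g ∘ f) (g ∘ f') (hg.comp hf) (hg.comp hf') fun k hk =>
    congrArg g (hff k hk)

theorem Supp.of_tp1_eq {X : Type v} {M : Type w} [L.Structure M] {i : X → M} {a : M} {G : Set X}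
    (h : Supp (L := L) i a G) {N : Type*} [L.Structure N] {j : X → N} {b : N}
    (he : tp1 (L := L) j b = tp1 i a) : Supp (L := L) j b G :=
  fun n f f' hf hf' hff => (tp1_comp he f).trans ((h n f f' hf hf' hff).trans (tp1_comp he f').symm)

/-- Elements with finite supports in a small set are determined by their types over it. -/
theorem tp1_eq_of_supp {X : Type v} {M : Type w} [L.Structure M] {i : X → M} {a b : M}
    {s : Set X} (hs : s.Infinite) {G G' : Finset X} (hG : ↑G ⊆ s) (hG' : ↑G' ⊆ s)
    (ha : Supp (L := L) i a G) (hb : Supp (L := L) i b G')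
    (hab : tp1 (L := L) (fun k : s => i k) a = tp1 (fun k : s => i k) b) :
    tp1 (L := L) i a = tp1 i b := by
  classical
  refine tp1_of_finite fun t => ?_
  have ha' := ha.mono (G' := ↑G ∪ ↑G') Set.subset_union_left
  have hb' := hb.mono (G' := ↑G ∪ ↑G') Set.subset_union_right
  obtain ⟨σ, h1, h2⟩ := exists_perm (R := (G : Set X) ∪ G') (T := s)
    (hs.sdiff (G.finite_toSet.union G'.finite_toSet)) t
  have hσ : ∀ k : t, σ k ∈ s := by
    intro k
    by_cases hk : (k : X) ∈ (G : Set X) ∪ G'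
    · rw [h1 _ hk]; exact Set.union_subset hG hG' hk
    · exact (h2 k k.2 hk).1
  have hfix : ∀ k : t, (k : X) ∈ (G : Set X) ∪ G' ∨ σ k ∈ (G : Set X) ∪ G' → (k : X) = σ k := by
    rintro k (h | h)
    · exact (h1 k h).symm
    · exact (σ.injective (h1 _ h)).symm
  have a1 := ha'.tp1_eq (f := fun k : t => (k : X)) (f' := fun k : t => σ k)
      Subtype.val_injective (σ.injective.comp Subtype.val_injective) hfix
  have a2 := hb'.tp1_eq (f := fun k : t => (k : X)) (f' := fun k : t => σ k)
      Subtype.val_injective (σ.injective.comp Subtype.val_injective) hfix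
  exact a1.trans ((tp1_comp hab fun k : t => (⟨σ k, hσ k⟩ : s)).trans a2.symm)

/-- The type of `a` over `s` is non-algebraic and has a unique non-algebraic extension over
finite enlargements of `s`. -/
structure MinType {X : Type v} {M : Type w} [L.Structure M] (i : X → M) (s : Set X) (a : M) :
    Prop where
  inf : s.Infinite
  count : s.Countable
  notMem : a ∉ clo L i s
  min : ∀ s', s ⊆ s' → (s' \ s).Finite → ∀ b ∉ clo L i s', ∀ b' ∉ clo L i s',
    tp1 (L := L) (fun k : s => i k) b = tp1 (fun k : s => i k) a →
    tp1 (L := L) (fun k : s => i k) b' = tp1 (fun k : s => i k) a →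
    tp1 (L := L) (fun k : s' => i k) b = tp1 (fun k : s' => i k) b'

namespace Ctx

variable {lam : Cardinal.{u}}

theorem mem_clo_iff (C : Ctx K lam p) {X : Type v} [Infinite X] {M : Type w} [L.Structure M]
    {i : X → M} (h : Ind p i) {x : X} {s : Set X} : i x ∈ clo L i s ↔ x ∈ s := by
  classical
  refine ⟨fun hx => ?_, apply_mem_clo i⟩
  by_contra hxs
  obtain ⟨S, hS, hxS⟩ := exists_finset_mem_clo hx
  obtain ⟨t, ht⟩ := exists_term_of_mem_clo hxS
  obtain ⟨y, hy⟩ := Infinite.exists_notMem_finset (insert x S)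
  rw [Finset.mem_insert, not_or] at hy
  have key := h.tp_comp_eq h (g := Sum.elim (fun k : (S : Set X) => (k : X)) fun _ : Unit => x)
    (g' := Sum.elim (fun k : (S : Set X) => (k : X)) fun _ : Unit => y)
    (by
      rintro (⟨k, hk⟩ | k) (⟨l, hl⟩ | l) hkl
      · exact congrArg Sum.inl (Subtype.ext hkl)
      · exact absurd (hS hk) ((show k = x from hkl) ▸ hxs)
      · exact absurd (hS hl) ((show x = l from hkl) ▸ hxs)
      · rfl)
    (by
      rintro (⟨k, hk⟩ | k) (⟨l, hl⟩ | l) hkl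
      · exact congrArg Sum.inl (Subtype.ext hkl)
      · exact absurd hk ((show k = y from hkl) ▸ hy.2)
      · exact absurd hl ((show y = l from hkl) ▸ hy.2)
      · rfl)
  have h2 : tp (L := L) ![i x, i x] = tp ![i x, i y] := by
    refine tp_of_terms key fun k => ?_
    fin_cases k
    · refine ⟨t.relabel Sum.inl, ?_, ?_⟩ <;> rw [Term.realize_relabel] <;> exact ht
    · exact ⟨Term.var (Sum.inr ()), rfl, rfl⟩
  have h3 : i x = i y := (apply_eq_of_tp_eq h2 0 1).1 rfl
  exact hy.1 (C.inj h h3).symm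

theorem exists_minType (C : Ctx K lam p) {X : Type u} (hX : Infinite X) {M : StrucOf L}
    (hM : M ∈ K) {i : X → M} (hi : Ind p i) : ∃ s a, MinType (L := L) i s a := by
  classical
  by_contra hcon
  push Not at hcon
  let P : Set X × M → Prop := fun q => q.1.Infinite ∧ q.1.Countable ∧ q.2 ∉ clo L i q.1
  have step : ∀ q, P q → ∃ q', P q' ∧ q.1 ⊆ q'.1 ∧
      tp1 (L := L) (fun k : q.1 => i k) q'.2 = tp1 (fun k : q.1 => i k) q.2 ∧
      ∀ G : Finset q'.1, (∀ k ∈ G, (k : X) ∈ q.1) →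
        ¬ Supp (L := L) (fun k : q'.1 => i k) q'.2 G := by
    rintro ⟨s, a⟩ ⟨hs1, hs2, ha⟩
    by_contra hno
    refine hcon s a ⟨hs1, hs2, ha, fun s' hs' hfin b hb b' hb' hba hba' => ?_⟩
    have hc : s'.Countable := by
      rw [← Set.union_sdiff_cancel hs']
      exact hs2.union hfin.countable
    have : ∀ b ∉ clo L i s', tp1 (L := L) (fun k : s => i k) b = tp1 (fun k : s => i k) a →
        ∃ G : Finset s', (∀ k ∈ G, (k : X) ∈ s) ∧ Supp (L := L) (fun k : s' => i k) b G := by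
      intro b hb hba
      by_contra hno'
      push Not at hno'
      exact hno ⟨(s', b), ⟨hs1.mono hs', hc, hb⟩, hs', hba, hno'⟩
    obtain ⟨G, hG, hGs⟩ := this b hb hba
    obtain ⟨G', hG', hGs'⟩ := this b' hb' hba'
    refine tp1_eq_of_supp (s := Subtype.val ⁻¹' s)
      (hs1.preimage (by rwa [Subtype.range_val])) hG hG' hGs hGs' ?_
    exact tp1_comp (hba.trans hba'.symm) fun k : (Subtype.val ⁻¹' s : Set s') => (⟨k.1.1, k.2⟩ : s)
  obtain ⟨x₀⟩ : Nonempty X := inferInstance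
  obtain ⟨s₀, hs₀, hs₀i, hs₀c⟩ : ∃ s₀ : Set X, x₀ ∉ s₀ ∧ s₀.Infinite ∧ s₀.Countable := by
    have : ({x₀}ᶜ : Set X).Infinite := (Set.finite_singleton x₀).infinite_compl
    refine ⟨Set.range fun n => (this.natEmbedding _ n).1, ?_, ?_, Set.countable_range _⟩
    · rintro ⟨n, hn⟩
      exact (this.natEmbedding _ n).2 hn
    · exact Set.infinite_range_of_injective
        (Subtype.val_injective.comp (this.natEmbedding _).injective)
  have h₀ : P (s₀, i x₀) := ⟨hs₀i, hs₀c, fun h => hs₀ ((C.mem_clo_iff hi).1 h)⟩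
  choose! F hF1 hF2 hF3 hF4 using step
  let q : ℕ → Set X × M := fun n => F^[n] (s₀, i x₀)
  have hq1 : ∀ n, q (n + 1) = F (q n) := fun n => Function.iterate_succ_apply' _ _ _
  have hqP : ∀ n, P (q n) := by
    intro n
    induction n with
    | zero => exact h₀
    | succ n ih => rw [hq1]; exact hF1 _ ih
  have hmono : Monotone fun n => (q n).1 := monotone_nat_of_le_succ fun n => by
    rw [hq1]; exact hF2 _ (hqP n)
  have htp : ∀ n m, n ≤ m → tp1 (L := L) (fun k : (q n).1 => i k) (q m).2 =
      tp1 (fun k : (q n).1 => i k) (q n).2 := by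
    intro n m hnm
    induction m, hnm using Nat.le_induction with
    | base => rfl
    | succ m hnm ih =>
      refine Eq.trans ?_ ih
      have := hF3 _ (hqP m)
      rw [← hq1] at this
      exact tp1_comp this fun k : (q n).1 => (⟨k, hmono hnm k.2⟩ : (q m).1)
  let U : Set X := ⋃ n, (q n).1
  have hfinU : ∀ G : Finset U, ∃ n, ∀ k ∈ G, (k : X) ∈ (q n).1 := by
    intro G
    choose r hr using fun k : U => Set.mem_iUnion.1 k.2
    exact ⟨G.sup r, fun k hk => hmono (Finset.le_sup hk) (hr k)⟩
  obtain ⟨E, hE, f, hf⟩ := exists_limit_model C.univ hM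
    (fun m => Sum.elim (fun k : U => i k) fun _ : PUnit.{u + 1} => (q m).2) (by
    intro s
    obtain ⟨n, hn⟩ := hfinU (s.preimage Sum.inl Sum.inl_injective.injOn)
    refine ⟨n, fun m hm => tp_reindex (htp n m hm) (fun z : s => match z with
      | ⟨Sum.inl k, hk⟩ => Sum.inl ⟨k, hn k (Finset.mem_preimage.2 hk)⟩
      | ⟨Sum.inr k, _⟩ => Sum.inr k) ?_ ?_⟩
    · rintro ⟨z | z, hz⟩ <;> rfl
    · rintro ⟨z | z, hz⟩ <;> rfl)
  have hfi : Ind p (f ∘ Sum.inl) := by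
    refine Ind.of_tp_eq (hi.comp Subtype.val_injective) (hf Sum.inl 0 fun m _ => rfl)
  obtain ⟨G, hG⟩ := C.exists_supp hE hfi (f (Sum.inr PUnit.unit))
  obtain ⟨n, hn⟩ := hfinU G
  let ε : (q (n + 1)).1 → U := fun k => ⟨k, Set.mem_iUnion.2 ⟨n + 1, k.2⟩⟩
  have hε : Function.Injective ε := fun k l h => Subtype.ext (congrArg (fun x : U => (x : X)) h)
  have h1 : tp1 (L := L) (fun k : (q (n + 1)).1 => i k) (q (n + 1)).2 =
      tp1 ((f ∘ Sum.inl) ∘ ε) (f (Sum.inr PUnit.unit)) := by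
    have := hf (Sum.map ε id) (n + 1) fun m hm => by
      refine tp_reindex (htp (n + 1) m hm) id ?_ ?_
      · rintro (z | z) <;> rfl
      · rintro (z | z) <;> rfl
    refine (tp_reindex this id ?_ ?_).symm
    · rintro (z | z) <;> rfl
    · rintro (z | z) <;> rfl
  have h2 := (hG.comp hε).of_tp1_eq h1
  have h3 := hF4 _ (hqP n)
  rw [← hq1] at h3
  refine h3 (G.preimage ε hε.injOn) (fun k hk => hn _ (Finset.mem_preimage.1 hk)) ?_
  rwa [Finset.coe_preimage]

end Ctx

end MinimalTypes

section UniqueExtensions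

open FirstOrder.Language

universe v w x

variable {L : FirstOrder.Language.{u, u}} {K : Set (StrucOf L)} {p : ∀ n, Set (Atm L (Fin n))}

theorem mem_gen_of_tp1_eq {ι : Type v} {M : Type w} {N : Type x} [L.Structure M] [L.Structure N]
    {f : ι → M} {g : ι → N} {a : M} {b : N} (h : tp1 (L := L) f a = tp1 g b)
    (ha : a ∈ gen L f) : b ∈ gen L g := by
  obtain ⟨t, ht⟩ := mem_gen.1 ha
  have h1 := (eq_of_tp_eq h (t.relabel Sum.inl) (Term.var (Sum.inr PUnit.unit))).1 (by
    rw [Term.realize_relabel]; exact ht)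
  rw [Term.realize_relabel] at h1
  exact mem_gen.2 ⟨t, h1⟩

/-- A non-algebraic type over an indiscernible set `S` with unique non-algebraic extensions. -/
structure UniqType (K : Set (StrucOf L)) (lam : Cardinal.{u}) (p : ∀ n, Set (Atm L (Fin n)))
    (S : Type u) (Q : Set (Atm L (S ⊕ PUnit.{u + 1}))) : Prop where
  inf : Infinite S
  count : #S ≤ ℵ₀
  nonalg : ∀ N ∈ K, #N = lam → ∀ h : S → N, Ind p h → ∀ {B : Type u} (g : B → N), #B < lam →
    ∃ b, tp1 (L := L) h b = Q ∧ b ∉ gen L (Sum.elim h g)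
  uniq : ∀ E ∈ K, ∀ E' ∈ K, ∀ {D : Type u} (d : S ⊕ D → E) (d' : S ⊕ D → E'),
    tp (L := L) d = tp d' → Ind p (d ∘ Sum.inl) → ∀ b b', b ∉ gen L d → b' ∉ gen L d' →
    tp1 (L := L) (d ∘ Sum.inl) b = Q → tp1 (L := L) (d' ∘ Sum.inl) b' = Q →
    tp1 (L := L) d b = tp1 d' b'

namespace Ctx

variable {lam : Cardinal.{u}}

theorem exists_realization_notMem_clo_of_disjoint (C : Ctx K lam p) {X : Type u} (hX : #X = lam)
    {N : StrucOf L} (hN : N ∈ K) {i : X → N} (hi : Ind p i) (hg : gen L i = ⊤) {s : Set X}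
    (hsi : s.Infinite) (hsc : #s ≤ ℵ₀) {D : Type u} [Finite D] {h : D → N} {Y : Finset X}
    (hdis : Disjoint s (Y : Set X))
    (hY : ∀ k, h k ∈ clo L i (s ∪ Y)) {E : StrucOf L} (hE : E ∈ K) {d : s ⊕ D → E}
    (hd : tp (L := L) (Sum.elim (fun k : s => i k) h) = tp d) {b : E} (hb : b ∉ gen L d) :
    ∃ b₁, tp1 (L := L) (Sum.elim (fun k : s => i k) h) b₁ = tp1 d b ∧
      b₁ ∉ clo L i (s ∪ Y) := by
  classical
  have hl0 : ℵ₀ < lam := aleph0_le_kap.trans_lt C.kap_lt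
  let g : ((Y : Set X)ᶜ : Set X) ⊕ D → N := Sum.elim (fun k => i k) h
  have hsg : ∀ k : s, (k : X) ∈ (Y : Set X)ᶜ := fun k => Set.disjoint_left.1 hdis k.2
  have hN₁ : (⟨gen L g⟩ : StrucOf L) ∈ K := gen_mem C.univ hN g
  have hcard : #(gen L g) = lam := by
    have hYc : #((Y : Set X)ᶜ : Set X) = lam := by
      have hinf : Infinite X := by
        rw [Cardinal.infinite_iff, hX]; exact hl0.le
      rw [Cardinal.mk_compl_of_infinite, hX]
      rw [hX]
      exact (Cardinal.lt_aleph0_of_finite _).trans hl0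
    apply le_antisymm
    · refine (Cardinal.mk_le_of_injective Subtype.val_injective).trans
        ((C.card_eq hi hg (C.kap_lt.le.trans hX.ge)).trans hX).le
    · rw [← hYc]
      refine Cardinal.mk_le_of_injective (f := fun k => toGen L g (Sum.inl k)) fun k l hkl => ?_
      exact Subtype.ext (C.inj hi (congrArg Subtype.val hkl))
  let f : s ⊕ D → gen L g := fun z => toGen L g (Sum.map (fun k : s => ⟨k, hsg k⟩) id z)
  have hf : tp (L := L) f = tp d := by
    rw [← hd]
    refine tp_reindex (tp_toGen (L := L) g) (Sum.map (fun k : s => ⟨k, hsg k⟩) id)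
      (fun z => rfl) ?_
    rintro (z | z) <;> rfl
  obtain ⟨c, hc⟩ := C.saturated hN₁ hcard hE (A := s ⊕ D) (by
    rw [Cardinal.mk_sum, Cardinal.lift_id, Cardinal.lift_id]
    exact Cardinal.add_lt_of_lt hl0.le (hsc.trans_lt hl0)
      ((Cardinal.lt_aleph0_of_finite _).trans hl0)) f d hf b
  have hc' : tp1 (L := L) (Sum.elim (fun k : s => i k) h) (c : N) = tp1 d b := by
    rw [← hc, ← tp1_embedding (gen L g).subtype]
    congr 1
    funext z; rcases z with z | z <;> rfl
  refine ⟨c, hc', fun hcY => hb (mem_gen_of_tp1_eq hc' ?_)⟩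
  obtain ⟨S, hS, hcS⟩ := exists_finset_mem_clo hcY
  have hS' : ∀ k, ∃ S' : Finset X, (S' : Set X) ⊆ s ∪ Y ∧ h k ∈ clo L i S' := fun k =>
    exists_finset_mem_clo (hY k)
  choose S' hS' hhS' using hS'
  let R : Set X := (S ∪ ⋃ k, (S' k : Set X)) ∪ Y
  have hRfin : R.Finite := (S.finite_toSet.union (Set.finite_iUnion fun k =>
    (S' k).finite_toSet)).union Y.finite_toSet
  obtain ⟨F, hF⟩ : ∃ F : Finset (((Y : Set X)ᶜ : Set X) ⊕ D), (c : N) ∈ clo L g F := by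
    have : (c : N) ∈ clo L g Set.univ := by rw [clo_univ]; exact c.2
    obtain ⟨F, -, hF⟩ := exists_finset_mem_clo this
    exact ⟨F, hF⟩
  obtain ⟨σ, h1, h2⟩ := exists_perm (R := R) (T := s) (hsi.sdiff hRfin)
    ((F.preimage Sum.inl Sum.inl_injective.injOn).image Subtype.val)
  obtain ⟨e, he⟩ := hi.exists_embedding hg σ.injective
  have hfix : ∀ x ∈ R, e (i x) = i x := fun x hx => by rw [he, h1 x hx]
  have hec : e c = c := embedding_fix_of_mem_clo hfix
    (clo_mono i (Set.subset_union_left.trans Set.subset_union_left) hcS)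
  have heh : ∀ k, e (h k) = h k := fun k => embedding_fix_of_mem_clo hfix
    (clo_mono i (((Set.subset_iUnion (fun k => (S' k : Set X)) k).trans
      Set.subset_union_right).trans Set.subset_union_left) (hhS' k))
  have hRs : ∀ x ∈ R, x ∉ (Y : Set X) → x ∈ s := by
    rintro x ((hx | hx) | hx) hxY
    · exact (hS hx).resolve_right hxY
    · obtain ⟨k, hk⟩ := Set.mem_iUnion.1 hx
      exact (hS' k hk).resolve_right hxY
    · exact absurd hx hxY
  have hall : ∀ z ∈ F, e (g z) ∈ gen L (Sum.elim (fun k : s => i k) h) := by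
    rintro (z | k) hz
    · have hσ : σ z ∈ s := by
        by_cases hzR : (z : X) ∈ R
        · rw [h1 _ hzR]; exact hRs _ hzR z.2
        · exact (h2 _ (Finset.mem_image_of_mem _ (Finset.mem_preimage.2 hz)) hzR).1
      have h3 : e (g (Sum.inl z)) = i (σ z) := he _
      rw [h3]
      exact apply_mem_gen (Sum.elim (fun k : s => i k) h) (Sum.inl ⟨σ z, hσ⟩)
    · have h3 : e (g (Sum.inr k)) = h k := heh k
      rw [h3]
      exact apply_mem_gen (Sum.elim (fun k : s => i k) h) (Sum.inr k)
  have hmem := (clo_embedding e g F).2 hF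
  rw [hec] at hmem
  exact clo_le.2 hall hmem

theorem exists_realization_notMem_clo (C : Ctx K lam p) {X : Type u} (hX : #X = lam)
    {N : StrucOf L} (hN : N ∈ K) {i : X → N} (hi : Ind p i) (hg : gen L i = ⊤) {s : Set X}
    (hsi : s.Infinite) (hsc : #s ≤ ℵ₀) {D : Type u} [Finite D] {h : D → N} {Y : Finset X}
    (hY : ∀ k, h k ∈ clo L i (s ∪ Y)) {E : StrucOf L} (hE : E ∈ K) {d : s ⊕ D → E}
    (hd : tp (L := L) (Sum.elim (fun k : s => i k) h) = tp d) {b : E} (hb : b ∉ gen L d) :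
    ∃ b₁, tp1 (L := L) (Sum.elim (fun k : s => i k) h) b₁ = tp1 d b ∧
      b₁ ∉ clo L i (s ∪ Y) := by
  classical
  have hYs : s ∪ ((Y.filter fun y => y ∉ s : Finset X) : Set X) = s ∪ Y := by
    ext y
    by_cases hy : y ∈ s <;> simp [hy]
  rw [← hYs] at hY ⊢
  refine C.exists_realization_notMem_clo_of_disjoint hX hN hi hg hsi hsc ?_ hY hE hd hb
  rw [Set.disjoint_left]
  intro y hy hy'
  rw [Finset.mem_coe, Finset.mem_filter] at hy'
  exact hy'.2 hy

theorem exists_uniqType (C : Ctx K lam p) :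
    ∃ (S : Type u) (Q : Set (Atm L (S ⊕ PUnit.{u + 1}))), UniqType K lam p S Q := by
  classical
  have hl0 : ℵ₀ < lam := aleph0_le_kap.trans_lt C.kap_lt
  obtain ⟨N, hN, i, hi, hg⟩ := C.free lam.out
  have hX : #lam.out = lam := Cardinal.mk_out _
  have hXi : Infinite lam.out := by
    rw [Cardinal.infinite_iff, hX]; exact hl0.le
  have hNl : #N = lam := (C.card_eq hi hg (C.kap_lt.le.trans hX.ge)).trans hX
  obtain ⟨s, a, hsa⟩ := C.exists_minType hXi hN hi
  have hsc : #s ≤ ℵ₀ := Cardinal.le_aleph0_iff_set_countable.2 hsa.count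
  have his : Ind p fun k : s => i k := hi.comp Subtype.val_injective
  refine ⟨s, tp1 (fun k : s => i k) a, hsa.inf.to_subtype, hsc, ?_, ?_⟩
  · intro M hM hMl h hh B g hB
    have hsB : #(s ⊕ B) < lam := by
      rw [Cardinal.mk_sum, Cardinal.lift_id, Cardinal.lift_id]
      exact Cardinal.add_lt_of_lt hl0.le (hsc.trans_lt hl0) hB
    obtain ⟨y, hy⟩ := C.saturated_tuple hN hNl hM hsB (fun k : s => i k) (Sum.elim h g)
      (his.tp_eq hh)
    obtain ⟨Z, hZ, hyZ⟩ := exists_set_mem_clo hg y (le_max_right #B ℵ₀) (le_max_left _ _)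
    have hZs : #(Z ∪ s : Set lam.out) < lam :=
      (Cardinal.mk_union_le _ _).trans_lt (Cardinal.add_lt_of_lt hl0.le
        (hZ.trans_lt (max_lt hB hl0)) (hsc.trans_lt hl0))
    have hinf : ((Z ∪ s)ᶜ : Set lam.out).Infinite := by
      intro hfin
      have := Cardinal.mk_sum_compl (Z ∪ s)
      rw [hX] at this
      exact this.not_lt (Cardinal.add_lt_of_lt hl0.le hZs (hfin.lt_aleph0.trans hl0))
    obtain ⟨F, hF⟩ := exists_finset_of_gen_eq_top hg a
    obtain ⟨σ, h1, h2⟩ := exists_perm (R := s) (T := (Z ∪ s)ᶜ) (hinf.mono fun x hx =>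
      ⟨hx, fun h => hx (Or.inr h)⟩) F
    obtain ⟨e, he⟩ := hi.exists_embedding hg σ.injective
    have hfix : ∀ x ∈ s, e (i x) = i x := fun x hx => by rw [he, h1 x hx]
    have heq : tp1 (L := L) (fun k : s => i k) (e a) = tp1 (fun k : s => i k) a := by
      rw [← tp1_embedding e (fun k : s => i k) a]
      congr 1
      funext k
      exact (hfix k k.2).symm
    have hea : e a ∉ clo L i (Z ∪ s) := by
      intro hmem
      have h3 : e a ∈ clo L i (σ '' (F ∪ s)) := by
        have := (clo_embedding e i (F ∪ s)).2 (clo_mono i Set.subset_union_left hF)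
        rw [show e ∘ i = i ∘ σ from funext he, clo_comp] at this
        exact this
      have h4 : σ '' (F ∪ s) ∩ (Z ∪ s) = s := by
        ext x
        constructor
        · rintro ⟨⟨x, hx, rfl⟩, hx'⟩
          by_cases hxs : x ∈ s
          · rwa [h1 x hxs]
          · exact absurd hx' (h2 x (hx.resolve_right hxs) hxs).1
        · exact fun hx => ⟨⟨x, Or.inr hx, h1 x hx⟩, Or.inr hx⟩
      have h5 := hi.mem_clo_inter (by rw [h4]; exact hsa.inf) h3 hmem
      rw [h4] at h5
      rw [← clo_congr (f := e ∘ i) hfix, clo_embedding] at h5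
      exact hsa.notMem h5
    obtain ⟨b, hb⟩ := C.saturated hM hMl hN hsB (Sum.elim h g) _ hy.symm (e a)
    refine ⟨b, ?_, fun hmem => hea (gen_le.2 ?_ (mem_gen_of_tp1_eq hb hmem))⟩
    · exact (tp1_comp hb Sum.inl).trans heq
    · rintro (k | k)
      · exact apply_mem_clo i (Or.inr k.2)
      · exact clo_mono i Set.subset_union_left (hyZ k)
  · intro E hE E' hE' D d d' hdd hdi b b' hb hb' hbQ hbQ'
    have fin : ∀ {D : Type u} [Finite D] (d : s ⊕ D → E) (d' : s ⊕ D → E'),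
        tp (L := L) d = tp d' → Ind p (d ∘ Sum.inl) → b ∉ gen L d → b' ∉ gen L d' →
        tp1 (L := L) (d ∘ Sum.inl) b = tp1 (fun k : s => i k) a →
        tp1 (L := L) (d' ∘ Sum.inl) b' = tp1 (fun k : s => i k) a →
        tp1 (L := L) d b = tp1 d' b' := by
      intro D _ d d' hdd hdi hb hb' hbQ hbQ'
      have hsD : #(s ⊕ D) < lam := by
        rw [Cardinal.mk_sum, Cardinal.lift_id, Cardinal.lift_id]
        exact Cardinal.add_lt_of_lt hl0.le (hsc.trans_lt hl0)
          ((Cardinal.lt_aleph0_of_finite _).trans hl0)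
      obtain ⟨h, hh⟩ := C.saturated_tuple hN hNl hE hsD (fun k : s => i k) d (his.tp_eq hdi)
      choose G hG using fun k => exists_finset_of_gen_eq_top hg (h k)
      have hfin : (⋃ k, (G k : Set lam.out)).Finite :=
        Set.finite_iUnion fun k => (G k).finite_toSet
      have hY : ∀ k, h k ∈ clo L i (s ∪ hfin.toFinset) := fun k =>
        clo_mono i ((Set.subset_iUnion (fun k => (G k : Set lam.out)) k).trans
          (by rw [hfin.coe_toFinset]; exact Set.subset_union_right)) (hG k)
      obtain ⟨c, hc, hcY⟩ := C.exists_realization_notMem_clo hX hN hi hg hsa.inf hsc hY hE hh hb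
      obtain ⟨c', hc', hcY'⟩ := C.exists_realization_notMem_clo hX hN hi hg hsa.inf hsc hY hE'
        (hh.trans hdd) hb'
      have key := hsa.min (s ∪ hfin.toFinset) Set.subset_union_left
        (hfin.toFinset.finite_toSet.subset fun x hx => hx.1.resolve_left hx.2) c hcY c' hcY'
        ((tp1_comp hc Sum.inl).trans hbQ) ((tp1_comp hc' Sum.inl).trans hbQ')
      rw [← hc, ← hc']
      refine tp_of_terms key ?_
      rintro ((k | k) | z)
      · exact ⟨Term.var (Sum.inl ⟨k, Or.inl k.2⟩), rfl, rfl⟩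
      · obtain ⟨t, ht⟩ := exists_term_of_mem_clo (hY k)
        refine ⟨t.relabel Sum.inl, ?_, ?_⟩ <;> rw [Term.realize_relabel] <;> exact ht
      · exact ⟨Term.var (Sum.inr z), rfl, rfl⟩
    refine tp1_of_finite fun t => ?_
    let D₀ : Finset D := t.preimage Sum.inr Sum.inr_injective.injOn
    let k : s ⊕ D₀ → s ⊕ D := Sum.map id Subtype.val
    have := fin (d ∘ k) (d' ∘ k) (tp_comp hdd k) hdi (fun h => hb (gen_comp_le d k h))
      (fun h => hb' (gen_comp_le d' k h)) hbQ hbQ'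
    refine tp_reindex this (fun z : t ⊕ PUnit.{u + 1} => match z with
      | Sum.inl ⟨Sum.inl x, _⟩ => Sum.inl (Sum.inl x)
      | Sum.inl ⟨Sum.inr x, hx⟩ => Sum.inl (Sum.inr ⟨x, Finset.mem_preimage.2 hx⟩)
      | Sum.inr x => Sum.inr x) ?_ ?_
    · rintro (⟨z | z, hz⟩ | z) <;> rfl
    · rintro (⟨z | z, hz⟩ | z) <;> rfl

end Ctx

end UniqueExtensions

section NoVaughtianPairs

open FirstOrder.Language

universe v w x

variable {L : FirstOrder.Language.{u, u}} {K : Set (StrucOf L)} {p : ∀ n, Set (Atm L (Fin n))}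

theorem exists_finset_mem_gen {ι : Type v} {M : Type w} [L.Structure M] {f : ι → M} {x : M}
    (h : x ∈ gen L f) : ∃ s : Finset ι, x ∈ clo L f s := by
  rw [← clo_univ] at h
  obtain ⟨s, -, hs⟩ := exists_finset_mem_clo h
  exact ⟨s, hs⟩

theorem embedding_mem_clo_iff {X : Type v} {M : Type w} [L.Structure M] {i : X → M}
    {e : M ↪[L] M} {σ : Equiv.Perm X} (he : ∀ x, e (i x) = i (σ x)) {A : Set X} {a : M} :
    e a ∈ clo L i A ↔ a ∈ clo L i (σ ⁻¹' A) := by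
  have := clo_embedding e i (σ ⁻¹' A) (a := a)
  rwa [show e ∘ i = i ∘ σ from funext he, clo_comp, Set.image_preimage_eq _ σ.surjective] at this

/-- A term whose value over an indiscernible set is a new element, evaluated at many disjoint
tuples: an element of the closure of its values lies in the closure of the base as soon as
this holds for a single value. -/
theorem mem_clo_of_mem_clo_values {Y Λ : Type u} {V : StrucOf L}
    {i : Y ⊕ Λ × ℕ → V} (hi : Ind p i) (hig : gen L i = ⊤) {Y₁ : Set Y} (hY₁ : Y₁.Infinite)
    (hY₁' : (Y₁ᶜ).Infinite) {kk : Finset ℕ} {Y₀ : Finset Y} (hY₀ : ↑Y₀ ⊆ Y₁) {c : Λ → V}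
    (hcW : ∀ α, c α ∈ clo L i (Sum.inl '' (Y₀ : Set Y) ∪ (fun n => Sum.inr (α, n)) '' (kk : Set ℕ)))
    (hσc : ∀ (σ : Equiv.Perm (Y ⊕ Λ × ℕ)) (e : V ↪[L] V), (∀ x, e (i x) = i (σ x)) →
      ∀ α, (∀ y ∈ Y₀, σ (Sum.inl y) = Sum.inl y) → (∀ n ∈ kk, σ (Sum.inr (α, n)) = Sum.inr (α, n)) →
      e (c α) = c α)
    {S : Type u} {h : S → V} (hh : ∀ k, h k ∈ clo L i (Sum.inl '' Y₁))
    {Q : Set (Atm L (S ⊕ PUnit.{u + 1}))}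
    (hQ : ∀ α b, b ∈ gen L (Sum.elim (i ∘ Sum.inl) fun _ : PUnit.{u + 1} => c α) →
      tp1 (L := L) h b = Q → b ∈ clo L i (Set.range Sum.inl))
    (F : Finset Λ) (b : V)
    (hb : b ∈ clo L (Sum.elim (fun y : Y₁ => i (Sum.inl y)) c) (Set.range Sum.inl ∪ Sum.inr '' F))
    (hbQ : tp1 (L := L) h b = Q) : b ∈ clo L i (Sum.inl '' Y₁) := by
  classical
  let g : Y₁ ⊕ Λ → V := Sum.elim (fun y : Y₁ => i (Sum.inl y)) c
  let W : Λ → Set (Y ⊕ Λ × ℕ) := fun α => (fun n => Sum.inr (α, n)) '' (kk : Set ℕ)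
  have hWfin : ∀ α, (W α).Finite := fun α => kk.finite_toSet.image _
  have hcW' : ∀ α, c α ∈ clo L i (Sum.inl '' Y₁ ∪ W α) := fun α =>
    clo_mono i (Set.union_subset_union_left _ (Set.image_mono hY₀)) (hcW α)
  induction F using Finset.induction generalizing b with
  | empty =>
    refine clo_le.2 ?_ hb
    rintro _ (⟨y, rfl⟩ | ⟨y, hy, rfl⟩)
    · exact apply_mem_clo i (Set.mem_image_of_mem _ y.2)
    · simp at hy
  | insert γ F hγ ih =>
    let WF : Set (Y ⊕ Λ × ℕ) := ⋃ α ∈ F, W α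
    have hWF : WF.Finite := F.finite_toSet.biUnion fun α _ => hWfin α
    have hdis : ∀ x ∈ WF, x ∉ W γ := by
      intro x hx hx'
      obtain ⟨α, hα, n, hn, rfl⟩ := Set.mem_iUnion₂.1 hx
      obtain ⟨m, hm, hmn⟩ := hx'
      have := congrArg Prod.fst (Sum.inr_injective hmn)
      exact hγ ((show γ = α from this) ▸ hα)
    have hWl : ∀ α, ∀ x ∈ W α, ∀ y, x ≠ Sum.inl y := by
      rintro α _ ⟨n, hn, rfl⟩ y ⟨⟩
    have hWFl : ∀ x ∈ WF, ∀ y, x ≠ Sum.inl y := by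
      intro x hx
      obtain ⟨α, hα, hx⟩ := Set.mem_iUnion₂.1 hx
      exact hWl α x hx
    have hWFr : ∀ α ∈ F, W α ⊆ WF := fun α hα => Set.subset_biUnion_of_mem (u := W) hα
    have hbC : b ∈ clo L i (Sum.inl '' Y₁ ∪ WF ∪ W γ) := by
      refine clo_le.2 ?_ hb
      rintro _ (⟨y, rfl⟩ | ⟨α, hα, rfl⟩)
      · exact apply_mem_clo i (Or.inl (Or.inl (Set.mem_image_of_mem _ y.2)))
      · rcases Finset.mem_insert.1 hα with rfl | hα
        · exact clo_mono i (Set.union_subset_union_left _ Set.subset_union_left) (hcW' _)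
        · exact clo_mono i ((Set.union_subset_union_right _ (hWFr α hα)).trans
            Set.subset_union_left) (hcW' α)
    have step : b ∈ clo L i (Sum.inl '' Y₁ ∪ WF) := by
      let R : Set (Y ⊕ Λ × ℕ) := Sum.inl '' Y₁ ∪ W γ
      obtain ⟨σ, h1, h2⟩ := exists_perm (R := R) (T := Set.range Sum.inl) (by
        refine (hY₁'.image Sum.inl_injective.injOn).mono ?_
        rintro _ ⟨y, hy, rfl⟩
        refine ⟨⟨y, rfl⟩, ?_⟩
        rintro (⟨z, hz, hzy⟩ | hz)
        · exact hy (Sum.inl_injective hzy ▸ hz)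
        · exact hWl γ _ hz y rfl) hWF.toFinset
      obtain ⟨e, he⟩ := hi.exists_embedding hig σ.injective
      have hfixY : ∀ y ∈ Y₁, σ (Sum.inl y) = Sum.inl y := fun y hy =>
        h1 _ (Or.inl (Set.mem_image_of_mem _ hy))
      have hfix : ∀ x ∈ Sum.inl '' Y₁, e (i x) = i x := fun x hx => by
        rw [he, h1 x (Or.inl hx)]
      have hWFR : ∀ x ∈ WF, x ∉ R := by
        rintro x hx (⟨y, hy, rfl⟩ | hx')
        · exact hWFl _ hx y rfl
        · exact hdis x hx hx'
      have heb : e b ∈ gen L (Sum.elim (i ∘ Sum.inl) fun _ : PUnit.{u + 1} => c γ) := by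
        have h3 := (clo_embedding e g _).2 hb
        refine clo_le.2 ?_ h3
        rintro _ (⟨y, rfl⟩ | ⟨α, hα, rfl⟩)
        · have : e (g (Sum.inl y)) = i (Sum.inl y) := hfix _ (Set.mem_image_of_mem _ y.2)
          rw [Function.comp, this]
          exact apply_mem_gen (Sum.elim (i ∘ Sum.inl) fun _ : PUnit.{u + 1} => c γ) (Sum.inl y.1)
        · rcases Finset.mem_insert.1 hα with rfl | hα
          · have : e (c α) = c α := hσc σ e he α (fun y hy => hfixY y (hY₀ hy))
              fun n hn => h1 _ (Or.inr (Set.mem_image_of_mem _ hn))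
            rw [Function.comp, show g (Sum.inr α) = c α from rfl, this]
            exact apply_mem_gen (Sum.elim (i ∘ Sum.inl) fun _ : PUnit.{u + 1} => c α)
              (Sum.inr PUnit.unit)
          · have h4 : e (c α) ∈ clo L i (Set.range Sum.inl) := by
              rw [embedding_mem_clo_iff he]
              refine clo_mono i ?_ (hcW' α)
              rintro x (⟨y, hy, rfl⟩ | hx)
              · exact ⟨y, (hfixY y hy).symm⟩
              · exact (h2 x (hWF.mem_toFinset.2 (hWFr α hα hx)) (hWFR x (hWFr α hα hx))).1
            refine clo_le.2 ?_ h4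
            rintro _ ⟨y, rfl⟩
            exact apply_mem_gen (Sum.elim (i ∘ Sum.inl) fun _ : PUnit.{u + 1} => c γ) (Sum.inl y)
      have hebQ : tp1 (L := L) h (e b) = Q := by
        rw [← hbQ, ← tp1_embedding e h b]
        congr 1
        funext k
        exact (embedding_fix_of_mem_clo hfix (hh k)).symm
      have h5 := hQ γ (e b) heb hebQ
      rw [embedding_mem_clo_iff he] at h5
      have h6 := hi.mem_clo_inter (A := σ ⁻¹' Set.range Sum.inl)
        (B := Sum.inl '' Y₁ ∪ WF ∪ W γ) (by
          refine (hY₁.image Sum.inl_injective.injOn).mono ?_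
          rintro _ ⟨y, hy, rfl⟩
          exact ⟨⟨y, (hfixY y hy).symm⟩, Or.inl (Or.inl (Set.mem_image_of_mem _ hy))⟩) h5 hbC
      refine clo_mono i ?_ h6
      rintro x ⟨⟨y, hy⟩, hx | hx⟩
      · exact hx
      · rw [h1 x (Or.inr hx)] at hy
        exact absurd hy.symm (hWl γ x hx y)
    refine ih b ?_ hbQ
    obtain ⟨P, hP, hbP⟩ := exists_finset_mem_clo step
    obtain ⟨P', hP', hbP'⟩ := exists_finset_mem_clo hb
    let R : Set (Y ⊕ Λ × ℕ) := ↑P ∪ WF ∪ Sum.inl '' (Y₀ : Set Y) ∪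
      (fun z : Y₁ => Sum.inl z.1) '' (Sum.inl ⁻¹' (P' : Set (Y₁ ⊕ Λ)))
    have hR : R.Finite := ((P.finite_toSet.union hWF).union (Y₀.finite_toSet.image _)).union
      ((P'.finite_toSet.preimage Sum.inl_injective.injOn).image _)
    obtain ⟨σ, h1, h2⟩ := exists_perm (R := R) (T := Sum.inl '' Y₁)
      ((hY₁.image Sum.inl_injective.injOn).sdiff hR) (hWfin γ).toFinset
    obtain ⟨e, he⟩ := hi.exists_embedding hig σ.injective
    have hWR : ∀ x ∈ W γ, x ∉ R := by
      rintro x hx (((hx' | hx') | ⟨y, hy, rfl⟩) | ⟨y, hy, rfl⟩)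
      · rcases hP hx' with ⟨y, hy, rfl⟩ | hx'
        · exact hWl γ _ hx y rfl
        · exact hdis x hx' hx
      · exact hdis x hx' hx
      · exact hWl γ _ hx y rfl
      · exact hWl γ _ hx y rfl
    have heb : e b = b := embedding_fix_of_mem_clo
      (fun x hx => by rw [he, h1 x (Or.inl (Or.inl (Or.inl hx)))]) hbP
    have h3 := (clo_embedding e g _).2 hbP'
    rw [heb] at h3
    refine clo_le.2 ?_ h3
    intro z hz
    have hzP := hP' hz
    rcases z with y | α
    · have : e (g (Sum.inl y)) = g (Sum.inl y) := (he _).trans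
        (congrArg i (h1 _ (Or.inr ⟨y, hz, rfl⟩)))
      rw [Function.comp, this]
      exact apply_mem_clo g (Or.inl ⟨y, rfl⟩)
    · have hα : α ∈ insert γ F := by
        rcases hzP with ⟨y, hy⟩ | ⟨β, hβ, hβα⟩
        · cases hy
        · exact Sum.inr_injective hβα ▸ hβ
      rcases Finset.mem_insert.1 hα with rfl | hα
      · have h4 : e (c α) ∈ clo L i (Sum.inl '' Y₁) := by
          rw [embedding_mem_clo_iff he]
          refine clo_mono i ?_ (hcW α)
          rintro x (⟨y, hy, rfl⟩ | hx)
          · exact ⟨y, hY₀ hy, (h1 _ (Or.inl (Or.inr (Set.mem_image_of_mem _ hy)))).symm⟩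
          · exact (h2 x ((hWfin α).mem_toFinset.2 hx) (hWR x hx)).1
        refine clo_le.2 ?_ h4
        rintro _ ⟨y, hy, rfl⟩
        exact apply_mem_clo g (k := Sum.inl ⟨y, hy⟩) (Or.inl ⟨_, rfl⟩)
      · have : e (g (Sum.inr α)) = g (Sum.inr α) := hσc σ e he α
          (fun y hy => h1 _ (Or.inl (Or.inr (Set.mem_image_of_mem _ hy))))
          fun n hn => h1 _ (Or.inl (Or.inl (Or.inr (hWFr α hα (Set.mem_image_of_mem _ hn)))))
        rw [Function.comp, this]
        exact apply_mem_clo g (Or.inr ⟨α, hα, rfl⟩)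

namespace Ctx

variable {lam : Cardinal.{u}}

theorem exists_new_realization (C : Ctx K lam p) {S : Type u}
    {Q : Set (Atm L (S ⊕ PUnit.{u + 1}))} (hQ : UniqType K lam p S Q) {N : StrucOf L} (hN : N ∈ K)
    {h : S → N} (hh : Ind p h) {B : L.Substructure N} (hhB : ∀ k, h k ∈ B)
    (hB : #B = lam) {c : N} (hc : c ∉ B) :
    ∃ b ∈ gen L (Sum.elim (Subtype.val : B → N) fun _ : PUnit.{u + 1} => c),
      tp1 (L := L) h b = Q ∧ b ∉ B := by
  classical
  by_contra hcon
  push Not at hcon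
  have hl0 : ℵ₀ < lam := aleph0_le_kap.trans_lt C.kap_lt
  let Y : Type u := lam.out
  have hY : #Y = lam := Cardinal.mk_out _
  have hYi : Infinite Y := by
    rw [Cardinal.infinite_iff, hY]; exact hl0.le
  obtain ⟨j, hj, hjg⟩ := C.cat ⟨B⟩ (sub_mem C.univ hN B) hB Y hY
  let j' : Y → N := fun y => (j y : B)
  have hj' : Ind p j' := hj.embedding B.subtype
  have hgB : ∀ x, x ∈ gen L j' ↔ x ∈ B := by
    intro x
    constructor
    · intro hx
      exact gen_le.2 (fun y => (j y).2) hx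
    · intro hx
      have : (⟨x, hx⟩ : B) ∈ gen L j := by rw [hjg]; trivial
      exact (gen_embedding B.subtype j _).2 this
  obtain ⟨t, ht⟩ := C.exists_term hY hN hj' c
  obtain ⟨V, hV, i₀, hi₀, hig₀⟩ := C.free (Y ⊕ Y × ULift.{u} ℕ)
  let ε : Y ⊕ Y × ℕ ≃ Y ⊕ Y × ULift.{u} ℕ :=
    Equiv.sumCongr (Equiv.refl _) (Equiv.prodCongr (Equiv.refl _) Equiv.ulift.symm)
  let i : Y ⊕ Y × ℕ → V := i₀ ∘ ε
  have hi : Ind p i := hi₀.comp ε.injective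
  have hig : gen L i = ⊤ := by
    rw [← clo_univ, clo_comp, Set.image_univ, ε.surjective.range_eq, clo_univ, hig₀]
  let ia : Y → Y ⊕ ℕ → V := fun α => i ∘ Sum.map id fun n => (α, n)
  have hia : ∀ α, Ind p (ia α) := fun α => hi.comp
    (Function.injective_id.sumMap fun n m hnm => congrArg Prod.snd hnm)
  let cc : Y → V := fun α => t.realize (ia α)
  have hcc : ∀ α, tp1 (L := L) (i ∘ Sum.inl) (cc α) = tp1 j' c := fun α => ht V (ia α) (hia α)
  obtain ⟨q, hq⟩ := StrucOf.Term.exists_finset t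
  let Y₀ : Finset Y := q.preimage Sum.inl Sum.inl_injective.injOn
  let kk : Finset ℕ := q.preimage Sum.inr Sum.inr_injective.injOn
  have hccq : ∀ α, cc α ∈ clo L (ia α) (q : Set (Y ⊕ ℕ)) := by
    intro α
    obtain ⟨r, hr⟩ := hq q (subset_refl _)
    refine mem_gen.2 ⟨r, ?_⟩
    change _ = t.realize _
    rw [← hr, Term.realize_subst]
    rfl
  have hccW : ∀ α, cc α ∈ clo L i
      (Sum.inl '' (Y₀ : Set Y) ∪ (fun n => Sum.inr (α, n)) '' (kk : Set ℕ)) := by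
    intro α
    have := hccq α
    rw [clo_comp] at this
    refine clo_mono i ?_ this
    rintro _ ⟨y | n, hy, rfl⟩
    · exact Or.inl ⟨y, Finset.mem_coe.2 (Finset.mem_preimage.2 hy), rfl⟩
    · exact Or.inr ⟨n, Finset.mem_coe.2 (Finset.mem_preimage.2 hy), rfl⟩
  have hσc : ∀ (σ : Equiv.Perm (Y ⊕ Y × ℕ)) (e : V ↪[L] V), (∀ x, e (i x) = i (σ x)) →
      ∀ α, (∀ y ∈ Y₀, σ (Sum.inl y) = Sum.inl y) → (∀ n ∈ kk, σ (Sum.inr (α, n)) = Sum.inr (α, n)) →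
      e (cc α) = cc α := by
    intro σ e he α h1 h2
    refine embedding_fix_of_mem_clo ?_ (hccq α)
    rintro (y | n) hy
    · exact (he _).trans (congrArg i (h1 y (Finset.mem_preimage.2 hy)))
    · exact (he _).trans (congrArg i (h2 n (Finset.mem_preimage.2 hy)))
  obtain ⟨Y₂, hY₂, hhY₂⟩ := exists_set_mem_clo hjg (fun k => (⟨h k, hhB k⟩ : B)) le_rfl hQ.count
  let Y₁ : Set Y := Y₂ ∪ Y₀ ∪ Set.range (Infinite.natEmbedding Y)
  have hY₁ : Y₁.Infinite := (Set.infinite_range_of_injective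
    (Infinite.natEmbedding Y).injective).mono Set.subset_union_right
  have hY₁l : #Y₁ < lam := by
    refine lt_of_le_of_lt ?_ hl0
    refine (Cardinal.mk_union_le _ _).trans (add_le_of_le le_rfl
      ((Cardinal.mk_union_le _ _).trans (add_le_of_le le_rfl hY₂
        (Cardinal.lt_aleph0_of_finite _).le)) ?_)
    exact Cardinal.le_aleph0_iff_set_countable.2 (Set.countable_range _)
  have hY₁c : (Y₁ᶜ).Infinite := by
    intro hfin
    have := Cardinal.mk_sum_compl Y₁
    rw [hY] at this
    exact this.not_lt (Cardinal.add_lt_of_lt hl0.le hY₁l (hfin.lt_aleph0.trans hl0))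
  have hhY : ∀ k, h k ∈ clo L j' Y₁ := by
    intro k
    have := (clo_embedding B.subtype j Y₂).2 (hhY₂ k)
    exact clo_mono j' (Set.subset_union_left.trans Set.subset_union_left) this
  choose τ hτ using fun k => exists_term_of_mem_clo (hhY k)
  let hV' : S → V := fun k => (τ k).realize fun y : Y₁ => i (Sum.inl y)
  have hhV : ∀ k, hV' k ∈ clo L i (Sum.inl '' Y₁) := by
    intro k
    rw [← clo_comp]
    exact mem_gen.2 ⟨τ k, rfl⟩
  have hbase : tp (L := L) (i ∘ Sum.inl) = tp j' := (hi.comp Sum.inl_injective).tp_eq hj'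
  have hVtp : tp (L := L) hV' = tp h := by
    refine tp_of_terms hbase fun k => ⟨(τ k).relabel Subtype.val, ?_, ?_⟩
    · rw [Term.realize_relabel]; rfl
    · rw [Term.realize_relabel]; exact hτ k
  have hVi : Ind p hV' := hh.of_tp_eq hVtp
  have hrange : clo L i (Set.range Sum.inl) = gen L (i ∘ Sum.inl) := by
    rw [← Set.image_univ, ← clo_comp, clo_univ]
  have hccn : ∀ α, cc α ∉ gen L (i ∘ Sum.inl) := fun α hα =>
    hc ((hgB c).1 (mem_gen_of_tp1_eq (hcc α) hα))
  have hcci : Function.Injective cc := by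
    intro α β hαβ
    by_contra hne
    have h1 := hccW β
    rw [← hαβ] at h1
    have h2 := hi.mem_clo_inter (A := Set.range Sum.inl ∪
      (fun n => Sum.inr (α, n)) '' (kk : Set ℕ)) (B := Set.range Sum.inl ∪
      (fun n => Sum.inr (β, n)) '' (kk : Set ℕ)) ((Set.infinite_range_of_injective
        Sum.inl_injective).mono fun x hx => ⟨Or.inl hx, Or.inl hx⟩)
      (clo_mono i (Set.union_subset_union_left _ (Set.image_subset_range _ _)) (hccW α))
      (clo_mono i (Set.union_subset_union_left _ (Set.image_subset_range _ _)) h1)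
    refine hccn α ?_
    rw [← hrange]
    refine clo_mono i ?_ h2
    rintro x ⟨hx | ⟨n, hn, rfl⟩, hx' | ⟨m, hm, hmn⟩⟩
    · exact hx
    · exact hx
    · exact hx'
    · exact absurd (congrArg Prod.fst (Sum.inr_injective hmn)).symm hne
  have key : ∀ α b, b ∈ gen L (Sum.elim (i ∘ Sum.inl) fun _ : PUnit.{u + 1} => cc α) →
      tp1 (L := L) hV' b = Q → b ∈ clo L i (Set.range Sum.inl) := by
    intro α b hb hbQ
    obtain ⟨r, hr⟩ := mem_gen.1 hb
    let b' : N := r.realize (Sum.elim j' fun _ : PUnit.{u + 1} => c)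
    have h1 : tp1 (L := L) (Sum.elim (i ∘ Sum.inl) hV') b = tp1 (Sum.elim j' h) b' := by
      refine tp_of_terms (hcc α) ?_
      rintro ((y | k) | z)
      · exact ⟨Term.var (Sum.inl y), rfl, rfl⟩
      · refine ⟨(τ k).relabel fun y => Sum.inl y.1, ?_, ?_⟩
        · rw [Term.realize_relabel]; rfl
        · rw [Term.realize_relabel]; exact hτ k
      · exact ⟨r, hr, rfl⟩
    have hb' : b' ∈ gen L (Sum.elim (Subtype.val : B → N) fun _ : PUnit.{u + 1} => c) := by
      refine gen_le.2 ?_ (realize_mem_gen _ r)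
      rintro (y | z)
      · exact apply_mem_gen (Sum.elim (Subtype.val : B → N) fun _ : PUnit.{u + 1} => c)
          (Sum.inl (j y))
      · exact apply_mem_gen (Sum.elim (Subtype.val : B → N) fun _ : PUnit.{u + 1} => c)
          (Sum.inr PUnit.unit)
    have hb'Q : tp1 (L := L) h b' = Q := (tp1_comp h1 Sum.inr).symm.trans hbQ
    rw [hrange]
    exact mem_gen_of_tp1_eq (tp1_comp h1 Sum.inl).symm ((hgB _).2 (hcon b' hb' hb'Q))
  let g : Y₁ ⊕ Y → V := Sum.elim (fun y : Y₁ => i (Sum.inl y)) cc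
  have hN₂ : (⟨gen L g⟩ : StrucOf L) ∈ K := gen_mem C.univ hV g
  have hN₂l : #(gen L g) = lam := by
    apply le_antisymm
    · refine (card_gen_le g).trans (max_le ?_ C.kap_lt.le)
      rw [Cardinal.mk_sum, Cardinal.lift_id, Cardinal.lift_id, hY]
      exact add_le_of_le hl0.le hY₁l.le le_rfl
    · rw [← hY]
      exact Cardinal.mk_le_of_injective (f := fun α => toGen L g (Sum.inr α)) fun α β hαβ =>
        hcci (congrArg Subtype.val hαβ)
  have hhg : ∀ k, hV' k ∈ gen L g := by
    intro k
    refine gen_le.2 (fun y => ?_) (realize_mem_gen (fun y : Y₁ => i (Sum.inl y)) (τ k))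
    exact apply_mem_gen g (Sum.inl y)
  have hVi₂ : Ind p fun k => (⟨hV' k, hhg k⟩ : gen L g) :=
    hVi.of_tp_eq (tp_embedding (gen L g).subtype _).symm
  obtain ⟨b, hb, hbn⟩ := hQ.nonalg ⟨gen L g⟩ hN₂ hN₂l (fun k => ⟨hV' k, hhg k⟩) hVi₂
    (fun y : Y₁ => toGen L g (Sum.inl y)) hY₁l
  have hbQ : tp1 (L := L) hV' (b : V) = Q := by
    rw [← hb]
    exact tp1_embedding (gen L g).subtype (fun k => (⟨hV' k, hhg k⟩ : gen L g)) b
  obtain ⟨F, hF⟩ := exists_finset_mem_gen (x := (b : V)) (f := g) b.2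
  have hfinal := mem_clo_of_mem_clo_values hi hig hY₁ hY₁c
    (Set.subset_union_right.trans Set.subset_union_left : (Y₀ : Set Y) ⊆ Y₁) hccW hσc hhV key
    (F.preimage Sum.inr Sum.inr_injective.injOn) b (by
      refine clo_mono g ?_ hF
      rintro (y | α) hz
      · exact Or.inl ⟨y, rfl⟩
      · exact Or.inr ⟨α, Finset.mem_coe.2 (Finset.mem_preimage.2 hz), rfl⟩) hbQ
  refine hbn ?_
  rw [← clo_comp] at hfinal
  have h7 : (b : V) ∈ gen L ((gen L g).subtype ∘ fun y : Y₁ => toGen L g (Sum.inl y)) := hfinal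
  exact gen_comp_le (Sum.elim (fun k => (⟨hV' k, hhg k⟩ : gen L g)) fun y : Y₁ =>
    toGen L g (Sum.inl y)) Sum.inr ((gen_embedding (gen L g).subtype _ b).1 h7)

end Ctx

end NoVaughtianPairs

section Transfer

open FirstOrder.Language

universe v w x

theorem tp_of_expansion {L J : FirstOrder.Language.{u, u}} (φ : L →ᴸ J) {ι : Type v}
    {M : Type w} {N : Type x} [L.Structure M] [J.Structure M] [φ.IsExpansionOn M]
    [L.Structure N] [J.Structure N] [φ.IsExpansionOn N] {f : ι → M} {g : ι → N}
    (h : tp (L := J) f = tp g) : tp (L := L) f = tp g := by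
  ext ψ
  cases ψ with
  | eq t s =>
    have := eq_of_tp_eq h (φ.onTerm t) (φ.onTerm s)
    simpa only [mem_tp, Atm.Holds, LHom.realize_onTerm] using this
  | rel R ts =>
    have : (Atm.rel (φ.onRelation R) fun k => φ.onTerm (ts k)) ∈ tp (L := J) f ↔
      (Atm.rel (φ.onRelation R) fun k => φ.onTerm (ts k)) ∈ tp (L := J) g := by rw [h]
    simpa only [mem_tp, Atm.Holds, LHom.realize_onTerm, LHom.map_onRelation] using this

/-- The structures all of whose finite tuples have types realized in `N`. -/
def tupleClass (J : FirstOrder.Language.{u, u}) (N : Type u) [J.Structure N] : Set (StrucOf J) :=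
  {M | ∀ (n : ℕ) (m : Fin n → M), ∃ m' : Fin n → N, tp (L := J) m = tp m'}

theorem tupleClass_univ (J : FirstOrder.Language.{u, u}) (N : Type u) [J.Structure N] :
    IsUniversalClass J (tupleClass J N) := by
  refine ⟨?_, ?_, ?_⟩
  · rintro M hM M' ⟨e⟩ n m
    obtain ⟨m', h⟩ := hM n (e.symm ∘ m)
    exact ⟨m', (tp_embedding e.symm.toEmbedding m).symm.trans h⟩
  · intro M hM S n m
    obtain ⟨m', h⟩ := hM n (fun k => (m k : M.α))
    exact ⟨m', (tp_embedding S.subtype m).symm.trans h⟩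
  · intro ι _ _ _ G _ f _ h n m
    obtain ⟨i, y, rfl⟩ := DirectLimit.exists_quotient_mk'_sigma_mk'_eq G f m
    obtain ⟨m', h⟩ := h i n y
    exact ⟨m', (tp_embedding (DirectLimit.of J ι G f i) y).trans h⟩

theorem exists_tuple_model {J : FirstOrder.Language.{u, u}} {κ lam : Cardinal.{u}}
    (hJ : kap J ≤ κ) (hκ : κ ≤ lam) (N : Type u) [J.Structure N]
    (hN : min lam (Cardinal.beth ((Order.succ ((2 : Cardinal.{u}) ^ κ)).ord)) ≤ #N) :
    ∃ M ∈ tupleClass J N, #M = lam := by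
  have hl : max lam (kap J) = lam := max_eq_left (hJ.trans hκ)
  rcases min_le_iff.1 hN with h | h
  · obtain ⟨s, hs⟩ := Cardinal.le_mk_iff_exists_subset.1 (show lam ≤ #(Set.univ : Set N) by simpa)
    refine ⟨⟨gen J (Subtype.val : s → N)⟩, fun n m => ⟨fun k => (m k).1,
      (tp_embedding (gen J (Subtype.val : s → N)).subtype m).symm⟩, le_antisymm ?_ ?_⟩
    · refine (card_gen_le _).trans ?_
      rw [hs.2, hl]
    · rw [← hs.2]
      exact Cardinal.mk_le_of_injective (f := toGen J (Subtype.val : s → N)) fun a b hab =>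
        Subtype.ext (by simpa [toGen] using hab)
  · have hb : Cardinal.beth ((Order.succ ((2 : Cardinal.{u}) ^ kap J)).ord) ≤ #N := by
      refine le_trans (Cardinal.beth_mono (Cardinal.ord_le_ord.2 (Order.succ_le_succ ?_))) h
      exact Cardinal.power_le_power_left two_ne_zero hJ
    obtain ⟨p, hp, hf⟩ := exists_template N hb
    have hNK : (⟨N⟩ : StrucOf J) ∈ tupleClass J N := fun n m => ⟨m, rfl⟩
    obtain ⟨lo, -, -⟩ := exists_initial_wellOrder lam.out
    obtain ⟨V, hV, i, hi, hg⟩ := exists_indisc (tupleClass_univ J N) hp (fun n => by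
      obtain ⟨f, -, hf⟩ := hf n
      exact ⟨⟨N⟩, hNK, f, hf⟩) lam.out
    refine ⟨V, hV, le_antisymm ?_ ?_⟩
    · refine (card_le_of_gen hg).trans ?_
      rw [Cardinal.mk_out, hl]
    · obtain ⟨f, hf⟩ := hf 2
      rw [← Cardinal.mk_out lam]
      exact Cardinal.mk_le_of_injective (hi.injective ⟨N, inferInstance, f, hf⟩)

/-- Function symbols: constants indexed by `A` and countably many unary operations. -/
inductive OpSymb (A : Type u) : ℕ → Type u
  | con (a : A) : OpSymb A 0
  | op (k : ℕ) : OpSymb A 1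

/-- The language with constants indexed by `A` and countably many unary operations. -/
def opLang (A : Type u) : FirstOrder.Language.{u, u} where
  Functions := OpSymb A
  Relations := fun _ => PEmpty

theorem card_opLang_le (A : Type u) : (opLang A).card ≤ #A + ℵ₀ := by
  have h : Function.Injective (fun z : (opLang A).Symbols => match z with
      | Sum.inl ⟨_, .con a⟩ => (Sum.inl a : A ⊕ ULift.{u} ℕ)
      | Sum.inl ⟨_, .op k⟩ => Sum.inr ⟨k⟩
      | Sum.inr ⟨_, r⟩ => PEmpty.elim r) := by
    rintro (⟨_, a | k⟩ | ⟨_, r⟩) (⟨_, b | l⟩ | ⟨_, s⟩) hab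
    · cases hab; rfl
    · cases hab
    · exact PEmpty.elim s
    · cases hab
    · cases hab; rfl
    · exact PEmpty.elim s
    · exact PEmpty.elim r
    · exact PEmpty.elim r
    · exact PEmpty.elim r
  have := Cardinal.mk_le_of_injective h
  change #(opLang A).Symbols ≤ _
  simpa only [Cardinal.mk_sum, Cardinal.mk_uLift, Cardinal.mk_nat, Cardinal.lift_id,
    Cardinal.lift_aleph0] using this

/-- The structure on `N` given by interpreting constants and unary operations. -/
@[reducible] def opStructure {A : Type u} {N : Type u} (f : A → N) (g : ℕ → N → N) :
    (opLang A).Structure N where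
  funMap := fun {_} F => match F with
    | .con a => fun _ => f a
    | .op k => fun x => g k (x 0)
  RelMap := fun R => PEmpty.elim R

theorem exists_model_with_operations {L : FirstOrder.Language.{u, u}} {K : Set (StrucOf L)}
    {lam : Cardinal.{u}} (hK : IsUniversalClass L K) (hl : kap L ≤ lam) {N : StrucOf L}
    (hN : N ∈ K)
    (hNc : min lam (Cardinal.beth ((Order.succ ((2 : Cardinal.{u}) ^ kap L)).ord)) ≤ #N)
    {A : Type u} (hA : #A ≤ kap L) (f : A → N) (g : ℕ → N → N) :
    ∃ M ∈ K, #M = lam ∧ ∃ (f' : A → M) (g' : ℕ → M → M), ∀ {W : Type u} [Finite W] (m : W → M),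
      ∃ m' : W → N, tp (L := L) (Sum.elim f' (Sum.elim m fun z : ℕ × W => g' z.1 (m z.2))) =
        tp (Sum.elim f (Sum.elim m' fun z : ℕ × W => g z.1 (m' z.2))) := by
  let : (opLang A).Structure N := opStructure f g
  let J := L.sum (opLang A)
  have hJ : kap J ≤ kap L := by
    have h1 := card_opLang_le A
    have h2 : J.card = L.card + (opLang A).card := by
      simp [J, Language.card_sum]
    have h3 : L.card ≤ kap L := self_le_add_right _ _
    have h4 : (ℵ₀ : Cardinal.{u}) ≤ kap L := aleph0_le_kap
    change J.card + ℵ₀ ≤ _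
    rw [h2]
    exact Cardinal.add_le_of_le h4 (Cardinal.add_le_of_le h4 h3
      (h1.trans (Cardinal.add_le_of_le h4 hA h4))) h4
  obtain ⟨M, hM, hMc⟩ := exists_tuple_model (J := J) hJ hl N hNc
  let sL : L.Structure M.α := (LHom.sumInl : L →ᴸ J).reduct M.α
  have key : ∀ {n : ℕ} (m : Fin n → M.α), ∃ m' : Fin n → N, tp (L := J) m = tp m' ∧
      tp (L := L) m = tp m' := by
    intro n m
    obtain ⟨m', h⟩ := hM n m
    exact ⟨m', h, tp_of_expansion (LHom.sumInl : L →ᴸ J) h⟩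
  let M' : StrucOf L := ⟨M.α⟩
  refine ⟨M', ?_, hMc, fun a => Structure.funMap (L := J) (Sum.inr (OpSymb.con a)) Fin.elim0,
    fun k x => Structure.funMap (L := J) (Sum.inr (OpSymb.op k)) fun _ => x, ?_⟩
  · refine mem_of_tuples hK fun s => ?_
    obtain ⟨m', -, h⟩ := key (fun k => ((Finite.equivFin s).symm k).1)
    refine ⟨N, hN, m' ∘ Finite.equivFin s, tp_reindex h (Finite.equivFin s) ?_ ?_⟩
    · intro z
      simp
    · intro z
      rfl
  · intro W _ m
    obtain ⟨m', h, -⟩ := key (fun k => m ((Finite.equivFin W).symm k))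
    refine ⟨m' ∘ Finite.equivFin W, ?_⟩
    refine tp_of_expansion (LHom.sumInl : L →ᴸ J) (tp_of_terms h ?_)
    rintro (a | k | ⟨k, z⟩)
    · refine ⟨Term.func (L := J) (Sum.inr (OpSymb.con a)) Fin.elim0, ?_, ?_⟩
      · exact congrArg (Structure.funMap (L := J) (M := M.α) (Sum.inr (OpSymb.con a)))
          (funext fun k => k.elim0)
      · rfl
    · exact ⟨Term.var (Finite.equivFin W k), by simp, by simp⟩
    · refine ⟨Term.func (L := J) (Sum.inr (OpSymb.op k))
        fun _ => Term.var (Finite.equivFin W z), ?_, ?_⟩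
      · refine congrArg (Structure.funMap (L := J) (M := M.α) (Sum.inr (OpSymb.op k)))
          (funext fun _ => ?_)
        simp
      · rfl

end Transfer

section Isomorphism

open FirstOrder.Language

universe v w x

variable {L : FirstOrder.Language.{u, u}} {K : Set (StrucOf L)} {p : ∀ n, Set (Atm L (Fin n))}

theorem isEmpty_principalSeg {α β : Type u} [LinearOrder α] [LinearOrder β]
    (hβ : ∀ b : β, #(Set.Iio b) < #β) (h : #α = #β) :
    IsEmpty (PrincipalSeg (· < · : α → α → Prop) (· < · : β → β → Prop)) := by
  refine ⟨fun f => (hβ f.top).not_ge ?_⟩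
  rw [← h]
  exact Cardinal.mk_le_of_injective (f := fun a => (⟨f a, f.lt_top a⟩ : Set.Iio f.top))
    fun a b hab => f.injective (congrArg Subtype.val hab)

theorem exists_orderIso {α β : Type u} [LinearOrder α] [LinearOrder β] [WellFoundedLT α]
    [WellFoundedLT β] (hα : ∀ a : α, #(Set.Iio a) < #α) (hβ : ∀ b : β, #(Set.Iio b) < #β)
    (h : #α = #β) : ∃ θ : α ≃ β, ∀ a b, a < b ↔ θ a < θ b := by
  rcases InitialSeg.total (· < · : α → α → Prop) (· < · : β → β → Prop) with f | f
  · rcases f.principalSumRelIso with g | g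
    · exact ((isEmpty_principalSeg hβ h).false g).elim
    · exact ⟨g.toEquiv, fun a b => g.map_rel_iff.symm⟩
  · rcases f.principalSumRelIso with g | g
    · exact ((isEmpty_principalSeg hα h.symm).false g).elim
    · exact ⟨g.toEquiv.symm, fun a b => g.symm.map_rel_iff.symm⟩

theorem kap_lt_beth : kap L < Cardinal.beth ((Order.succ ((2 : Cardinal.{u}) ^ kap L)).ord) := by
  have h1 : kap L < Order.succ ((2 : Cardinal.{u}) ^ kap L) :=
    (Cardinal.cantor _).trans (Order.lt_succ _)
  refine h1.trans_le ?_
  have hm : StrictMono fun o : Ordinal.{u} => (Cardinal.beth o).ord :=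
    Cardinal.ord_strictMono.comp Cardinal.beth_strictMono
  exact Cardinal.ord_le_ord.1 (hm.le_apply (x := (Order.succ ((2 : Cardinal.{u}) ^ kap L)).ord))

namespace Ctx

variable {lam : Cardinal.{u}}

theorem realizes_one_types (C : Ctx K lam p) {N : StrucOf L} (hN : N ∈ K)
    (hNc : min lam (Cardinal.beth ((Order.succ ((2 : Cardinal.{u}) ^ kap L)).ord)) ≤ #N)
    {E : StrucOf L} (hE : E ∈ K) {A : Type u} (hA : #A ≤ kap L) (f : A → N) (g : A → E)
    (h : tp (L := L) f = tp g) (c : E) : ∃ b, tp1 (L := L) f b = tp1 g c := by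
  obtain ⟨M, hM, hMc, f', g', key⟩ :=
    exists_model_with_operations C.univ C.kap_lt.le hN hNc hA f fun _ => id
  have hf : tp (L := L) f' = tp f := by
    obtain ⟨m', h0⟩ := key (PEmpty.elim : PEmpty.{u + 1} → M)
    exact tp_comp h0 Sum.inl
  obtain ⟨b, hb⟩ := C.saturated hM hMc hE (hA.trans_lt C.kap_lt) f' g (hf.trans h) c
  obtain ⟨m', h0⟩ := key (fun _ : PUnit.{u + 1} => b)
  refine ⟨m' PUnit.unit, Eq.trans ?_ hb⟩
  exact (tp_reindex h0 (Sum.map id Sum.inl) (by rintro (z | z) <;> rfl)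
    (by rintro (z | z) <;> rfl)).symm

theorem exists_ind (C : Ctx K lam p) {N : StrucOf L} (hN : N ∈ K)
    (hNc : min lam (Cardinal.beth ((Order.succ ((2 : Cardinal.{u}) ^ kap L)).ord)) ≤ #N)
    {S : Type u} (hS : #S ≤ kap L) : ∃ h : S → N, Ind p h := by
  obtain ⟨M, hM, hMc, f', g', key⟩ :=
    exists_model_with_operations (A := PEmpty.{u + 1}) C.univ C.kap_lt.le hN hNc (by simp)
      PEmpty.elim fun _ => id
  have h0 : tp (L := L) (PEmpty.elim : PEmpty.{u + 1} → N) = tp f' := by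
    obtain ⟨m', h0⟩ := key (PEmpty.elim : PEmpty.{u + 1} → M)
    exact (tp_comp h0 Sum.inl).symm
  obtain ⟨i, hi, -⟩ := C.cat M hM hMc lam.out (Cardinal.mk_out _)
  have hSl : #S ≤ #lam.out := by
    rw [Cardinal.mk_out]
    exact hS.trans C.kap_lt.le
  obtain ⟨e⟩ := Cardinal.le_def _ _ |>.1 hSl
  obtain ⟨h, hh⟩ := exists_tuple_of_one_point (μ := Order.succ (kap L)) (M := N) (N := M)
    (fun f g hA hfg c => C.realizes_one_types hN hNc hM (Order.lt_succ_iff.1 hA) f g hfg c)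
    (A := PEmpty.{u + 1}) (D := S) (by simpa using hS) PEmpty.elim
    (Sum.elim f' (i ∘ e)) (by simpa using h0)
  exact ⟨h, (hi.comp e.injective).of_tp_eq (tp_comp hh Sum.inr)⟩

/-- The realizations of `Q` not generated by `h` and the earlier realizations. -/
def basis {S : Type u} (Q : Set (Atm L (S ⊕ PUnit.{u + 1}))) {N : Type u} [L.Structure N]
    [LinearOrder N] (h : S → N) : Set N :=
  {x | tp1 (L := L) h x = Q ∧
    x ∉ gen L (Sum.elim h (Subtype.val : {y | y < x ∧ tp1 (L := L) h y = Q} → N))}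

theorem gen_basis (C : Ctx K lam p) {S : Type u} {Q : Set (Atm L (S ⊕ PUnit.{u + 1}))}
    (hQ : UniqType K lam p S Q) {N : StrucOf L} (hN : N ∈ K)
    (hNc : min lam (Cardinal.beth ((Order.succ ((2 : Cardinal.{u}) ^ kap L)).ord)) ≤ #N)
    {h : S → N} (hh : Ind p h) [LinearOrder N] [WellFoundedLT N] :
    gen L (Sum.elim h (Subtype.val : basis Q h → N)) = ⊤ := by
  classical
  have hinf := hQ.inf
  have hreal : ∀ x, tp1 (L := L) h x = Q →
      x ∈ gen L (Sum.elim h (Subtype.val : basis Q h → N)) := by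
    intro x
    induction x using WellFoundedLT.induction with
    | ind x ih =>
      intro hx
      by_cases hxb : x ∈ basis Q h
      · exact apply_mem_gen (Sum.elim h (Subtype.val : basis Q h → N)) (Sum.inr ⟨x, hxb⟩)
      · have hx' : x ∈ gen L
            (Sum.elim h (Subtype.val : {y | y < x ∧ tp1 (L := L) h y = Q} → N)) := by
          by_contra hcon
          exact hxb ⟨hx, hcon⟩
        refine (gen_le.2 ?_ : gen L _ ≤ _) hx'
        rintro (k | ⟨y, hy, hyQ⟩)
        · exact apply_mem_gen (Sum.elim h (Subtype.val : basis Q h → N)) (Sum.inl k)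
        · exact ih y hy hyQ
  have henum : ∀ b : N, ∃ e : ℕ → N, b ∈ gen L (Sum.elim h (Subtype.val : basis Q h → N)) →
      (∀ k, e k ∈ gen L (Sum.elim h (Subtype.val : basis Q h → N))) ∧
        b ∈ gen L (Sum.elim h e) := by
    intro b
    by_cases hb : b ∈ gen L (Sum.elim h (Subtype.val : basis Q h → N))
    · obtain ⟨s, hs⟩ := exists_finset_mem_gen hb
      let s₀ : S := Classical.arbitrary S
      have hne : Nonempty (insert (Sum.inl s₀) s : Finset (S ⊕ basis Q h)) :=
        ⟨⟨Sum.inl s₀, Finset.mem_insert_self _ _⟩⟩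
      obtain ⟨e, he⟩ := exists_surjective_nat (insert (Sum.inl s₀) s : Finset (S ⊕ basis Q h))
      refine ⟨fun k => Sum.elim h Subtype.val (e k).1, fun _ => ⟨fun k => apply_mem_gen _ _, ?_⟩⟩
      refine (clo_le.2 ?_ : clo L _ _ ≤ _) hs
      intro k hk
      obtain ⟨z, hz⟩ := he ⟨k, Finset.mem_insert_of_mem hk⟩
      have := apply_mem_gen (L := L)
        (Sum.elim h fun k => Sum.elim h (Subtype.val : basis Q h → N) (e k).1) (Sum.inr z)
      simpa only [Sum.elim_inr, hz] using this
    · exact ⟨fun _ => b, fun h => absurd h hb⟩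
  choose gg hgg using henum
  by_contra hne
  obtain ⟨c, hc⟩ : ∃ c, c ∉ gen L (Sum.elim h (Subtype.val : basis Q h → N)) := by
    by_contra hall
    push Not at hall
    exact hne (eq_top_iff.2 fun x _ => hall x)
  have hA : #(S ⊕ PUnit.{u + 1}) ≤ kap L := by
    refine le_trans ?_ (aleph0_le_kap (L := L))
    rw [Cardinal.mk_sum]
    simpa using hQ.count
  obtain ⟨M, hM, hMc, f', g', key⟩ := exists_model_with_operations C.univ C.kap_lt.le hN hNc hA
    (Sum.elim h fun _ => c) fun k b => gg b k
  have hf : tp (L := L) (f' ∘ Sum.inl) = tp h := by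
    obtain ⟨m', h0⟩ := key (PEmpty.elim : PEmpty.{u + 1} → M)
    exact tp_comp h0 (Sum.inl ∘ Sum.inl)
  have hh' : Ind p (f' ∘ Sum.inl) := hh.of_tp_eq hf
  let R : Set M := {r | tp1 (L := L) (f' ∘ Sum.inl) r = Q}
  let F : S ⊕ (ℕ × R) → M := Sum.elim (f' ∘ Sum.inl) fun z => g' z.1 z.2
  have hpull : ∀ {W : Type u} [Finite W] (m : W → R), ∃ m' : W → N,
      tp (L := L) (Sum.elim f' (Sum.elim (fun w => (m w : M)) fun z : ℕ × W => g' z.1 (m z.2))) =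
        tp (Sum.elim (Sum.elim h fun _ => c)
          (Sum.elim m' fun z : ℕ × W => gg (m' z.2) z.1)) ∧
      ∀ w, m' w ∈ gen L (Sum.elim h (Subtype.val : basis Q h → N)) := by
    intro W _ m
    obtain ⟨m', h0⟩ := key (fun w => (m w : M))
    refine ⟨m', h0, fun w => hreal _ (Eq.trans ?_ (m w).2)⟩
    exact (tp_reindex h0 (Sum.elim (Sum.inl ∘ Sum.inl) fun _ => Sum.inr (Sum.inl w))
      (by rintro (z | z) <;> rfl) (by rintro (z | z) <;> rfl)).symm
  have hRF : ∀ r ∈ R, r ∈ gen L F := by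
    intro r hr
    obtain ⟨m', h0, hm⟩ := hpull (fun _ : PUnit.{u + 1} => (⟨r, hr⟩ : R))
    have h1 := (hgg _ (hm PUnit.unit)).2
    have h2 : r ∈ gen L (Sum.elim (f' ∘ Sum.inl) fun k => g' k r) := by
      refine mem_gen_of_tp1_eq (Eq.symm ?_) h1
      exact tp_reindex h0 (Sum.elim (Sum.elim (Sum.inl ∘ Sum.inl) fun k =>
        Sum.inr (Sum.inr (k, PUnit.unit))) fun _ => Sum.inr (Sum.inl PUnit.unit))
        (by rintro ((z | z) | z) <;> rfl) (by rintro ((z | z) | z) <;> rfl)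
    refine (gen_le.2 ?_ : gen L _ ≤ _) h2
    rintro (k | k)
    · exact apply_mem_gen F (Sum.inl k)
    · exact apply_mem_gen F (Sum.inr (k, ⟨r, hr⟩))
  have hcF : f' (Sum.inr PUnit.unit) ∉ gen L F := by
    intro hcon
    obtain ⟨t, ht⟩ := exists_finset_mem_gen hcon
    have hfin : Finite {r : R | ∃ k, Sum.inr (k, r) ∈ t} := by
      refine Set.Finite.subset ((t.finite_toSet.preimage
        (Sum.inr_injective.injOn : Set.InjOn (Sum.inr : ℕ × R → S ⊕ (ℕ × R)) _)).image
          Prod.snd) ?_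
      rintro r ⟨k, hk⟩
      exact ⟨(k, r), hk, rfl⟩
    obtain ⟨m', h0, hm⟩ := hpull (fun w : {r : R | ∃ k, Sum.inr (k, r) ∈ t} => w.1)
    have h1 : f' (Sum.inr PUnit.unit) ∈ gen L (Sum.elim (f' ∘ Sum.inl)
        fun z : ℕ × {r : R | ∃ k, Sum.inr (k, r) ∈ t} => g' z.1 z.2.1) := by
      refine (clo_le.2 ?_ : clo L _ _ ≤ _) ht
      rintro (k | ⟨k, r⟩) hk
      · exact apply_mem_gen (Sum.elim (f' ∘ Sum.inl)
          fun z : ℕ × {r : R | ∃ k, Sum.inr (k, r) ∈ t} => g' z.1 z.2.1) (Sum.inl k)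
      · exact apply_mem_gen (Sum.elim (f' ∘ Sum.inl)
          fun z : ℕ × {r : R | ∃ k, Sum.inr (k, r) ∈ t} => g' z.1 z.2.1)
          (Sum.inr (k, ⟨r, k, hk⟩))
    have h2 : c ∈ gen L (Sum.elim h
        fun z : ℕ × {r : R | ∃ k, Sum.inr (k, r) ∈ t} => gg (m' z.2) z.1) := by
      refine mem_gen_of_tp1_eq ?_ h1
      exact tp_reindex h0 (Sum.elim (Sum.elim (Sum.inl ∘ Sum.inl) fun z =>
        Sum.inr (Sum.inr z)) fun _ => Sum.inl (Sum.inr PUnit.unit))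
        (by rintro ((z | z) | z) <;> rfl) (by rintro ((z | z) | z) <;> rfl)
    refine hc ((gen_le.2 ?_ : gen L _ ≤ _) h2)
    rintro (k | z)
    · exact apply_mem_gen (Sum.elim h (Subtype.val : basis Q h → N)) (Sum.inl k)
    · exact (hgg _ (hm z.2)).1 z.1
  have hB : #(gen L F) = lam := by
    refine le_antisymm ?_ (not_lt.1 fun hlt => ?_)
    · rw [← hMc]
      exact Cardinal.mk_le_of_injective Subtype.val_injective
    · obtain ⟨b, hb, hbn⟩ := hQ.nonalg M hM hMc _ hh' (Subtype.val : gen L F → M) hlt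
      exact hbn (apply_mem_gen (Sum.elim (f' ∘ Sum.inl) (Subtype.val : gen L F → M))
        (Sum.inr ⟨b, hRF b hb⟩))
  obtain ⟨b, -, hb, hbn⟩ := C.exists_new_realization hQ hM hh'
    (fun k => apply_mem_gen F (Sum.inl k)) hB hcF
  exact hbn (hRF b hb)

theorem tp_eq_of_independent {S : Type u} {Q : Set (Atm L (S ⊕ PUnit.{u + 1}))}
    (hQ : UniqType K lam p S Q) {N N' : StrucOf L} (hN : N ∈ K) (hN' : N' ∈ K) {h : S → N}
    {h' : S → N'} (hh : Ind p h) (hh' : Ind p h') {Λ : Type u} [LinearOrder Λ] {i : Λ → N}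
    {i' : Λ → N'} (hi : ∀ a, tp1 (L := L) h (i a) = Q) (hi' : ∀ a, tp1 (L := L) h' (i' a) = Q)
    (hn : ∀ a, i a ∉ gen L (Sum.elim h fun b : Set.Iio a => i b))
    (hn' : ∀ a, i' a ∉ gen L (Sum.elim h' fun b : Set.Iio a => i' b)) :
    tp (L := L) (Sum.elim h i) = tp (Sum.elim h' i') := by
  classical
  have hmain : ∀ s : Finset Λ, tp (L := L) (Sum.elim h fun k : s => i k) =
      tp (Sum.elim h' fun k : s => i' k) := by
    intro s
    induction s using Finset.induction_on_max with
    | empty =>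
      refine tp_reindex (hh.tp_eq hh') (Sum.elim id fun k => (Finset.notMem_empty _ k.2).elim)
        ?_ ?_
      all_goals
        rintro (z | ⟨z, hz⟩)
        · rfl
        · exact (Finset.notMem_empty _ hz).elim
    | insert a s has ih =>
      have hlt : ∀ {P : StrucOf L} (q : S → P) (j : Λ → P),
          gen L (Sum.elim q fun k : s => j k) ≤ gen L (Sum.elim q fun b : Set.Iio a => j b) := by
        intro P q j
        refine gen_le.2 ?_
        rintro (k | k)
        · exact apply_mem_gen (Sum.elim q fun b : Set.Iio a => j b) (Sum.inl k)
        · exact apply_mem_gen (Sum.elim q fun b : Set.Iio a => j b) (Sum.inr ⟨k, has k k.2⟩)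
      have h1 := hQ.uniq N hN N' hN' (D := s) _ _ ih hh (i a) (i' a)
        (fun hcon => hn a (hlt h i hcon)) (fun hcon => hn' a (hlt h' i' hcon)) (hi a) (hi' a)
      refine tp_reindex h1 (Sum.elim (Sum.inl ∘ Sum.inl) fun k : (insert a s : Finset Λ) =>
        if hk : k.1 ∈ s then Sum.inl (Sum.inr ⟨k, hk⟩) else Sum.inr PUnit.unit) ?_ ?_
      all_goals
        rintro (z | ⟨z, hz⟩)
        · rfl
        · by_cases hzs : z ∈ s
          · simp [hzs]
          · obtain rfl : z = a := (Finset.mem_insert.1 hz).resolve_right hzs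
            simp [hzs]
  refine tp_eq_of_finite fun s => ?_
  have hs : ∀ z : s, ∀ k, z.1 = Sum.inr k → k ∈ s.toRight := fun z k hk => by
    rw [Finset.mem_toRight, ← hk]; exact z.2
  refine tp_reindex (hmain s.toRight) (fun z : s => match hz : z.1 with
    | Sum.inl k => Sum.inl k
    | Sum.inr k => Sum.inr ⟨k, hs z k hz⟩) ?_ ?_
  all_goals
    rintro ⟨z | z, hz⟩ <;> rfl

theorem nonempty_equiv (C : Ctx K lam p) {N N' : StrucOf L} (hN : N ∈ K) (hN' : N' ∈ K)
    (hNc : min lam (Cardinal.beth ((Order.succ ((2 : Cardinal.{u}) ^ kap L)).ord)) ≤ #N)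
    (hc : #N = #N') : Nonempty (N ≃[L] N') := by
  classical
  obtain ⟨S, Q, hQ⟩ := C.exists_uniqType
  have hS : #S ≤ kap L := hQ.count.trans aleph0_le_kap
  have hk : kap L < #N := (lt_min C.kap_lt kap_lt_beth).trans_le hNc
  have hdata : ∀ {P : StrucOf L}, P ∈ K → #P = #N → ∃ (h : S → P) (Λ : Type u)
      (_ : LinearOrder Λ) (_ : WellFoundedLT Λ) (i : Λ → P), Ind p h ∧ #Λ = #N ∧
      (∀ a : Λ, #(Set.Iio a) < #Λ) ∧ (∀ a, tp1 (L := L) h (i a) = Q) ∧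
      (∀ a, i a ∉ gen L (Sum.elim h fun b : Set.Iio a => i b)) ∧
      gen L (Sum.elim h i) = ⊤ := by
    intro P hP hPc
    rw [← hPc] at hNc hk ⊢
    obtain ⟨h, hh⟩ := C.exists_ind hP hNc hS
    obtain ⟨lo, wf, hlo⟩ := exists_initial_wellOrder P
    have hg := C.gen_basis hQ hP hNc hh
    have hcard : #(basis Q h) = #P := by
      refine le_antisymm (Cardinal.mk_le_of_injective Subtype.val_injective) ?_
      have h1 := card_le_of_gen hg
      rw [Cardinal.mk_sum, Cardinal.lift_id, Cardinal.lift_id] at h1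
      by_contra! hlt
      refine h1.not_gt (max_lt (Cardinal.add_lt_of_lt (aleph0_le_kap.trans hk.le)
        (hS.trans_lt hk) hlt) hk)
    refine ⟨h, basis Q h, inferInstance, inferInstance, Subtype.val, hh, hcard, ?_,
      fun a => a.2.1, ?_, hg⟩
    · intro a
      rw [hcard]
      refine lt_of_le_of_lt ?_ (hlo a.1)
      let F : Set.Iio a → Set.Iio a.1 := fun b => ⟨b.1.1, b.2⟩
      have hF : Function.Injective F := by
        rintro ⟨⟨b, hb⟩, hba⟩ ⟨⟨c, hc⟩, hca⟩ hbc
        cases hbc; rfl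
      exact Cardinal.mk_le_of_injective hF
    · intro a hcon
      refine a.2.2 ((gen_le.2 ?_ : gen L _ ≤ _) hcon)
      rintro (k | b)
      · exact apply_mem_gen (Sum.elim h
          (Subtype.val : {y | y < a.1 ∧ tp1 (L := L) h y = Q} → P)) (Sum.inl k)
      · exact apply_mem_gen (Sum.elim h
          (Subtype.val : {y | y < a.1 ∧ tp1 (L := L) h y = Q} → P))
          (Sum.inr ⟨b.1.1, b.2, b.1.2.1⟩)
  obtain ⟨h, Λ, lo, wf, i, hh, hΛ, hΛi, hi, hin, hig⟩ := hdata hN rfl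
  obtain ⟨h', Λ', lo', wf', i', hh', hΛ', hΛi', hi', hin', hig'⟩ := hdata hN' hc.symm
  obtain ⟨θ, hθ⟩ := exists_orderIso hΛi hΛi' (hΛ.trans hΛ'.symm)
  have htp : tp (L := L) (Sum.elim h i) = tp (Sum.elim h' (i' ∘ θ)) := by
    refine tp_eq_of_independent hQ hN hN' hh hh' hi (fun a => hi' (θ a)) hin ?_
    intro a hcon
    refine hin' (θ a) ((gen_le.2 ?_ : gen L _ ≤ _) hcon)
    rintro (k | b)
    · exact apply_mem_gen (Sum.elim h' fun b : Set.Iio (θ a) => i' b) (Sum.inl k)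
    · exact apply_mem_gen (Sum.elim h' fun b : Set.Iio (θ a) => i' b)
        (Sum.inr ⟨θ b, (hθ _ _).1 b.2⟩)
  have htop : gen L (Sum.elim h' (i' ∘ θ)) = ⊤ := by
    rw [eq_top_iff, ← hig', gen_le]
    rintro (k | b)
    · exact apply_mem_gen (Sum.elim h' (i' ∘ θ)) (Sum.inl k)
    · have := apply_mem_gen (L := L) (Sum.elim h' (i' ∘ θ)) (Sum.inr (θ.symm b))
      simpa using this
  obtain ⟨e, -⟩ := exists_equiv_of_tp_eq htp hig htop
  exact ⟨e⟩

end Ctx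

theorem categorical_of_min_le (hK : IsUniversalClass L K) (hap : Amalgamation L K)
    (harb : ArbitrarilyLargeModels L K) {lam : Cardinal.{u}} (hlam : kap L < lam)
    (hcat : Categorical L K lam) {μ : Cardinal.{u}}
    (hμ : min lam (Cardinal.beth ((Order.succ ((2 : Cardinal.{u}) ^ kap L)).ord)) ≤ μ) :
    Categorical L K μ := by
  obtain ⟨p, C⟩ := exists_ctx hK hap harb hlam hcat
  constructor
  · obtain ⟨V, hV, i, hi, hg⟩ := C.free μ.out
    refine ⟨V, hV, (C.card_eq hi hg ?_).trans (Cardinal.mk_out _)⟩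
    rw [Cardinal.mk_out]
    exact ((lt_min C.kap_lt kap_lt_beth).trans_le hμ).le
  · intro M hM N hN hMc hNc
    exact C.nonempty_equiv hM hN (hμ.trans_eq hMc.symm) (hMc.trans hNc.symm)

end Isomorphism

/-- Let `K` be a universal class with amalgamation and arbitrarily large
models.  If `K` is categorical in some `λ > LS(K)` (where `LS(K) = |τ(K)| + ℵ₀`), then `K` is
categorical in every `λ' ≥ min (λ, ℶ_{(2^{LS(K)})⁺})`. -/
theorem categoricity_transfer_universal_class (K : Set (StrucOf L))
    (huniv : IsUniversalClass L K)
    (hap : Amalgamation L K) (harb : ArbitrarilyLargeModels L K)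
    (lam : Cardinal.{u}) (hlam : L.card + ℵ₀ < lam)
    (hcat : Categorical L K lam) :
    ∀ lam' : Cardinal.{u},
      min lam (Cardinal.beth ((Order.succ ((2 : Cardinal.{u}) ^ (L.card + ℵ₀))).ord)) ≤ lam' →
      Categorical L K lam' := by
  exact fun _ => categorical_of_min_le huniv hap harb hlam hcat

end StrucOf
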